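/- arXiv:1211.5804 — 6 statements merged into one kernel-verified Lean document; each statement's English description precedes it below -/
import Mathlib

section
/- Assume (H1). Then every BV function x:[0,T]→ℝ satisfying the weak local stability and the energy-dissipation upper bound is of class SBV, i.e. the distributional derivative measure μ of x has no Cantor part: μ decomposes as f·dt plus an atomic measure concentrated on the jump set J of x, with f∈L¹. -/
open Set Filter Topology MeasureTheory

/-- Dissipation of `x` on `[t₁,t₂]`: total variation of `x` on the interval. -/
noncomputable def Diss (x : ℝ → ℝ) (t₁ t₂ : ℝ) : ℝ :=
  (eVariationOn x (Set.Icc t₁ t₂)).toReal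

/-- ∂ₓ𝓔 -/
noncomputable def pEx (E : ℝ → ℝ → ℝ) (t y : ℝ) : ℝ := deriv (fun z => E t z) y
/-- ∂ₜ𝓔 -/
noncomputable def pEt (E : ℝ → ℝ → ℝ) (t y : ℝ) : ℝ := deriv (fun s => E s y) t
/-- ∂ₓₓ𝓔 -/
noncomputable def pExx (E : ℝ → ℝ → ℝ) (t y : ℝ) : ℝ := deriv (fun z => pEx E t z) y
/-- ∂ₓₓₓ𝓔 -/
noncomputable def pExxx (E : ℝ → ℝ → ℝ) (t y : ℝ) : ℝ := deriv (fun z => pExx E t z) y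
/-- ∂ₓₜ𝓔 -/
noncomputable def pExt (E : ℝ → ℝ → ℝ) (t y : ℝ) : ℝ := deriv (fun s => pEx E s y) t
/-- ∂ₓₓₜ𝓔 -/
noncomputable def pExxt (E : ℝ → ℝ → ℝ) (t y : ℝ) : ℝ := deriv (fun s => pExx E s y) t
/-- ∂ₓₜₜ𝓔 -/
noncomputable def pExtt (E : ℝ → ℝ → ℝ) (t y : ℝ) : ℝ := deriv (fun s => pExt E s y) t

/-- The jump set of `x` on `[0,T]`: points of discontinuity. -/
def JumpSet (x : ℝ → ℝ) (T : ℝ) : Set ℝ :=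
  {t ∈ Set.Icc 0 T | ¬ ContinuousWithinAt x (Set.Icc 0 T) t}

/-- N := {t ∈ (0,T) : x'(t) exists and equals 0}. -/
def NullSet (x : ℝ → ℝ) (T : ℝ) : Set ℝ :=
  {t ∈ Set.Ioo 0 T | HasDerivAt x 0 t}

/-- Weak local stability: |∂ₓ𝓔(t,x(t))| ≤ 1 at every continuity point of x in [0,T]. -/
def WeakLS (E : ℝ → ℝ → ℝ) (x : ℝ → ℝ) (T : ℝ) : Prop :=
  ∀ t ∈ Set.Icc 0 T, ContinuousWithinAt x (Set.Icc 0 T) t → |pEx E t (x t)| ≤ 1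

/-- Strong local stability: x(t) local minimizer of z ↦ 𝓔(t,z)+|z−x(t)| off the jump set. -/
def StrongLS (E : ℝ → ℝ → ℝ) (x : ℝ → ℝ) (T : ℝ) : Prop :=
  ∀ t ∈ Set.Icc 0 T \ JumpSet x T, IsLocalMin (fun z => E t z + |z - x t|) (x t)

/-- Energy-dissipation upper bound. -/
def EDUB (E : ℝ → ℝ → ℝ) (x : ℝ → ℝ) (T : ℝ) : Prop :=
  ∀ t₁ t₂ : ℝ, 0 ≤ t₁ → t₁ ≤ t₂ → t₂ ≤ T →
    E t₂ (x t₂) - E t₁ (x t₁) ≤ (∫ s in t₁..t₂, pEt E s (x s)) - Diss x t₁ t₂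

/-- (H1): {(t,x) ∈ (0,T)×ℝ : ∂ₓ𝓔 ∈ {−1,1}, ∂ₓₓ𝓔 = ∂ₓₓₓ𝓔 = 0} is finite. -/
def H1cond (E : ℝ → ℝ → ℝ) (T : ℝ) : Prop :=
  {p : ℝ × ℝ | p.1 ∈ Set.Ioo 0 T ∧ (pEx E p.1 p.2 = -1 ∨ pEx E p.1 p.2 = 1) ∧
    pExx E p.1 p.2 = 0 ∧ pExxx E p.1 p.2 = 0}.Finite

/-- (H2). -/
def H2cond (E : ℝ → ℝ → ℝ) (T : ℝ) : Prop :=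
  {p : ℝ × ℝ | p.1 ∈ Set.Ioo 0 T ∧ (pEx E p.1 p.2 = -1 ∨ pEx E p.1 p.2 = 1) ∧
    pExx E p.1 p.2 = 0 ∧ pExt E p.1 p.2 = 0 ∧
    (pExxt E p.1 p.2) ^ 2 = pExtt E p.1 p.2 * pExxx E p.1 p.2}.Finite

/-- (H3). -/
def H3cond (E : ℝ → ℝ → ℝ) (T : ℝ) : Prop :=
  {p : ℝ × ℝ | p.1 ∈ Set.Ioo 0 T ∧ (pEx E p.1 p.2 = -1 ∨ pEx E p.1 p.2 = 1) ∧
    pExx E p.1 p.2 = 0 ∧ pExt E p.1 p.2 = 0}.Finite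

/-- (H4). -/
def H4cond (E : ℝ → ℝ → ℝ) (T : ℝ) : Prop :=
  {p : ℝ × ℝ | p.1 ∈ Set.Icc 0 T ∧ (pEx E p.1 p.2 = -1 ∨ pEx E p.1 p.2 = 1) ∧
    pExt E p.1 p.2 = 0 ∧ pExtt E p.1 p.2 = 0} = ∅

/-- (H5). -/
def H5cond (E : ℝ → ℝ → ℝ) (T : ℝ) : Prop :=
  {p : ℝ × ℝ | p.1 ∈ Set.Icc 0 T ∧ (pEx E p.1 p.2 = -1 ∨ pEx E p.1 p.2 = 1) ∧
    pExx E p.1 p.2 = 0} = ∅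

theorem hasDerivAt_snd_of_hasFDerivAt {F : ℝ → ℝ → ℝ} {t y : ℝ} {F' : ℝ × ℝ →L[ℝ] ℝ}
    (h : HasFDerivAt (Function.uncurry F) F' (t, y)) :
    HasDerivAt (fun z => F t z) (F' (0, 1)) y :=
  HasFDerivAt.comp_hasDerivAt (f := fun z : ℝ => (t, z)) y h
    ((hasDerivAt_const y t).prodMk (hasDerivAt_id y))

theorem hasDerivAt_fst_of_hasFDerivAt {F : ℝ → ℝ → ℝ} {t y : ℝ} {F' : ℝ × ℝ →L[ℝ] ℝ}
    (h : HasFDerivAt (Function.uncurry F) F' (t, y)) :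
    HasDerivAt (fun s => F s y) (F' (1, 0)) t :=
  HasFDerivAt.comp_hasDerivAt (f := fun s : ℝ => (s, y)) t h
    ((hasDerivAt_id t).prodMk (hasDerivAt_const t y))

theorem pEx_eq_fderiv {F : ℝ → ℝ → ℝ} (hF : ContDiff ℝ 1 (Function.uncurry F)) (t y : ℝ) :
    pEx F t y = fderiv ℝ (Function.uncurry F) (t, y) (0, 1) :=
  (hasDerivAt_snd_of_hasFDerivAt
    (hF.differentiable one_ne_zero (t, y)).hasFDerivAt).deriv

theorem pEt_eq_fderiv {F : ℝ → ℝ → ℝ} (hF : ContDiff ℝ 1 (Function.uncurry F)) (t y : ℝ) :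
    pEt F t y = fderiv ℝ (Function.uncurry F) (t, y) (1, 0) :=
  (hasDerivAt_fst_of_hasFDerivAt
    (hF.differentiable one_ne_zero (t, y)).hasFDerivAt).deriv

theorem contDiff_pEx {F : ℝ → ℝ → ℝ} {n : ℕ}
    (hF : ContDiff ℝ (n + 1) (Function.uncurry F)) :
    ContDiff ℝ n (Function.uncurry (pEx F)) := by
  have h1 : ContDiff ℝ 1 (Function.uncurry F) := hF.of_le le_add_self
  have : Function.uncurry (pEx F) = fun p => fderiv ℝ (Function.uncurry F) p (0, 1) := by
    ext ⟨t, y⟩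
    exact pEx_eq_fderiv h1 t y
  rw [this]
  exact (hF.fderiv_right le_rfl).clm_apply contDiff_const

theorem continuous_pEt {F : ℝ → ℝ → ℝ} (hF : ContDiff ℝ 1 (Function.uncurry F)) :
    Continuous (Function.uncurry (pEt F)) := by
  have : Function.uncurry (pEt F) = fun p => fderiv ℝ (Function.uncurry F) p (1, 0) := by
    ext ⟨t, y⟩
    exact pEt_eq_fderiv hF t y
  rw [this]
  exact (hF.continuous_fderiv one_ne_zero).clm_apply continuous_const

/-- A strict derivative controls difference quotients taken with an arbitrary normalization. -/
theorem HasStrictFDerivAt.tendsto_smul_sub {α V W : Type*} [NormedAddCommGroup V]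
    [NormedSpace ℝ V] [NormedAddCommGroup W] [NormedSpace ℝ W] {G : V → W} {G' : V →L[ℝ] W}
    {p w : V} (hG : HasStrictFDerivAt G G' p) {l : Filter α} {u v : α → V} {k : α → ℝ}
    (hu : Tendsto u l (𝓝 p)) (hv : Tendsto v l (𝓝 p))
    (huv : Tendsto (fun r => k r • (u r - v r)) l (𝓝 w)) :
    Tendsto (fun r => k r • (G (u r) - G (v r))) l (𝓝 (G' w)) := by
  have h1 := hG.isLittleO.comp_tendsto (hu.prodMk_nhds hv)
  have h2 := (Asymptotics.isBigO_refl k l).smul_isLittleO h1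
  have h3 : Tendsto (fun r => k r • (G (u r) - G (v r) - G' (u r - v r))) l (𝓝 0) :=
    (Asymptotics.isLittleO_one_iff ℝ).1 (h2.trans_isBigO (huv.isBigO_one ℝ))
  have h4 := h3.add ((G'.continuous.tendsto w).comp huv)
  rw [zero_add] at h4
  refine h4.congr fun r => ?_
  simp [smul_sub]

section Density

variable {μ : SignedMeasure ℝ} {K : Set ℝ} {σ : ℝ}

instance MeasureTheory.SignedMeasure.isFiniteMeasure_totalVariation (μ : SignedMeasure ℝ) :
    IsFiniteMeasure μ.totalVariation := by
  unfold SignedMeasure.totalVariation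
  infer_instance

theorem ae_tendsto_div_totalVariation_closedBall (hK : MeasurableSet K) (hK0 : volume K = 0) :
    ∀ᵐ t ∂μ.totalVariation, t ∈ K →
      Tendsto (fun r => (μ.totalVariation.real (Metric.closedBall t r))⁻¹ * r)
        (𝓝[>] 0) (𝓝 0) ∧
      Tendsto (fun r => (μ.totalVariation.real (Metric.closedBall t r))⁻¹ *
        μ.totalVariation.real (Metric.closedBall t r \ K)) (𝓝[>] 0) (𝓝 0) ∧
      ∀ᶠ r in 𝓝[>] (0 : ℝ), 0 < μ.totalVariation.real (Metric.closedBall t r) := by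
  set ν := μ.totalVariation
  have hrn : ∀ᵐ t ∂ν, t ∈ K → (volume : Measure ℝ).rnDeriv ν t = 0 := by
    rw [← ae_restrict_iff' hK]
    refine (lintegral_eq_zero_iff (Measure.measurable_rnDeriv _ _)).1 ?_
    exact le_antisymm ((Measure.setLIntegral_rnDeriv_le K).trans_eq hK0) zero_le
  filter_upwards [hrn, Besicovitch.ae_tendsto_rnDeriv (volume : Measure ℝ) ν,
    Besicovitch.ae_tendsto_measure_inter_div_of_measurableSet ν hK] with t h0 h1 h2 ht
  rw [h0 ht] at h1
  simp only [indicator_of_mem ht, Pi.one_apply] at h2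
  have hpos : ∀ᶠ r in 𝓝[>] (0 : ℝ), 0 < ν.real (Metric.closedBall t r) := by
    filter_upwards [h2.eventually_ne one_ne_zero] with r hr
    refine ENNReal.toReal_pos (fun h => hr ?_) (measure_ne_top _ _)
    rw [measure_mono_null inter_subset_right h, ENNReal.zero_div]
  refine ⟨?_, ?_, hpos⟩
  · have h3 := ((ENNReal.tendsto_toReal ENNReal.zero_ne_top).comp h1).div_const 2
    rw [ENNReal.toReal_zero, zero_div] at h3
    refine h3.congr' ?_
    filter_upwards [self_mem_nhdsWithin] with r hr
    rw [mem_Ioi] at hr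
    simp only [Function.comp_apply, Real.volume_closedBall, ENNReal.toReal_div,
      ENNReal.toReal_ofReal (by positivity : 0 ≤ 2 * r), Measure.real]
    ring
  · have h3 := ((ENNReal.tendsto_toReal ENNReal.one_ne_top).comp h2).const_sub 1
    rw [ENNReal.toReal_one, sub_self] at h3
    refine h3.congr' ?_
    filter_upwards [hpos] with r hr
    have h4 : ν.real (Metric.closedBall t r ∩ K) + ν.real (Metric.closedBall t r \ K) =
        ν.real (Metric.closedBall t r) := measureReal_inter_add_sdiff hK
    have h5 : ν.real (Metric.closedBall t r \ K) =
        ν.real (Metric.closedBall t r) - ν.real (Metric.closedBall t r ∩ K) := by linarith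
    rw [h5, inter_comm]
    simp only [Function.comp_apply, ENNReal.toReal_div]
    change 1 - ν.real _ / ν.real _ = _
    field_simp

theorem abs_sub_mul_totalVariation_le (hK : MeasurableSet K) (hσ : |σ| = 1)
    (hμK : ∀ D ⊆ K, MeasurableSet D → μ D = σ * μ.totalVariation.real D)
    {B C : Set ℝ} (hC : MeasurableSet C) (hCB : C ⊆ B)
    (h0 : μ.totalVariation ((B ∩ K) \ C) = 0) :
    |μ C - σ * μ.totalVariation.real B| ≤ 2 * μ.totalVariation.real (B \ K) := by
  set ν := μ.totalVariation
  have h1 : μ C = μ (C ∩ K) + μ (C \ K) := by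
    rw [← VectorMeasure.of_union
      (disjoint_sdiff_right.mono_left inter_subset_right) (hC.inter hK) (hC.diff hK),
      inter_union_sdiff]
  have h2 : ν.real (C ∩ K) = ν.real (B ∩ K) := by
    refine le_antisymm (measureReal_mono (inter_subset_inter_left _ hCB)) ?_
    have h : B ∩ K ⊆ (C ∩ K) ∪ ((B ∩ K) \ C) := by
      intro z hz
      by_cases hzC : z ∈ C
      · exact Or.inl ⟨hzC, hz.2⟩
      · exact Or.inr ⟨hz, hzC⟩
    calc ν.real (B ∩ K) ≤ ν.real ((C ∩ K) ∪ ((B ∩ K) \ C)) := measureReal_mono h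
      _ ≤ ν.real (C ∩ K) + ν.real ((B ∩ K) \ C) := measureReal_union_le _ _
      _ = ν.real (C ∩ K) := by simp [Measure.real, h0]
  have h3 : ν.real (B ∩ K) + ν.real (B \ K) = ν.real B := measureReal_inter_add_sdiff hK
  have h4 : |μ (C \ K)| ≤ ν.real (B \ K) :=
    (μ.norm_le_totalVariation (C \ K)).trans (measureReal_mono (sdiff_subset_sdiff_left hCB))
  rw [h1, hμK _ inter_subset_right (hC.inter hK), h2, ← h3]
  calc |σ * ν.real (B ∩ K) + μ (C \ K) - σ * (ν.real (B ∩ K) + ν.real (B \ K))|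
      = |μ (C \ K) - σ * ν.real (B \ K)| := by ring_nf
    _ ≤ |μ (C \ K)| + |σ * ν.real (B \ K)| := abs_sub _ _
    _ ≤ 2 * ν.real (B \ K) := by
      rw [abs_mul, hσ, abs_of_nonneg measureReal_nonneg]
      linarith

end Density

section Singular

variable {T c σ : ℝ} {x : ℝ → ℝ} {μ : SignedMeasure ℝ} {K : Set ℝ}

theorem sub_eq_signedMeasure_Ioc (hμ : ∀ t ∈ Icc 0 T, x t = c + μ (Ioc 0 t)) {a b : ℝ}
    (ha : 0 ≤ a) (hab : a ≤ b) (hb : b ≤ T) : x b - x a = μ (Ioc a b) := by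
  rw [hμ b ⟨ha.trans hab, hb⟩, hμ a ⟨ha, hab.trans hb⟩, ← Ioc_union_Ioc_eq_Ioc ha hab,
    VectorMeasure.of_union (Ioc_disjoint_Ioc_of_le le_rfl) measurableSet_Ioc measurableSet_Ioc]
  ring

/-- `K` is a compact Lebesgue-null set of interior continuity points of `x` on which `μ` has the
constant sign `σ`. -/
structure IsSingularPiece (T : ℝ) (x : ℝ → ℝ) (μ : SignedMeasure ℝ) (σ : ℝ) (K : Set ℝ) :
    Prop where
  isCompact : IsCompact K
  subset_Ioo : K ⊆ Ioo 0 T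
  continuousAt : ∀ t ∈ K, ContinuousAt x t
  volume_eq_zero : volume K = 0
  abs_sign : |σ| = 1
  apply_eq : ∀ D ⊆ K, MeasurableSet D → μ D = σ * μ.totalVariation.real D

namespace IsSingularPiece

theorem mono {L : Set ℝ} (hK : IsSingularPiece T x μ σ K) (hL : IsCompact L) (hLK : L ⊆ K) :
    IsSingularPiece T x μ σ L where
  isCompact := hL
  subset_Ioo := hLK.trans hK.subset_Ioo
  continuousAt t ht := hK.continuousAt t (hLK ht)
  volume_eq_zero := measure_mono_null hLK hK.volume_eq_zero
  abs_sign := hK.abs_sign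
  apply_eq D hD := hK.apply_eq D (hD.trans hLK)

theorem continuousOn (hK : IsSingularPiece T x μ σ K) : ContinuousOn x K :=
  fun t ht => (hK.continuousAt t ht).continuousWithinAt

theorem totalVariation_singleton (hK : IsSingularPiece T x μ σ K)
    (hμ : ∀ t ∈ Icc 0 T, x t = c + μ (Ioc 0 t)) {t : ℝ} (ht : t ∈ K) :
    μ.totalVariation {t} = 0 := by
  obtain ⟨u, hu_mono, hu_lt, hu_lim⟩ := exists_seq_strictMono_tendsto' (hK.subset_Ioo ht).1
  have hInter : ⋂ n, Ioc (u n) t = {t} := by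
    ext z
    simp only [mem_iInter, mem_Ioc, mem_singleton_iff]
    refine ⟨fun h => le_antisymm (h 0).2 (le_of_tendsto' hu_lim fun n => (h n).1.le), ?_⟩
    rintro rfl n
    exact ⟨(hu_lt n).2, le_rfl⟩
  have h1 : Tendsto (fun n => μ (Ioc (u n) t)) atTop (𝓝 (μ {t})) := by
    rw [← hInter]
    exact VectorMeasure.tendsto_vectorMeasure_iInter_atTop_nat
      (fun m n hmn => Ioc_subset_Ioc_left (hu_mono.monotone hmn)) fun n => measurableSet_Ioc
  have h2 : Tendsto (fun n => x t - x (u n)) atTop (𝓝 (x t - x t)) :=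
    tendsto_const_nhds.sub ((hK.continuousAt t ht).tendsto.comp hu_lim)
  have h3 : μ {t} = x t - x t := by
    refine tendsto_nhds_unique h1 (h2.congr fun n => ?_)
    exact sub_eq_signedMeasure_Ioc hμ (hu_lt n).1.le (hu_lt n).2.le (hK.subset_Ioo ht).2.le
  rw [sub_self, hK.apply_eq {t} (singleton_subset_iff.2 ht) (measurableSet_singleton t)] at h3
  have hσ : σ ≠ 0 := by
    rintro rfl
    simpa using hK.abs_sign
  exact (measureReal_eq_zero_iff).1 ((mul_eq_zero.1 h3).resolve_left hσ)

/-- Difference quotients of `G (s, x s)` with respect to the total variation of `μ`, along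
intervals that exhaust `K` near `t`, only see the partial derivative of `G` in the state
variable. -/
theorem ae_tendsto_quotient (hK : IsSingularPiece T x μ σ K)
    (hμ : ∀ t ∈ Icc 0 T, x t = c + μ (Ioc 0 t)) :
    ∀ᵐ t ∂μ.totalVariation, t ∈ K →
      Tendsto (fun r => (μ.totalVariation.real (Metric.closedBall t r))⁻¹ * r)
        (𝓝[>] 0) (𝓝 0) ∧
      ∀ a b : ℝ → ℝ, (∀ᶠ r in 𝓝[>] (0 : ℝ), a r ∈ Metric.closedBall t r ∧
          b r ∈ Metric.closedBall t r ∧ a r ≤ b r ∧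
          μ.totalVariation ((Metric.closedBall t r ∩ K) \ Ioc (a r) (b r)) = 0) →
        ∀ (G : ℝ × ℝ → ℝ) (G' : ℝ × ℝ →L[ℝ] ℝ), HasStrictFDerivAt G G' (t, x t) →
          Tendsto (fun r => (μ.totalVariation.real (Metric.closedBall t r))⁻¹ *
            (G (b r, x (b r)) - G (a r, x (a r)))) (𝓝[>] 0) (𝓝 (σ * G' (0, 1))) := by
  have hKm := hK.isCompact.measurableSet
  filter_upwards [ae_tendsto_div_totalVariation_closedBall (μ := μ) hKm hK.volume_eq_zero]
    with t h htK
  obtain ⟨hr, hd, hpos⟩ := h htK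
  refine ⟨hr, fun a b hab G G' hG => ?_⟩
  set N : ℝ → ℝ := fun r => μ.totalVariation.real (Metric.closedBall t r)
  have hr0 : Tendsto (fun r : ℝ => r) (𝓝[>] 0) (𝓝 0) := tendsto_nhdsWithin_of_tendsto_nhds
    tendsto_id
  have ht := hK.subset_Ioo htK
  have hball : ∀ {f : ℝ → ℝ}, (∀ᶠ r in 𝓝[>] (0 : ℝ), f r ∈ Metric.closedBall t r) →
      Tendsto (fun r => (f r, x (f r))) (𝓝[>] 0) (𝓝 (t, x t)) := by
    intro f hf
    have h1 : Tendsto f (𝓝[>] 0) (𝓝 t) :=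
      tendsto_iff_dist_tendsto_zero.2 (squeeze_zero' (Eventually.of_forall fun _ => dist_nonneg)
        hf hr0)
    exact h1.prodMk_nhds ((hK.continuousAt t htK).tendsto.comp h1)
  have ha := hball (hab.mono fun r h => h.1)
  have hb := hball (hab.mono fun r h => h.2.1)
  have hsmall : ∀ᶠ r in 𝓝[>] (0 : ℝ), Metric.closedBall t r ⊆ Icc 0 T := by
    filter_upwards [hr0.eventually (gt_mem_nhds (sub_pos.2 ht.2)),
      hr0.eventually (gt_mem_nhds ht.1)] with r h1 h2
    rw [Real.closedBall_eq_Icc]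
    exact Icc_subset_Icc (by linarith) (by linarith)
  have hT : Tendsto (fun r => (N r)⁻¹ * (b r - a r)) (𝓝[>] 0) (𝓝 0) := by
    have h2 := hr.const_mul 2
    rw [mul_zero] at h2
    refine squeeze_zero' ?_ ?_ h2
    · filter_upwards [hab, hpos] with r h hp
      exact mul_nonneg (inv_nonneg.2 hp.le) (sub_nonneg.2 h.2.2.1)
    · filter_upwards [hab, hpos] with r h hp
      rw [Real.closedBall_eq_Icc] at h
      calc (N r)⁻¹ * (b r - a r) ≤ (N r)⁻¹ * (2 * r) :=
            mul_le_mul_of_nonneg_left (by linarith [h.1.1, h.2.1.2]) (inv_nonneg.2 hp.le)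
        _ = 2 * ((N r)⁻¹ * r) := by ring
  have hX : Tendsto (fun r => (N r)⁻¹ * (x (b r) - x (a r))) (𝓝[>] 0) (𝓝 σ) := by
    have h2 := hd.const_mul 2
    rw [mul_zero] at h2
    refine tendsto_iff_dist_tendsto_zero.2
      (squeeze_zero' (Eventually.of_forall fun _ => dist_nonneg) ?_ h2)
    filter_upwards [hab, hpos, hsmall] with r h hp hs
    have hC : Ioc (a r) (b r) ⊆ Metric.closedBall t r := by
      have h' := h
      rw [Real.closedBall_eq_Icc] at h' ⊢
      exact fun z hz => ⟨h'.1.1.trans hz.1.le, hz.2.trans h'.2.1.2⟩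
    have h3 := abs_sub_mul_totalVariation_le hKm hK.abs_sign hK.apply_eq
      measurableSet_Ioc hC h.2.2.2
    rw [sub_eq_signedMeasure_Ioc hμ (hs h.1).1 h.2.2.1 (hs h.2.1).2, Real.dist_eq]
    have h4 : (N r)⁻¹ * μ (Ioc (a r) (b r)) - σ =
        (N r)⁻¹ * (μ (Ioc (a r) (b r)) - σ * N r) := by
      have hNr : N r ≠ 0 := hp.ne'
      field_simp
    rw [h4, abs_mul, abs_of_nonneg (inv_nonneg.2 hp.le)]
    calc (N r)⁻¹ * |μ (Ioc (a r) (b r)) - σ * N r| ≤ (N r)⁻¹ *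
          (2 * μ.totalVariation.real (Metric.closedBall t r \ K)) :=
          mul_le_mul_of_nonneg_left h3 (inv_nonneg.2 hp.le)
      _ = _ := by ring
  have h5 := hG.tendsto_smul_sub (k := fun r => (N r)⁻¹) (w := (0, σ)) hb ha
    (hT.prodMk_nhds hX)
  have h6 : ((0 : ℝ), σ) = σ • ((0 : ℝ), (1 : ℝ)) := by simp
  rwa [h6, map_smul, smul_eq_mul] at h5

/-- If `G (t, x t)` is constant on `K`, then its partial derivative in the state variable vanishes
almost everywhere on `K`. -/
theorem ae_pEx_eq_zero (hK : IsSingularPiece T x μ σ K)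
    (hμ : ∀ t ∈ Icc 0 T, x t = c + μ (Ioc 0 t)) {F : ℝ → ℝ → ℝ}
    (hF : ContDiff ℝ 1 (Function.uncurry F)) {k : ℝ} (hk : ∀ t ∈ K, F t (x t) = k) :
    ∀ᵐ t ∂μ.totalVariation, t ∈ K → pEx F t (x t) = 0 := by
  filter_upwards [hK.ae_tendsto_quotient hμ] with t h htK
  have hcomp : ∀ r : ℝ, IsCompact (Metric.closedBall t r ∩ K) := fun r =>
    hK.isCompact.inter_left Metric.isClosed_closedBall
  have hne : ∀ r : ℝ, 0 < r → (Metric.closedBall t r ∩ K).Nonempty := fun r hr =>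
    ⟨t, Metric.mem_closedBall_self hr.le, htK⟩
  have hmin : ∀ r : ℝ, 0 < r → sInf (Metric.closedBall t r ∩ K) ∈ Metric.closedBall t r ∩ K :=
    fun r hr => (hcomp r).sInf_mem (hne r hr)
  have hmax : ∀ r : ℝ, 0 < r → sSup (Metric.closedBall t r ∩ K) ∈ Metric.closedBall t r ∩ K :=
    fun r hr => (hcomp r).sSup_mem (hne r hr)
  have h1 := (h htK).2 (fun r => sInf (Metric.closedBall t r ∩ K))
    (fun r => sSup (Metric.closedBall t r ∩ K)) (by
      filter_upwards [self_mem_nhdsWithin] with r hr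
      refine ⟨(hmin r hr).1, (hmax r hr).1,
        csInf_le_csSup (hne r hr) (hcomp r).bddBelow (hcomp r).bddAbove, ?_⟩
      refine measure_mono_null (fun z hz => ?_) (hK.totalVariation_singleton hμ (hmin r hr).2)
      have h2 := csInf_le (hcomp r).bddBelow hz.1
      have h3 := le_csSup (hcomp r).bddAbove hz.1
      by_contra hne
      exact hz.2 ⟨lt_of_le_of_ne h2 (Ne.symm hne), h3⟩)
    _ _ (hF.hasStrictFDerivAt one_ne_zero)
  have h2 : σ * fderiv ℝ (Function.uncurry F) (t, x t) (0, 1) = 0 := by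
    refine tendsto_nhds_unique h1 (tendsto_const_nhds.congr' ?_)
    filter_upwards [self_mem_nhdsWithin] with r hr
    simp [hk _ (hmin r hr).2, hk _ (hmax r hr).2]
  have hσ : σ ≠ 0 := by
    rintro rfl
    simpa using hK.abs_sign
  rw [pEx_eq_fderiv hF]
  exact (mul_eq_zero.1 h2).resolve_left hσ

/-- The energy-dissipation upper bound forces `σ ∂ₓ𝓔 ≤ -1` almost everywhere on `K`. -/
theorem ae_mul_pEx_le (hK : IsSingularPiece T x μ σ K)
    (hμ : ∀ t ∈ Icc 0 T, x t = c + μ (Ioc 0 t)) {E : ℝ → ℝ → ℝ}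
    (hE : ContDiff ℝ 1 (Function.uncurry E)) (hBV : BoundedVariationOn x (Icc 0 T))
    (hED : EDUB E x T) :
    ∀ᵐ t ∂μ.totalVariation, t ∈ K → σ * pEx E t (x t) ≤ -1 := by
  obtain ⟨C, hC⟩ : ∃ C, ∀ s ∈ Icc 0 T, ‖pEt E s (x s)‖ ≤ C := by
    set V := (eVariationOn x (Icc 0 T)).toReal
    obtain ⟨C, hC⟩ := (isCompact_Icc.prod (isCompact_closedBall (x 0) V)).exists_bound_of_continuousOn
      (s := Icc 0 T ×ˢ Metric.closedBall (x 0) V) (continuous_pEt hE).continuousOn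
    exact ⟨C, fun s hs => hC (s, x s)
      ⟨hs, hBV.dist_le hs (left_mem_Icc.2 (hs.1.trans hs.2))⟩⟩
  filter_upwards [hK.ae_tendsto_quotient hμ] with t h htK
  have ht := hK.subset_Ioo htK
  have hquot := (h htK).2 (fun r => t - r) (fun r => t + r) (by
    filter_upwards [self_mem_nhdsWithin] with r hr
    rw [mem_Ioi] at hr
    rw [Real.closedBall_eq_Icc]
    refine ⟨⟨le_rfl, by linarith⟩, ⟨by linarith, le_rfl⟩, by linarith, ?_⟩
    by_cases hm : t - r ∈ K
    · refine measure_mono_null (fun z hz => ?_) (hK.totalVariation_singleton hμ hm)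
      by_contra hne
      exact hz.2 ⟨lt_of_le_of_ne hz.1.1.1 (Ne.symm hne), hz.1.1.2⟩
    · convert measure_empty (μ := μ.totalVariation)
      refine eq_empty_of_forall_notMem fun z hz => hz.2 ⟨lt_of_le_of_ne hz.1.1.1 ?_, hz.1.1.2⟩
      rintro rfl
      exact hm hz.1.2)
  have h1 := hquot _ _ (hE.hasStrictFDerivAt one_ne_zero)
  have h2 := (hquot _ _ (hasStrictFDerivAt_snd (𝕜 := ℝ))).abs
  have h3 := ((h htK).1.const_mul (2 * C)).sub h2
  have hr0 : Tendsto (fun r : ℝ => r) (𝓝[>] 0) (𝓝 0) := tendsto_nhdsWithin_of_tendsto_nhds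
    tendsto_id
  rw [pEx_eq_fderiv hE]
  have h4 := le_of_tendsto_of_tendsto h1 h3 (by
    filter_upwards [self_mem_nhdsWithin, hr0.eventually (gt_mem_nhds (sub_pos.2 ht.2)),
      hr0.eventually (gt_mem_nhds ht.1)] with r hr hr1 hr2
    rw [mem_Ioi] at hr
    have hsub : Icc (t - r) (t + r) ⊆ Icc 0 T := Icc_subset_Icc (by linarith) (by linarith)
    have hab : t - r ≤ t + r := by linarith
    have e1 := hED (t - r) (t + r) (by linarith) hab (by linarith)
    have e2 : |x (t + r) - x (t - r)| ≤ Diss x (t - r) (t + r) :=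
      BoundedVariationOn.dist_le (ne_top_of_le_ne_top hBV (eVariationOn.mono x hsub))
        (right_mem_Icc.2 hab) (left_mem_Icc.2 hab)
    have e3 : (∫ s in (t - r)..(t + r), pEt E s (x s)) ≤ C * (2 * r) := by
      refine (le_abs_self _).trans ((intervalIntegral.norm_integral_le_of_norm_le_const
        (C := C) fun s hs => hC s ?_).trans_eq ?_)
      · rw [uIoc_of_le hab] at hs
        exact hsub (Ioc_subset_Icc_self hs)
      · rw [abs_of_nonneg (by linarith)]
        ring
    have hn : 0 ≤ (μ.totalVariation.real (Metric.closedBall t r))⁻¹ :=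
      inv_nonneg.2 measureReal_nonneg
    simp only [Function.uncurry_apply_pair]
    rw [abs_mul, abs_of_nonneg hn]
    calc _ ≤ (μ.totalVariation.real (Metric.closedBall t r))⁻¹ *
          (C * (2 * r) - |x (t + r) - x (t - r)|) :=
          mul_le_mul_of_nonneg_left (by linarith) hn
      _ = _ := by ring)
  simpa [hK.abs_sign] using h4

theorem isCompact_sep (hK : IsSingularPiece T x μ σ K) {F : ℝ → ℝ → ℝ}
    (hF : Continuous (Function.uncurry F)) (k : ℝ) : IsCompact {t ∈ K | F t (x t) = k} := by
  refine hK.isCompact.of_isClosed_subset ?_ (sep_subset _ _)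
  exact (hF.comp_continuousOn (continuousOn_id.prodMk hK.continuousOn)).preimage_isClosed_of_isClosed
    hK.isCompact.isClosed (isClosed_singleton (x := k))

theorem totalVariation_eq_zero (hK : IsSingularPiece T x μ σ K)
    (hμ : ∀ t ∈ Icc 0 T, x t = c + μ (Ioc 0 t)) {E : ℝ → ℝ → ℝ}
    (hE : ContDiff ℝ 3 (Function.uncurry E)) (hH1 : H1cond E T)
    (hBV : BoundedVariationOn x (Icc 0 T)) (hWLS : WeakLS E x T) (hED : EDUB E x T) :
    μ.totalVariation K = 0 := by
  have hE1 : ContDiff ℝ 2 (Function.uncurry (pEx E)) := contDiff_pEx (n := 2) hE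
  have hE2 : ContDiff ℝ 1 (Function.uncurry (pExx E)) := contDiff_pEx (n := 1) hE1
  have hE3 : ContDiff ℝ 0 (Function.uncurry (pExxx E)) := contDiff_pEx (n := 0) (by simpa using hE2)
  have hσ : σ = 1 ∨ σ = -1 := eq_or_eq_neg_of_abs_eq hK.abs_sign
  have hK1 := hK.mono (hK.isCompact_sep hE1.continuous (-σ)) (sep_subset _ _)
  have hK2 := hK1.mono (hK1.isCompact_sep hE2.continuous 0) (sep_subset _ _)
  have hK3 := hK2.mono (hK2.isCompact_sep hE3.continuous 0) (sep_subset _ _)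
  set K1 := {t ∈ K | pEx E t (x t) = -σ}
  set K2 := {t ∈ K1 | pExx E t (x t) = 0}
  set K3 := {t ∈ K2 | pExxx E t (x t) = 0}
  have hfin : K3.Finite := by
    refine (hH1.image Prod.fst).subset fun t ht => ⟨(t, x t), ⟨hK3.subset_Ioo ht, ?_, ht.1.2, ht.2⟩,
      rfl⟩
    have h : pEx E t (x t) = -σ := ht.1.1.2
    rcases hσ with rfl | rfl <;> simp [h]
  have h3 : μ.totalVariation K3 = 0 :=
    (measure_null_iff_singleton hfin.countable).2 fun t ht => hK3.totalVariation_singleton hμ ht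
  have h0 : ∀ᵐ t ∂μ.totalVariation, t ∉ K := by
    filter_upwards [hK.ae_mul_pEx_le hμ (hE.of_le (by norm_num)) hBV hED,
      hK1.ae_pEx_eq_zero hμ (hE1.of_le (by norm_num)) (fun t ht => ht.2),
      hK2.ae_pEx_eq_zero hμ hE2 (fun t ht => ht.2),
      compl_mem_ae_iff.2 h3] with t a1 a2 a3 a4 ht
    have hle := abs_le.1 (hWLS t (Ioo_subset_Icc_self (hK.subset_Ioo ht))
      (hK.continuousAt t ht).continuousWithinAt)
    have b1 : t ∈ K1 := by
      refine ⟨ht, ?_⟩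
      have := a1 ht
      rcases hσ with rfl | rfl <;> linarith [hle.1, hle.2]
    have b2 : t ∈ K2 := ⟨b1, a2 b1⟩
    exact a4 ⟨b2, a3 b2⟩
  simpa [ae_iff] using h0

end IsSingularPiece

theorem BoundedVariationOn.countable_jumpSet (hBV : BoundedVariationOn x (Icc 0 T)) :
    (JumpSet x T).Countable := by
  obtain ⟨p, q, hp, hq, rfl⟩ := hBV.locallyBoundedVariationOn.exists_monotoneOn_sub_monotoneOn
  refine (hp.countable_not_continuousWithinAt.union hq.countable_not_continuousWithinAt).mono ?_
  rintro t ⟨ht, hc⟩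
  by_contra hn
  rw [mem_union, not_or] at hn
  exact hc ((not_not.1 fun h => hn.1 ⟨ht, h⟩).sub (not_not.1 fun h => hn.2 ⟨ht, h⟩))

/-- Every set splits into two measurable parts on which a signed measure agrees with its total
variation up to sign. -/
theorem MeasureTheory.SignedMeasure.exists_sign_totalVariation (μ : SignedMeasure ℝ) :
    ∃ i : Set ℝ, MeasurableSet i ∧
      (∀ D ⊆ i, MeasurableSet D → μ D = (-1) * μ.totalVariation.real D) ∧
      ∀ D ⊆ iᶜ, MeasurableSet D → μ D = 1 * μ.totalVariation.real D := by
  obtain ⟨i, hi, hpos, hneg⟩ := μ.toJordanDecomposition.mutuallySingular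
  refine ⟨i, hi, fun D hD hDm => ?_, fun D hD hDm => ?_⟩
  · rw [μ.apply_eq_posPart_real_sub_negPart_real hDm, SignedMeasure.totalVariation,
      measureReal_add_apply]
    simp [Measure.real, measure_mono_null hD hpos]
  · rw [μ.apply_eq_posPart_real_sub_negPart_real hDm, SignedMeasure.totalVariation,
      measureReal_add_apply]
    simp [Measure.real, measure_mono_null hD hneg]

theorem totalVariation_eq_zero_of_volume_eq_zero
    (hμ : ∀ t ∈ Icc 0 T, x t = c + μ (Ioc 0 t)) {E : ℝ → ℝ → ℝ}
    (hE : ContDiff ℝ 3 (Function.uncurry E)) (hH1 : H1cond E T)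
    (hBV : BoundedVariationOn x (Icc 0 T)) (hWLS : WeakLS E x T) (hED : EDUB E x T)
    {s : Set ℝ} (hs : MeasurableSet s) (hsub : s ⊆ Ioo 0 T \ JumpSet x T)
    (hs0 : volume s = 0) : μ.totalVariation s = 0 := by
  have key : ∀ (σ : ℝ) (D : Set ℝ), |σ| = 1 → MeasurableSet D → D ⊆ s →
      (∀ D' ⊆ D, MeasurableSet D' → μ D' = σ * μ.totalVariation.real D') →
      μ.totalVariation D = 0 := by
    intro σ D hσ hD hDs hDσ
    rw [hD.measure_eq_iSup_isCompact]
    simp only [ENNReal.iSup_eq_zero]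
    intro K hKD hKc
    refine IsSingularPiece.totalVariation_eq_zero (σ := σ)
      ⟨hKc, fun t ht => (hsub (hDs (hKD ht))).1, fun t ht => ?_,
        measure_mono_null (hKD.trans hDs) hs0, hσ, fun D' hD' => hDσ D' (hD'.trans hKD)⟩
      hμ hE hH1 hBV hWLS hED
    obtain ⟨h1, h2⟩ := hsub (hDs (hKD ht))
    have h3 : ContinuousWithinAt x (Icc 0 T) t := by
      by_contra hc
      exact h2 ⟨Ioo_subset_Icc_self h1, hc⟩
    exact h3.continuousAt (Icc_mem_nhds h1.1 h1.2)
  obtain ⟨i, hi, hneg, hpos⟩ := SignedMeasure.exists_sign_totalVariation μ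
  rw [← inter_union_sdiff s i]
  exact measure_union_null
    (key (-1) _ (by simp) (hs.inter hi) inter_subset_left
      fun D hD => hneg D (hD.trans inter_subset_right))
    (key 1 _ (by simp) (hs.diff hi) sdiff_subset fun D hD => hpos D fun z hz => (hD hz).2)

end Singular

/-- under (H1), every BV function satisfying the weak local stability and the
energy-dissipation upper bound is SBV: its derivative measure μ decomposes as `f·dt` plus an
atomic part concentrated on the jump set `J`, with `f ∈ L¹`. -/
theorem regularity_SBV
    (T : ℝ) (hT : 0 < T) (E : ℝ → ℝ → ℝ)
    (hE : ContDiff ℝ 3 (Function.uncurry E))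
    (hH1 : H1cond E T)
    (x : ℝ → ℝ) (hBV : BoundedVariationOn x (Set.Icc 0 T))
    (hWLS : WeakLS E x T) (hED : EDUB E x T)
    (μ : MeasureTheory.SignedMeasure ℝ) (c : ℝ)
    (hμ : ∀ t ∈ Set.Icc 0 T, x t = c + μ (Set.Ioc 0 t)) :
    ∃ f : ℝ → ℝ, MeasureTheory.IntegrableOn f (Set.Ioo 0 T) ∧
      ∀ s : Set ℝ, MeasurableSet s → s ⊆ Set.Ioo 0 T →
        μ s = (∫ t in s, f t) + μ (s ∩ JumpSet x T) := by
  have hJ : MeasurableSet (JumpSet x T) := hBV.countable_jumpSet.measurableSet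
  set A : Set ℝ := Ioo 0 T \ JumpSet x T with hA
  have hAm : MeasurableSet A := measurableSet_Ioo.diff hJ
  have hac : μ.restrict A ≪ᵥ (volume : Measure ℝ).toENNRealVectorMeasure := by
    refine VectorMeasure.AbsolutelyContinuous.mk fun s hs hs0 => ?_
    rw [Measure.toENNRealVectorMeasure_apply_measurable hs] at hs0
    rw [VectorMeasure.restrict_apply _ hAm hs]
    exact SignedMeasure.null_of_totalVariation_zero _
      (totalVariation_eq_zero_of_volume_eq_zero hμ hE hH1 hBV hWLS hED (hs.inter hAm)
        inter_subset_right (measure_mono_null inter_subset_left hs0))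
  have hint : Integrable (SignedMeasure.rnDeriv (μ.restrict A) volume) volume :=
    SignedMeasure.integrable_rnDeriv _ _
  refine ⟨SignedMeasure.rnDeriv (μ.restrict A) volume, hint.integrableOn, fun s hs hsT => ?_⟩
  have h1 : μ (s \ JumpSet x T) = ∫ t in s, SignedMeasure.rnDeriv (μ.restrict A) volume t := by
    rw [← withDensityᵥ_apply hint hs, SignedMeasure.withDensityᵥ_rnDeriv_eq _ _ hac,
      VectorMeasure.restrict_apply _ hAm hs, hA, ← inter_sdiff_assoc, inter_eq_left.2 hsT]
  rw [← h1, ← VectorMeasure.of_union (disjoint_sdiff_left.mono_right inter_subset_right)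
    (hs.diff hJ) (hs.inter hJ), sdiff_union_inter]
end

section
/- Assume the BV function x:[0,T]→ℝ has only finitely many jump points and satisfies the strong local stability and the energy-dissipation upper bound, and assume (H1), (H3) and (H4). Then there exist finitely many disjoint open intervals I₁,…,I_M such that [0,T] = ∪_{n=1}^M cl(Iₙ) and x is of class C¹ on each interval Iₙ. -/
open Set Filter Topology MeasureTheory

theorem contDiff_deriv_snd {f : ℝ → ℝ → ℝ} {n m : WithTop ℕ∞}
    (hf : ContDiff ℝ n (Function.uncurry f)) (hmn : m + 1 ≤ n) :
    ContDiff ℝ m (Function.uncurry fun t y => deriv (fun z => f t z) y) := by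
  have h1 : 1 ≤ n := le_trans le_add_self hmn
  have hd : Differentiable ℝ (Function.uncurry f) := hf.differentiable (by positivity)
  have : (Function.uncurry fun t y => deriv (fun z => f t z) y)
      = fun p => fderiv ℝ (Function.uncurry f) p (0, 1) := by
    ext ⟨t, y⟩
    have h := (hd (t, y)).hasFDerivAt.comp_hasDerivAt y
      ((hasDerivAt_const y t).prodMk (hasDerivAt_id y))
    exact h.deriv
  rw [this]
  exact (hf.fderiv_right hmn).clm_apply contDiff_const

theorem contDiff_deriv_fst {f : ℝ → ℝ → ℝ} {n m : WithTop ℕ∞}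
    (hf : ContDiff ℝ n (Function.uncurry f)) (hmn : m + 1 ≤ n) :
    ContDiff ℝ m (Function.uncurry fun t y => deriv (fun s => f s y) t) :=
  (contDiff_deriv_snd (f := fun t s => f s t) (hf.comp (contDiff_snd.prodMk contDiff_fst))
    hmn).comp (contDiff_snd.prodMk contDiff_fst)

theorem contDiff_slice_snd {f : ℝ → ℝ → ℝ} {n : WithTop ℕ∞}
    (hf : ContDiff ℝ n (Function.uncurry f)) (t : ℝ) : ContDiff ℝ n fun z => f t z :=
  hf.comp (contDiff_const.prodMk contDiff_id)

theorem contDiff_slice_fst {f : ℝ → ℝ → ℝ} {n : WithTop ℕ∞}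
    (hf : ContDiff ℝ n (Function.uncurry f)) (y : ℝ) : ContDiff ℝ n fun s => f s y :=
  hf.comp (contDiff_id.prodMk contDiff_const)

/-- Near `(a, y)`, the sign of `∂ₜf (a, y)` determines the sign of `f (t, z) - f (a, z)`. -/
theorem eventually_lt_of_deriv_fst_mul_neg {f : ℝ → ℝ → ℝ}
    (hf : ContDiff ℝ 2 (Function.uncurry f)) (a y : ℝ) :
    ∀ᶠ p : ℝ × ℝ in 𝓝 (a, y), deriv (fun s => f s y) a * (p.1 - a) < 0 → f p.1 p.2 < f a p.2 := by
  set D := deriv (fun s => f s y) a with hD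
  have hc : Continuous (Function.uncurry fun t z => deriv (fun s => f s z) t) :=
    (contDiff_deriv_fst (m := 1) hf (by norm_num)).continuous
  rcases eq_or_ne D 0 with h0 | h0
  · simp [h0]
  have hev : ∀ᶠ p : ℝ × ℝ in 𝓝 (a, y), 0 < D * deriv (fun s => f s p.2) p.1 := by
    have : ContinuousAt (fun p : ℝ × ℝ => D * deriv (fun s => f s p.2) p.1) (a, y) :=
      (continuous_const.mul hc).continuousAt
    exact this.eventually (lt_mem_nhds (by simpa [← hD] using mul_self_pos.2 h0))
  obtain ⟨ε, hε, hb⟩ := Metric.eventually_nhds_iff.1 hev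
  filter_upwards [Metric.ball_mem_nhds _ hε] with ⟨t, z⟩ hp hneg
  simp only at hneg ⊢
  have hp' : |t - a| < ε ∧ |z - y| < ε := by simpa [Prod.dist_eq, Real.dist_eq] using hp
  have hdiff : Differentiable ℝ fun s => f s z := (contDiff_slice_fst hf z).differentiable (by simp)
  have key : ∀ c, |c - a| < ε → 0 < D * deriv (fun s => f s z) c := fun c hcε =>
    @hb (c, z) (by simpa [Prod.dist_eq, Real.dist_eq] using ⟨hcε, hp'.2⟩)
  rcases lt_trichotomy t a with hta | hta | hta
  · obtain ⟨c, hc1, hc2⟩ := exists_deriv_eq_slope (fun s => f s z) hta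
      hdiff.continuous.continuousOn hdiff.differentiableOn
    have := key c (by rw [abs_lt] at *; constructor <;> linarith [hc1.1, hc1.2])
    have hDp : 0 < D := by nlinarith
    have h2 : 0 < deriv (fun s => f s z) c := by
      by_contra! h; nlinarith
    rw [hc2, lt_div_iff₀ (by linarith)] at h2
    linarith
  · simp [hta] at hneg
  · obtain ⟨c, hc1, hc2⟩ := exists_deriv_eq_slope (fun s => f s z) hta
      hdiff.continuous.continuousOn hdiff.differentiableOn
    have := key c (by rw [abs_lt] at *; constructor <;> linarith [hc1.1, hc1.2])
    have hDp : D < 0 := by nlinarith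
    have h2 : deriv (fun s => f s z) c < 0 := by
      by_contra! h; nlinarith
    rw [hc2, div_lt_iff₀ (by linarith)] at h2
    linarith

theorem eq_of_eventuallyEq_on_Ioo {x : ℝ → ℝ} {a b : ℝ}
    (h : ∀ t ∈ Ioo a b, ∀ᶠ s in 𝓝 t, x s = x t) {u v : ℝ} (hu : u ∈ Ioo a b) (hv : v ∈ Ioo a b) :
    x u = x v := by
  have hd : ∀ t ∈ Ioo a b, HasDerivAt x 0 t := fun t ht =>
    (hasDerivAt_const t (x t)).congr_of_eventuallyEq (h t ht)
  exact isOpen_Ioo.is_const_of_deriv_eq_zero isPreconnected_Ioo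
    (fun t ht => (hd t ht).differentiableAt.differentiableWithinAt)
    (fun t ht => (hd t ht).deriv) hu hv

theorem eq_of_eventuallyEq_on_Ioo_of_continuousAt_left {x : ℝ → ℝ} {a b : ℝ}
    (h : ∀ t ∈ Ioo a b, ∀ᶠ s in 𝓝 t, x s = x t) (ha : ContinuousAt x a) {u : ℝ}
    (hu : u ∈ Ioo a b) : x u = x a := by
  have h1 : Tendsto x (𝓝[>] a) (𝓝 (x a)) := ha.tendsto.mono_left nhdsWithin_le_nhds
  have h2 : Tendsto x (𝓝[>] a) (𝓝 (x u)) :=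
    tendsto_const_nhds.congr' (by
      filter_upwards [Ioo_mem_nhdsGT (hu.1.trans hu.2)] with v hv
      exact eq_of_eventuallyEq_on_Ioo h hu hv)
  exact tendsto_nhds_unique h2 h1

theorem eq_of_eventuallyEq_on_Ioo_of_continuousAt_right {x : ℝ → ℝ} {a b : ℝ}
    (h : ∀ t ∈ Ioo a b, ∀ᶠ s in 𝓝 t, x s = x t) (hb : ContinuousAt x b) {u : ℝ}
    (hu : u ∈ Ioo a b) : x u = x b := by
  have h1 : Tendsto x (𝓝[<] b) (𝓝 (x b)) := hb.tendsto.mono_left nhdsWithin_le_nhds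
  have h2 : Tendsto x (𝓝[<] b) (𝓝 (x u)) :=
    tendsto_const_nhds.congr' (by
      filter_upwards [Ioo_mem_nhdsLT (hu.1.trans hu.2)] with v hv
      exact eq_of_eventuallyEq_on_Ioo h hu hv)
  exact tendsto_nhds_unique h2 h1

/-- A continuous solution of `f (t, x t) = c` is `C¹` where `∂ₓf` does not vanish. -/
theorem contDiffAt_of_eventually_eq_const {f : ℝ → ℝ → ℝ} {x : ℝ → ℝ} {t c : ℝ}
    (hf : ContDiff ℝ 2 (Function.uncurry f)) (hx : ContinuousAt x t)
    (heq : ∀ᶠ s in 𝓝 t, f s (x s) = c) (hne : deriv (fun z => f t z) (x t) ≠ 0) :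
    ContDiffAt ℝ 1 x t := by
  have cdf : ContDiffAt ℝ 1 (Function.uncurry f) (t, x t) :=
    (hf.of_le (by norm_num)).contDiffAt
  have hd : fderiv ℝ (Function.uncurry f) (t, x t) (0, 1) = deriv (fun z => f t z) (x t) := by
    have h := (cdf.differentiableAt (by simp)).hasFDerivAt.comp_hasDerivAt (x t)
      ((hasDerivAt_const (x t) t).prodMk (hasDerivAt_id (x t)))
    exact h.deriv.symm
  have hinv : (fderiv ℝ (Function.uncurry f) (t, x t) ∘L .inr ℝ ℝ ℝ).IsInvertible := by
    refine ⟨ContinuousLinearEquiv.unitsEquivAut ℝ (Units.mk0 _ hne), ?_⟩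
    ext
    simp [hd]
  have h1 := cdf.eventually_apply_eq_iff_implicitFunction one_ne_zero hinv
  have h2 := cdf.contDiffAt_implicitFunction one_ne_zero hinv
  have h3 : Tendsto (fun s => (s, x s)) (𝓝 t) (𝓝 (t, x t)) :=
    (continuousAt_id.prodMk hx).tendsto
  refine h2.congr_of_eventuallyEq ?_
  filter_upwards [h3.eventually h1, heq] with s hs1 hs2
  exact (hs1.1 (by simp [Function.uncurry, hs2, heq.self_of_nhds])).symm

/-- An antitone curve kept in the region `f ≤ 1` and moving only on the level set `f = 1`. -/
structure SlidesOn (f : ℝ → ℝ → ℝ) (x : ℝ → ℝ) (α β : ℝ) : Prop where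
  contDiff : ContDiff ℝ 2 (Function.uncurry f)
  continuousAt : ∀ t ∈ Ioo α β, ContinuousAt x t
  antitoneOn : AntitoneOn x (Ioo α β)
  le_one : ∀ t ∈ Ioo α β, f t (x t) ≤ 1
  eventually_eq : ∀ t ∈ Ioo α β, f t (x t) < 1 → ∀ᶠ s in 𝓝 t, x s = x t
  stable_left : ∀ t ∈ Ioo α β, f t (x t) = 1 → ∀ᶠ z in 𝓝[<] (x t), f t z ≤ 1
  stable : ∀ t ∈ Ioo α β, f t (x t) = 1 → deriv (fun z => f t z) (x t) = 0 →
    deriv (fun s => f s (x t)) t ≠ 0 ∧ ∀ᶠ z in 𝓝 (x t), f t z ≤ 1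
  nondegenerate : (∀ s ∈ Ioo α β, ∀ t ∈ Ioo α β, deriv (fun r => f r (x t)) s ≠ 0) ∨
    ∀ s ∈ Ioo α β, ∀ t ∈ Ioo α β, deriv (fun r => deriv (fun q => f q (x t)) r) s ≠ 0

namespace SlidesOn

variable {f : ℝ → ℝ → ℝ} {x : ℝ → ℝ} {α β : ℝ}

theorem tendsto_prod (h : SlidesOn f x α β) {a : ℝ} (ha : a ∈ Ioo α β) :
    Tendsto (fun s => (s, x s)) (𝓝 a) (𝓝 (a, x a)) :=
  (continuousAt_id.prodMk (h.continuousAt a ha)).tendsto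

theorem eventually_lt_one (h : SlidesOn f x α β) {a : ℝ} (ha : a ∈ Ioo α β)
    (h1 : f a (x a) = 1) (hneg : deriv (fun s => f s (x a)) a < 0) :
    ∀ᶠ t in 𝓝[>] a, f t (x t) < 1 := by
  have e1 := ((h.tendsto_prod ha).eventually
    (eventually_lt_of_deriv_fst_mul_neg h.contDiff a (x a))).filter_mono
      (nhdsWithin_le_nhds (s := Ioi a))
  have e2 := ((h.continuousAt a ha).tendsto.eventually
    (eventually_nhdsWithin_iff.1 (h.stable_left a ha h1))).filter_mono
      (nhdsWithin_le_nhds (s := Ioi a))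
  filter_upwards [e1, e2, self_mem_nhdsWithin, Ioo_mem_nhdsGT ha.2] with t ht1 ht2 (hat : a < t) htb
  refine (ht1 (mul_neg_of_neg_of_pos hneg (sub_pos.2 hat))).trans_le ?_
  rcases (h.antitoneOn ha ⟨ha.1.trans hat, htb.2⟩ hat.le).lt_or_eq with hlt | heq
  · exact ht2 hlt
  · simp only [heq, h1, le_refl]

theorem hasDerivWithinAt_zero (h : SlidesOn f x α β) {a : ℝ} (ha : a ∈ Ioo α β)
    (hneg : deriv (fun s => f s (x a)) a < 0) : HasDerivWithinAt x 0 (Ici a) a := by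
  rcases (h.le_one a ha).lt_or_eq with hlt | heq
  · exact ((hasDerivAt_const a (x a)).congr_of_eventuallyEq
      (h.eventually_eq a ha hlt)).hasDerivWithinAt
  · obtain ⟨b, hb, hsub⟩ := mem_nhdsGT_iff_exists_Ioo_subset.1
      (inter_mem (h.eventually_lt_one ha heq hneg) (Ioo_mem_nhdsGT ha.2))
    have hloc : ∀ t ∈ Ioo a b, ∀ᶠ s in 𝓝 t, x s = x t := fun t ht =>
      h.eventually_eq t ⟨ha.1.trans ht.1, (hsub ht).2.2⟩ (hsub ht).1
    refine HasDerivWithinAt.congr_of_eventuallyEq (hasDerivWithinAt_const a _ (x a)) ?_ rfl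
    filter_upwards [Ico_mem_nhdsGE hb] with u hu
    rcases hu.1.eq_or_lt with h0 | h0
    · rw [h0]
    · exact eq_of_eventuallyEq_on_Ioo_of_continuousAt_left hloc (h.continuousAt a ha) ⟨h0, hu.2⟩

theorem deriv_fst_nonneg (h : SlidesOn f x α β) {a : ℝ} (ha : a ∈ Ioo α β)
    (h1 : f a (x a) = 1) : 0 ≤ deriv (fun s => f s (x a)) a := by
  by_contra! hneg
  have hc : Continuous (Function.uncurry fun t z => deriv (fun s => f s z) t) :=
    (contDiff_deriv_fst (m := 1) h.contDiff (by norm_num)).continuous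
  have hev : ∀ᶠ t in 𝓝 a, deriv (fun s => f s (x t)) t < 0 :=
    (h.tendsto_prod ha).eventually (hc.continuousAt.eventually (gt_mem_nhds hneg))
  obtain ⟨l, hl, hsub⟩ := mem_nhdsLE_iff_exists_Icc_subset.1
    (inter_mem (nhdsWithin_le_nhds hev) (nhdsWithin_le_nhds (Ioo_mem_nhds ha.1 ha.2)))
  have hconst := constant_of_has_deriv_right_zero (a := l) (b := a)
    (fun t ht => (h.continuousAt t (hsub ht).2).continuousWithinAt)
    (fun t ht => h.hasDerivWithinAt_zero (hsub (Ico_subset_Icc_self ht)).2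
      (hsub (Ico_subset_Icc_self ht)).1)
  have hla : l < a := hl
  have hanti : StrictAntiOn (fun s => f s (x l)) (Icc l a) := by
    refine strictAntiOn_of_deriv_neg (convex_Icc l a)
      (contDiff_slice_fst h.contDiff _).continuous.continuousOn fun t ht => ?_
    have ht' := interior_subset ht
    have := (hsub ht').1
    rwa [mem_ofPred_eq, hconst t ht'] at this
  have hlt := hanti (left_mem_Icc.2 hla.le) (right_mem_Icc.2 hla.le) hla
  have hle := h.le_one l (hsub (left_mem_Icc.2 hla.le)).2
  have := hconst a (right_mem_Icc.2 hla.le)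
  simp only at hlt
  rw [← this, h1] at hlt
  rw [← this] at hle
  linarith

theorem eq_one_of_between (h : SlidesOn f x α β) {k₁ s k₂ : ℝ} (hk₁ : k₁ ∈ Ioo α β)
    (hk₂ : k₂ ∈ Ioo α β) (h1 : f k₁ (x k₁) = 1) (h2 : f k₂ (x k₂) = 1) (hs₁ : k₁ ≤ s)
    (hs₂ : s ≤ k₂) : f s (x s) = 1 := by
  by_contra hne
  have hcont : ContinuousOn (fun t => f t (x t)) (Ioo α β) := fun t ht =>
    ((h.contDiff.continuous.continuousAt).comp
      (f := fun t => (t, x t)) (h.tendsto_prod ht)).continuousWithinAt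
  have hIoo : ∀ t, k₁ ≤ t → t ≤ k₂ → t ∈ Ioo α β := fun t h1 h2 =>
    ⟨hk₁.1.trans_le h1, h2.trans_lt hk₂.2⟩
  obtain ⟨a, ⟨ha, hfa⟩, hmax⟩ : ∃ a, IsGreatest (Icc k₁ s ∩ {t | f t (x t) = 1}) a := by
    refine IsCompact.exists_isGreatest ?_ ⟨k₁, ⟨le_rfl, hs₁⟩, h1⟩
    have := (hcont.mono fun t ht => hIoo t ht.1 (ht.2.trans hs₂)).preimage_isClosed_of_isClosed
      (isClosed_Icc (a := k₁) (b := s)) (isClosed_singleton (x := (1 : ℝ)))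
    exact isCompact_Icc.of_isClosed_subset this inter_subset_left
  obtain ⟨b, ⟨hb, hfb⟩, hmin⟩ : ∃ b, IsLeast (Icc s k₂ ∩ {t | f t (x t) = 1}) b := by
    refine IsCompact.exists_isLeast ?_ ⟨k₂, ⟨hs₂, le_rfl⟩, h2⟩
    have := (hcont.mono fun t ht => hIoo t (hs₁.trans ht.1) ht.2).preimage_isClosed_of_isClosed
      (isClosed_Icc (a := s) (b := k₂)) (isClosed_singleton (x := (1 : ℝ)))
    exact isCompact_Icc.of_isClosed_subset this inter_subset_left
  simp only [mem_ofPred_eq] at hfa hfb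
  have has : a < s := lt_of_le_of_ne ha.2 (by rintro rfl; exact hne hfa)
  have hsb : s < b := lt_of_le_of_ne hb.1 (by rintro rfl; exact hne hfb)
  have haI := hIoo a ha.1 (ha.2.trans hs₂)
  have hbI := hIoo b (hs₁.trans hb.1) hb.2
  have hlt : ∀ t ∈ Ioo a b, f t (x t) < 1 := by
    intro t ht
    have htI := hIoo t (ha.1.trans ht.1.le) (ht.2.le.trans hb.2)
    refine lt_of_le_of_ne (h.le_one t htI) fun h0 => ?_
    rcases le_total t s with hts | hts
    · exact absurd (hmax ⟨⟨ha.1.trans ht.1.le, hts⟩, h0⟩) (not_le.2 ht.1)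
    · exact absurd (hmin ⟨⟨hts, ht.2.le.trans hb.2⟩, h0⟩) (not_le.2 ht.2)
  have hloc : ∀ t ∈ Ioo a b, ∀ᶠ s in 𝓝 t, x s = x t := fun t ht =>
    h.eventually_eq t ⟨haI.1.trans ht.1, ht.2.trans hbI.2⟩ (hlt t ht)
  have hxa : ∀ t ∈ Ioo a b, x t = x a := fun t ht =>
    eq_of_eventuallyEq_on_Ioo_of_continuousAt_left hloc (h.continuousAt a haI) ht
  have hxb : x b = x a := by
    rw [← hxa s ⟨has, hsb⟩]
    exact (eq_of_eventuallyEq_on_Ioo_of_continuousAt_right hloc (h.continuousAt b hbI)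
      ⟨has, hsb⟩).symm
  have hab : a < b := has.trans hsb
  have hzero : deriv (fun r => f r (x a)) a = 0 := by
    refine le_antisymm ?_ (h.deriv_fst_nonneg haI hfa)
    by_contra! hpos
    have hsign := (eventually_nhdsWithin_sign_eq_of_deriv_pos
      (f := fun r => f r (x a) - 1) (x₀ := a) (by simpa using hpos) (by simp [hfa])).filter_mono
        (nhdsWithin_le_nhds (s := Ioi a))
    obtain ⟨t, ht1, ht2⟩ := (hsign.and (Ioo_mem_nhdsGT hab)).exists
    rw [sign_pos (sub_pos.2 ht2.1), sign_eq_one_iff] at ht1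
    have := hlt t ht2
    rw [hxa t ht2] at this
    linarith
  rcases h.nondegenerate with hn | hn
  · exact hn a haI a haI hzero
  · have hcd := contDiff_slice_fst h.contDiff (x a)
    obtain ⟨c, hc, hc0⟩ := exists_deriv_eq_zero (f := fun r => f r (x a)) hab
      hcd.continuous.continuousOn (by simp only [hfa]; rw [← hxb, hfb])
    have hcd' : Continuous (deriv fun q => f q (x a)) := hcd.continuous_deriv (by norm_num)
    obtain ⟨d, hd, hd0⟩ := exists_deriv_eq_zero (f := fun r => deriv (fun q => f q (x a)) r) hc.1
      hcd'.continuousOn (by simp only [hzero, hc0])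
    exact hn d ⟨haI.1.trans hd.1, hd.2.trans (hc.2.trans hbI.2)⟩ a haI hd0

theorem contDiffOn_of_eq_one (h : SlidesOn f x α β) {a b : ℝ} (hsub : Ioo a b ⊆ Ioo α β)
    (h1 : ∀ t ∈ Ioo a b, f t (x t) = 1) : ContDiffOn ℝ 1 x (Ioo a b) := by
  intro t ht
  have hmem : Ioo a b ∈ 𝓝 t := Ioo_mem_nhds ht.1 ht.2
  have htI := hsub ht
  refine (contDiffAt_of_eventually_eq_const (c := 1) h.contDiff (h.continuousAt t htI)
    (eventually_of_mem hmem h1) fun h0 => ?_).contDiffWithinAt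
  obtain ⟨hne, hle⟩ := h.stable t htI (h1 t ht) h0
  have hpos : 0 < deriv (fun s => f s (x t)) t :=
    lt_of_le_of_ne (h.deriv_fst_nonneg htI (h1 t ht)) hne.symm
  have e1 := ((h.tendsto_prod htI).eventually
    (eventually_lt_of_deriv_fst_mul_neg h.contDiff t (x t))).and
      (((h.continuousAt t htI).tendsto.eventually hle).and hmem)
  obtain ⟨s, ⟨hs1, hs2, hs3⟩, hst⟩ :=
    ((e1.filter_mono (nhdsWithin_le_nhds (s := Iio t))).and self_mem_nhdsWithin).exists
  have := hs1 (mul_neg_of_pos_of_neg hpos (sub_neg.2 hst))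
  have := h1 s hs3
  simp only at *
  linarith

theorem contDiffOn_of_ne_one (h : SlidesOn f x α β) {a b : ℝ} (hsub : Ioo a b ⊆ Ioo α β)
    (h1 : ∀ t ∈ Ioo a b, f t (x t) ≠ 1) : ContDiffOn ℝ 1 x (Ioo a b) := fun t ht =>
  (contDiffAt_const.congr_of_eventuallyEq (h.eventually_eq t (hsub ht)
    (lt_of_le_of_ne (h.le_one t (hsub ht)) (h1 t ht)))).contDiffWithinAt

theorem exists_contDiffOn (h : SlidesOn f x α β) (hαβ : α < β) :
    (∃ b > α, ContDiffOn ℝ 1 x (Ioo α b)) ∧ ∃ a < β, ContDiffOn ℝ 1 x (Ioo a β) := by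
  by_cases hK : ∃ k ∈ Ioo α β, f k (x k) = 1
  · obtain ⟨k, hk, hk1⟩ := hK
    constructor
    · by_cases hs : ∃ s ∈ Ioo α k, f s (x s) ≠ 1
      · obtain ⟨s, hs, hs1⟩ := hs
        refine ⟨s, hs.1, h.contDiffOn_of_ne_one
          (Ioo_subset_Ioo_right (hs.2.trans hk.2).le) fun t ht ht1 => hs1 ?_⟩
        exact h.eq_one_of_between ⟨ht.1, ht.2.trans (hs.2.trans hk.2)⟩ hk ht1 hk1 ht.2.le hs.2.le
      · push Not at hs
        exact ⟨k, hk.1, h.contDiffOn_of_eq_one (Ioo_subset_Ioo_right hk.2.le) hs⟩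
    · by_cases hs : ∃ s ∈ Ioo k β, f s (x s) ≠ 1
      · obtain ⟨s, hs, hs1⟩ := hs
        refine ⟨s, hs.2, h.contDiffOn_of_ne_one
          (Ioo_subset_Ioo_left (hk.1.trans hs.1).le) fun t ht ht1 => hs1 ?_⟩
        exact h.eq_one_of_between hk ⟨hk.1.trans (hs.1.trans ht.1), ht.2⟩ hk1 ht1 hs.1.le ht.1.le
      · push Not at hs
        exact ⟨k, hk.2, h.contDiffOn_of_eq_one (Ioo_subset_Ioo_left hk.1.le) hs⟩
  · push Not at hK
    have := h.contDiffOn_of_ne_one Subset.rfl hK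
    exact ⟨⟨β, hαβ, this⟩, α, hαβ, this⟩

end SlidesOn

theorem not_eventually_one_lt_of_isLocalMin {G h : ℝ → ℝ} {y : ℝ}
    (hG : ∀ z, HasDerivAt G (h z) z) (hmin : IsLocalMin (fun z => G z + |z - y|) y) :
    ¬ ∀ᶠ z in 𝓝[<] y, 1 < h z := by
  intro hev
  obtain ⟨l, hl, hsub⟩ := mem_nhdsLT_iff_exists_Ioo_subset.1
    (inter_mem hev (nhdsWithin_le_nhds hmin))
  obtain ⟨m, hlm, hmy⟩ := exists_between (mem_Iio.1 hl)
  have hd : ∀ z, HasDerivAt (fun z => G z + (y - z)) (h z - 1) z := fun z => by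
    rw [sub_eq_add_neg]
    exact (hG z).add ((hasDerivAt_id z).const_sub y)
  have hmono : StrictMonoOn (fun z => G z + (y - z)) (Icc m y) := by
    refine strictMonoOn_of_deriv_pos (convex_Icc m y)
      (fun z _ => (hd z).continuousAt.continuousWithinAt) fun z hz => ?_
    rw [interior_Icc] at hz
    rw [(hd z).deriv, sub_pos]
    exact (hsub ⟨hlm.trans hz.1, hz.2⟩).1
  have h1 := hmono (left_mem_Icc.2 hmy.le) (right_mem_Icc.2 hmy.le) hmy
  have h2 := (hsub ⟨hlm, hmy⟩).2
  simp only [mem_ofPred_eq, sub_self, abs_zero] at h1 h2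
  rw [abs_of_neg (by linarith)] at h2
  linarith

theorem le_one_of_not_eventually_one_lt {h : ℝ → ℝ} {y : ℝ} (hc : ContinuousAt h y)
    (hleft : ¬ ∀ᶠ z in 𝓝[<] y, 1 < h z) : h y ≤ 1 := by
  by_contra! hlt
  exact hleft (nhdsWithin_le_nhds (hc.eventually (lt_mem_nhds hlt)))

theorem eventually_le_one_of_not_eventually_one_lt {h : ℝ → ℝ} {y : ℝ} (hc : Continuous h)
    (h1 : h y = 1) (hleft : ¬ ∀ᶠ z in 𝓝[<] y, 1 < h z)
    (hnd : deriv h y = 0 → deriv (deriv h) y ≠ 0) :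
    (∀ᶠ z in 𝓝[<] y, h z ≤ 1) ∧ (deriv h y = 0 → ∀ᶠ z in 𝓝 y, h z ≤ 1) := by
  rcases lt_trichotomy (deriv h y) 0 with hd | hd | hd
  · refine absurd ?_ hleft
    filter_upwards [nhdsWithin_le_nhds (s := Iio y) (eventually_nhdsWithin_sign_eq_of_deriv_neg
      (f := fun z => h z - 1) (by simpa using hd) (by simp [h1])), self_mem_nhdsWithin]
      with z hz (hzy : z < y)
    rw [sign_pos (sub_pos.2 hzy), sign_eq_one_iff] at hz
    linarith
  · rcases (hnd hd).lt_or_gt with hdd | hdd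
    · have := isLocalMax_of_deriv_deriv_neg hdd hd hc.continuousAt
      have hev : ∀ᶠ z in 𝓝 y, h z ≤ 1 := by simpa [IsLocalMax, IsMaxFilter, h1] using this
      exact ⟨nhdsWithin_le_nhds hev, fun _ => hev⟩
    · refine absurd ?_ hleft
      have hneg := deriv_neg_left_of_sign_deriv (nhdsWithin_le_nhds
        (eventually_nhdsWithin_sign_eq_of_deriv_pos hdd hd))
      obtain ⟨l, hl, hsub⟩ := mem_nhdsLT_iff_exists_Ioo_subset.1 hneg
      filter_upwards [Ioo_mem_nhdsLT hl] with z hz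
      have hanti : StrictAntiOn h (Icc z y) := by
        refine strictAntiOn_of_deriv_neg (convex_Icc z y) hc.continuousOn fun w hw => ?_
        rw [interior_Icc] at hw
        exact hsub ⟨hz.1.trans hw.1, hw.2⟩
      simpa [h1] using hanti (left_mem_Icc.2 hz.2.le) (right_mem_Icc.2 hz.2.le) hz.2
  · refine ⟨?_, fun h0 => absurd h0 hd.ne'⟩
    filter_upwards [nhdsWithin_le_nhds (s := Iio y) (eventually_nhdsWithin_sign_eq_of_deriv_pos
      (f := fun z => h z - 1) (by simpa using hd) (by simp [h1])), self_mem_nhdsWithin]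
      with z hz (hzy : z < y)
    rw [sign_neg (sub_neg.2 hzy), sign_eq_neg_one_iff] at hz
    linarith

/-- Where `σ ∂ₓE > -1`, the energy-dissipation upper bound makes `σ x` nonincreasing. -/
theorem EDUB.exists_mul_le {E : ℝ → ℝ → ℝ} {x : ℝ → ℝ} {T : ℝ}
    (hE : ContDiff ℝ 3 (Function.uncurry E)) (hBV : BoundedVariationOn x (Icc 0 T))
    (hED : EDUB E x T) {σ : ℝ} (hσ : σ = 1 ∨ σ = -1) {t₀ y₀ : ℝ} (h0 : -1 < σ * pEx E t₀ y₀) :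
    ∃ ε > 0, ∀ t₁ t₂, t₁ ≤ t₂ → Icc t₁ t₂ ⊆ Icc 0 T → ContinuousOn x (Icc t₁ t₂) →
      (∀ t ∈ Icc t₁ t₂, |t - t₀| < ε ∧ |x t - y₀| < ε) → σ * x t₂ ≤ σ * x t₁ := by
  have hEx : ContDiff ℝ 2 (Function.uncurry (pEx E)) := contDiff_deriv_snd hE (by norm_num)
  have hEt : ContDiff ℝ 2 (Function.uncurry (pEt E)) := contDiff_deriv_fst hE (by norm_num)
  obtain ⟨c, hc0, hc1, hc⟩ : ∃ c > 0, c ≤ 1 ∧ -1 + c < σ * pEx E t₀ y₀ := by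
    refine ⟨min 1 ((1 + σ * pEx E t₀ y₀) / 2), lt_min one_pos (by linarith), min_le_left _ _, ?_⟩
    linarith [min_le_right 1 ((1 + σ * pEx E t₀ y₀) / 2)]
  have hev1 : ∀ᶠ p : ℝ × ℝ in 𝓝 (t₀, y₀), -1 + c < σ * pEx E p.1 p.2 :=
    (continuous_const.mul hEx.continuous).continuousAt.eventually (lt_mem_nhds hc)
  obtain ⟨L, s, hs, hL⟩ :=
    ((hEt.of_le (by norm_num) : ContDiff ℝ 1 _).contDiffAt (x := (t₀, y₀))).exists_lipschitzOnWith
  obtain ⟨ε₁, hε₁, hb⟩ := Metric.eventually_nhds_iff.1 (hev1.and hs)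
  have hL0 : (0 : ℝ) ≤ L := L.2
  refine ⟨min ε₁ (c / (2 * (L + 1))), lt_min hε₁ (by positivity), ?_⟩
  intro t₁ t₂ h12 hsub hcont hclose
  have hbox : ∀ t ∈ Icc t₁ t₂, ∀ z, |z - y₀| < min ε₁ (c / (2 * (L + 1))) →
      -1 + c < σ * pEx E t z ∧ (t, z) ∈ s := fun t ht z hz =>
    @hb (t, z) (by
      simpa [Prod.dist_eq, Real.dist_eq] using
        ⟨(hclose t ht).1.trans_le (min_le_left _ _), hz.trans_le (min_le_left _ _)⟩)
  by_contra! hlt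
  have m1 : t₁ ∈ Icc t₁ t₂ := left_mem_Icc.2 h12
  have m2 : t₂ ∈ Icc t₁ t₂ := right_mem_Icc.2 h12
  have hVfin : eVariationOn x (Icc t₁ t₂) ≠ ⊤ := hBV.mono hsub
  have hV : ∀ t ∈ Icc t₁ t₂, |x t - x t₁| ≤ Diss x t₁ t₂ := fun t ht => by
    rw [← Real.dist_eq, ← ENNReal.toReal_ofReal (dist_nonneg (x := x t) (y := x t₁)), ← edist_dist]
    exact ENNReal.toReal_mono hVfin (eVariationOn.edist_le x ht m1)
  have hspace : (-1 + c) * (σ * x t₂ - σ * x t₁) ≤ E t₂ (x t₂) - E t₂ (x t₁) := by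
    have hdiff : Differentiable ℝ fun z => E t₂ z :=
      (contDiff_slice_snd hE t₂).differentiable (by simp)
    have a1 := abs_lt.1 (hclose t₁ m1).2
    have a2 := abs_lt.1 (hclose t₂ m2).2
    rcases hσ with rfl | rfl
    · obtain ⟨ξ, hξ, hξ2⟩ := exists_deriv_eq_slope (fun z => E t₂ z) (by linarith : x t₁ < x t₂)
        hdiff.continuous.continuousOn hdiff.differentiableOn
      have h := (hbox t₂ m2 ξ (abs_lt.2 ⟨by linarith [hξ.1], by linarith [hξ.2]⟩)).1
      rw [pEx, hξ2, one_mul, lt_div_iff₀ (by linarith)] at h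
      linarith
    · obtain ⟨ξ, hξ, hξ2⟩ := exists_deriv_eq_slope (fun z => E t₂ z) (by linarith : x t₂ < x t₁)
        hdiff.continuous.continuousOn hdiff.differentiableOn
      have h := (hbox t₂ m2 ξ (abs_lt.2 ⟨by linarith [hξ.1], by linarith [hξ.2]⟩)).1
      rw [pEx, hξ2, neg_one_mul, ← neg_div, lt_div_iff₀ (by linarith)] at h
      linarith
  have hcs : Continuous fun s => pEt E s (x t₁) := (contDiff_slice_fst hEt _).continuous
  have htime : ∫ s in t₁..t₂, pEt E s (x t₁) = E t₂ (x t₁) - E t₁ (x t₁) :=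
    intervalIntegral.integral_deriv_eq_sub' (fun s => E s (x t₁)) rfl
      (fun s _ => (contDiff_slice_fst hE _).differentiable (by simp) s) hcs.continuousOn
  have hi1 : IntervalIntegrable (fun s => pEt E s (x s)) volume t₁ t₂ := by
    refine ContinuousOn.intervalIntegrable ?_
    rw [uIcc_of_le h12]
    exact hEt.continuous.comp_continuousOn (continuousOn_id.prodMk hcont)
  have hi2 : IntervalIntegrable (fun s => pEt E s (x t₁)) volume t₁ t₂ :=
    hcs.intervalIntegrable _ _
  have hint : (∫ s in t₁..t₂, pEt E s (x s)) - (∫ s in t₁..t₂, pEt E s (x t₁))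
      ≤ L * Diss x t₁ t₂ * (t₂ - t₁) := by
    rw [← intervalIntegral.integral_sub hi1 hi2]
    refine (le_abs_self _).trans ?_
    rw [← abs_of_nonneg (sub_nonneg.2 h12)]
    refine intervalIntegral.norm_integral_le_of_norm_le_const (E := ℝ) fun r hr => ?_
    rw [uIoc_of_le h12] at hr
    have hr' := Ioc_subset_Icc_self hr
    have := hL.dist_le_mul _ (hbox r hr' _ (hclose r hr').2).2 _ (hbox r hr' _ (hclose t₁ m1).2).2
    simp only [Function.uncurry, Real.dist_eq, Prod.dist_eq, sub_self, abs_zero] at this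
    rw [max_eq_right (abs_nonneg _)] at this
    exact this.trans (mul_le_mul_of_nonneg_left (hV r hr') hL0)
  have hen := hED t₁ t₂ (hsub m1).1 h12 (hsub m2).2
  have hd : σ * x t₂ - σ * x t₁ ≤ Diss x t₁ t₂ := by
    have := hV t₂ m2
    rcases hσ with rfl | rfl
    · linarith [le_abs_self (x t₂ - x t₁)]
    · linarith [neg_abs_le (x t₂ - x t₁)]
  have hLt : L * (t₂ - t₁) < c := by
    have b1 := (abs_lt.1 ((hclose t₁ m1).1.trans_le (min_le_right _ _))).1
    have b2 := (abs_lt.1 ((hclose t₂ m2).1.trans_le (min_le_right _ _))).2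
    have h3 : t₂ - t₁ ≤ c / (L + 1) := by
      have : c / (L + 1) = 2 * (c / (2 * (L + 1))) := by field_simp
      linarith
    calc L * (t₂ - t₁) ≤ L * (c / (L + 1)) := mul_le_mul_of_nonneg_left h3 hL0
      _ < c := by
        rw [mul_div_assoc', div_lt_iff₀ (by positivity)]
        nlinarith
  have hVpos : 0 < Diss x t₁ t₂ := by linarith
  nlinarith [mul_nonneg (sub_nonneg.2 hc1) (sub_nonneg.2 hd), mul_pos (sub_pos.2 hLt) hVpos]

/-- The times at which `x` jumps or at which (H1) or (H3) has an exceptional point, together with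
the endpoints of `[0, T]`. -/
def exceptionalTimes (E : ℝ → ℝ → ℝ) (x : ℝ → ℝ) (T : ℝ) : Set ℝ :=
  {0, T} ∪ JumpSet x T ∪ (Prod.fst '' {p : ℝ × ℝ | p.1 ∈ Set.Ioo 0 T ∧
    (pEx E p.1 p.2 = -1 ∨ pEx E p.1 p.2 = 1) ∧ pExx E p.1 p.2 = 0 ∧ pExxx E p.1 p.2 = 0}) ∪
    (Prod.fst '' {p : ℝ × ℝ | p.1 ∈ Set.Ioo 0 T ∧
    (pEx E p.1 p.2 = -1 ∨ pEx E p.1 p.2 = 1) ∧ pExx E p.1 p.2 = 0 ∧ pExt E p.1 p.2 = 0})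

theorem exceptionalTimes_finite {E : ℝ → ℝ → ℝ} {x : ℝ → ℝ} {T : ℝ} (hJ : (JumpSet x T).Finite)
    (hH1 : H1cond E T) (hH3 : H3cond E T) : (exceptionalTimes E x T).Finite :=
  (((Set.toFinite _).union hJ).union (hH1.image _)).union (hH3.image _)

theorem mem_Ioo_of_notMem_exceptionalTimes {E : ℝ → ℝ → ℝ} {x : ℝ → ℝ} {T t : ℝ}
    (ht : t ∈ Icc 0 T \ exceptionalTimes E x T) : t ∈ Ioo 0 T := by
  have h : t ≠ 0 ∧ t ≠ T := by
    constructor <;> rintro rfl <;> exact ht.2 (by simp [exceptionalTimes])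
  exact ⟨lt_of_le_of_ne ht.1.1 h.1.symm, lt_of_le_of_ne ht.1.2 h.2⟩

theorem notMem_jumpSet_of_notMem_exceptionalTimes {E : ℝ → ℝ → ℝ} {x : ℝ → ℝ} {T t : ℝ}
    (ht : t ∈ Icc 0 T \ exceptionalTimes E x T) : t ∉ JumpSet x T := fun h =>
  ht.2 (Or.inl (Or.inl (Or.inr h)))

theorem continuousAt_of_notMem_exceptionalTimes {E : ℝ → ℝ → ℝ} {x : ℝ → ℝ} {T t : ℝ}
    (ht : t ∈ Icc 0 T \ exceptionalTimes E x T) : ContinuousAt x t := by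
  have hI := mem_Ioo_of_notMem_exceptionalTimes ht
  have : ContinuousWithinAt x (Icc 0 T) t := by
    by_contra h
    exact notMem_jumpSet_of_notMem_exceptionalTimes ht ⟨ht.1, h⟩
  exact this.continuousAt (Icc_mem_nhds hI.1 hI.2)

/-- Strong local stability, transported by the reflection `z ↦ σ z`. -/
theorem StrongLS.not_eventually_one_lt {E : ℝ → ℝ → ℝ} {x : ℝ → ℝ} {T : ℝ}
    (hE : ContDiff ℝ 3 (Function.uncurry E)) (hS : StrongLS E x T) {σ : ℝ} (hσ : σ = 1 ∨ σ = -1)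
    {t : ℝ} (ht : t ∈ Icc 0 T \ JumpSet x T) :
    ¬ ∀ᶠ z in 𝓝[<] (σ * x t), 1 < σ * pEx E t (σ * z) := by
  have hσσ : ∀ y, σ * (σ * y) = y := fun y => by rcases hσ with rfl | rfl <;> ring
  refine not_eventually_one_lt_of_isLocalMin (G := fun z => E t (σ * z)) (fun z => ?_) ?_
  · have h1 : HasDerivAt (fun w => E t w) (pEx E t (σ * z)) (σ * z) :=
      ((contDiff_slice_snd hE t).differentiable (by simp) _).hasDerivAt
    have h2 : HasDerivAt (fun z => σ * z) σ z := by
      simpa using (hasDerivAt_id z).const_mul σ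
    exact (h1.comp z h2).congr_deriv (mul_comm _ _)
  · have hmin := hS t ht
    have htend : Tendsto (fun z => σ * z) (𝓝 (σ * x t)) (𝓝 (x t)) := by
      have : ContinuousAt (fun z => σ * z) (σ * x t) := by fun_prop
      simpa only [ContinuousAt, hσσ] using this
    filter_upwards [htend.eventually hmin] with z hz
    have habs : |σ * z - x t| = |z - σ * x t| := by
      rcases hσ with rfl | rfl
      · simp
      · rw [← abs_neg]; ring_nf
    simpa only [hσσ, sub_self, habs] using hz

theorem StrongLS.mul_pEx_le_one {E : ℝ → ℝ → ℝ} {x : ℝ → ℝ} {T : ℝ}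
    (hE : ContDiff ℝ 3 (Function.uncurry E)) (hS : StrongLS E x T) {σ : ℝ} (hσ : σ = 1 ∨ σ = -1)
    {t : ℝ} (ht : t ∈ Icc 0 T \ JumpSet x T) : σ * pEx E t (x t) ≤ 1 := by
  have hσσ : ∀ y, σ * (σ * y) = y := fun y => by rcases hσ with rfl | rfl <;> ring
  have hc : Continuous (pEx E t) :=
    (contDiff_slice_snd (contDiff_deriv_snd (m := 2) hE (by norm_num)) t).continuous
  simpa only [hσσ] using le_one_of_not_eventually_one_lt
    (by fun_prop) (hS.not_eventually_one_lt hE hσ ht)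

/-- `x` is constant near every regular time at which `|∂ₓE| < 1`. -/
theorem EDUB.eventually_eq {E : ℝ → ℝ → ℝ} {x : ℝ → ℝ} {T : ℝ}
    (hE : ContDiff ℝ 3 (Function.uncurry E)) (hBV : BoundedVariationOn x (Icc 0 T))
    (hED : EDUB E x T) {t : ℝ} (ht : t ∈ Ioo 0 T) (hc : ∀ᶠ s in 𝓝 t, ContinuousAt x s)
    (h1 : pEx E t (x t) < 1) (h2 : -1 < pEx E t (x t)) : ∀ᶠ s in 𝓝 t, x s = x t := by
  obtain ⟨ε₁, hε₁, H₁⟩ := hED.exists_mul_le hE hBV (Or.inl rfl) (t₀ := t) (y₀ := x t) (by linarith)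
  obtain ⟨ε₂, hε₂, H₂⟩ := hED.exists_mul_le hE hBV (Or.inr rfl) (t₀ := t) (y₀ := x t) (by linarith)
  have hev : ∀ᶠ s in 𝓝 t, s ∈ Icc 0 T ∧ ContinuousAt x s ∧
      (|s - t| < ε₁ ∧ |x s - x t| < ε₁) ∧ (|s - t| < ε₂ ∧ |x s - x t| < ε₂) := by
    have hx := hc.self_of_nhds
    have a1 : ∀ ε > 0, ∀ᶠ s in 𝓝 t, |s - t| < ε ∧ |x s - x t| < ε := fun ε hε =>
      Filter.inter_mem (Metric.ball_mem_nhds t hε) (hx.eventually (Metric.ball_mem_nhds (x t) hε))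
    filter_upwards [Icc_mem_nhds ht.1 ht.2, hc, a1 ε₁ hε₁, a1 ε₂ hε₂] with s b1 b2 b3 b4
    exact ⟨b1, b2, b3, b4⟩
  obtain ⟨δ, hδ, hb⟩ := Metric.eventually_nhds_iff.1 hev
  have key : ∀ t₁ t₂, t₁ ≤ t₂ → (∀ s ∈ Icc t₁ t₂, dist s t < δ) → x t₁ = x t₂ := by
    intro t₁ t₂ h12 hd
    have k1 := H₁ t₁ t₂ h12 (fun s hs => (hb (hd s hs)).1)
      (fun s hs => (hb (hd s hs)).2.1.continuousWithinAt) fun s hs => (hb (hd s hs)).2.2.1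
    have k2 := H₂ t₁ t₂ h12 (fun s hs => (hb (hd s hs)).1)
      (fun s hs => (hb (hd s hs)).2.1.continuousWithinAt) fun s hs => (hb (hd s hs)).2.2.2
    linarith
  filter_upwards [Metric.ball_mem_nhds t hδ] with s hs
  rw [Metric.mem_ball, Real.dist_eq, abs_lt] at hs
  rcases le_total s t with hst | hst
  · refine key s t hst fun r hr => ?_
    rw [Real.dist_eq, abs_lt]; constructor <;> linarith [hr.1, hr.2]
  · refine (key t s hst fun r hr => ?_).symm
    rw [Real.dist_eq, abs_lt]; constructor <;> linarith [hr.1, hr.2]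

section Local

variable {E : ℝ → ℝ → ℝ} {x : ℝ → ℝ} {T : ℝ}

theorem exists_slidesOn (hE : ContDiff ℝ 3 (Function.uncurry E))
    (hBV : BoundedVariationOn x (Icc 0 T)) (hS : StrongLS E x T) (hED : EDUB E x T)
    (hH4 : H4cond E T) {t₀ y₀ σ : ℝ} (ht₀ : t₀ ∈ Icc 0 T) (hσ : σ = 1 ∨ σ = -1)
    (h0 : σ * pEx E t₀ y₀ = 1) :
    ∃ ε > 0, ∀ α β, (∀ t ∈ Ioo α β, t ∈ Icc 0 T \ exceptionalTimes E x T ∧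
      |t - t₀| < ε ∧ |x t - y₀| < ε) →
      SlidesOn (fun t z => σ * pEx E t (σ * z)) (fun t => σ * x t) α β := by
  have hσσ : ∀ y, σ * (σ * y) = y := fun y => by rcases hσ with rfl | rfl <;> ring
  have hσ0 : σ ≠ 0 := by rcases hσ with rfl | rfl <;> norm_num
  have hpm : ∀ {t y}, σ * pEx E t y = 1 → pEx E t y = -1 ∨ pEx E t y = 1 := fun {t y} h => by
    rcases hσ with rfl | rfl
    · right; linarith
    · left; linarith
  have hEx : ContDiff ℝ 2 (Function.uncurry (pEx E)) := contDiff_deriv_snd hE (by norm_num)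
  have hExt : ContDiff ℝ 1 (Function.uncurry (pExt E)) := contDiff_deriv_fst hEx (by norm_num)
  have hExtt : ContDiff ℝ 0 (Function.uncurry (pExtt E)) := contDiff_deriv_fst hExt (by norm_num)
  obtain ⟨ε₁, hε₁, H₁⟩ := hED.exists_mul_le hE hBV hσ (t₀ := t₀) (y₀ := y₀) (by linarith)
  have hev : ∀ᶠ p : ℝ × ℝ in 𝓝 (t₀, y₀), -1 < σ * pEx E p.1 p.2 :=
    (continuous_const.mul hEx.continuous).continuousAt.eventually
      (lt_mem_nhds (by change -1 < σ * pEx E t₀ y₀; linarith))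
  have hnd : (∀ᶠ p : ℝ × ℝ in 𝓝 (t₀, y₀), pExt E p.1 p.2 ≠ 0) ∨
      ∀ᶠ p : ℝ × ℝ in 𝓝 (t₀, y₀), pExtt E p.1 p.2 ≠ 0 := by
    by_cases h : pExt E t₀ y₀ = 0
    · have h' : pExtt E t₀ y₀ ≠ 0 := fun h' =>
        (Set.eq_empty_iff_forall_notMem.1 hH4 (t₀, y₀)) ⟨ht₀, hpm h0, h, h'⟩
      exact Or.inr (hExtt.continuous.continuousAt.eventually_ne h')
    · exact Or.inl (hExt.continuous.continuousAt.eventually_ne h)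
  obtain ⟨ε₂, hε₂, hbox⟩ : ∃ ε > 0, (∀ t z, |t - t₀| < ε → |z - y₀| < ε → -1 < σ * pEx E t z) ∧
      ((∀ t z, |t - t₀| < ε → |z - y₀| < ε → pExt E t z ≠ 0) ∨
        ∀ t z, |t - t₀| < ε → |z - y₀| < ε → pExtt E t z ≠ 0) := by
    have hball : ∀ {ε t z}, |t - t₀| < ε → |z - y₀| < ε →
        dist ((t, z) : ℝ × ℝ) (t₀, y₀) < ε := fun h1 h2 => by
      simpa [Prod.dist_eq, Real.dist_eq] using ⟨h1, h2⟩
    rcases hnd with hnd | hnd <;> obtain ⟨ε, hε, hb⟩ := Metric.eventually_nhds_iff.1 (hev.and hnd)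
    · exact ⟨ε, hε, fun t z h1 h2 => (hb (hball h1 h2)).1,
        Or.inl fun t z h1 h2 => (hb (hball h1 h2)).2⟩
    · exact ⟨ε, hε, fun t z h1 h2 => (hb (hball h1 h2)).1,
        Or.inr fun t z h1 h2 => (hb (hball h1 h2)).2⟩
  refine ⟨min ε₁ ε₂, lt_min hε₁ hε₂, fun α β hgood => ?_⟩
  have hIoo : ∀ t ∈ Ioo α β, t ∈ Ioo 0 T := fun t ht =>
    mem_Ioo_of_notMem_exceptionalTimes (hgood t ht).1
  have hJ : ∀ t ∈ Ioo α β, t ∈ Icc 0 T \ JumpSet x T := fun t ht =>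
    ⟨(hgood t ht).1.1, notMem_jumpSet_of_notMem_exceptionalTimes (hgood t ht).1⟩
  have hcont : ∀ t ∈ Ioo α β, ContinuousAt x t := fun t ht =>
    continuousAt_of_notMem_exceptionalTimes (hgood t ht).1
  have hg2 : ∀ t ∈ Ioo α β, |t - t₀| < ε₂ ∧ |x t - y₀| < ε₂ := fun t ht =>
    ⟨(hgood t ht).2.1.trans_le (min_le_right _ _), (hgood t ht).2.2.trans_le (min_le_right _ _)⟩
  have hdz : ∀ t, (deriv fun z => σ * pEx E t (σ * z)) = fun z => pExx E t (σ * z) := fun t => by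
    ext z
    rw [deriv_const_mul_field, deriv_comp_mul_left, smul_eq_mul, hσσ]
    rfl
  have hdzz : ∀ t z, deriv (deriv fun z => σ * pEx E t (σ * z)) z = σ * pExxx E t (σ * z) :=
    fun t z => by
      rw [hdz, deriv_comp_mul_left, smul_eq_mul]
      rfl
  have hdt : ∀ z, (deriv fun s => σ * pEx E s (σ * z)) = fun s => σ * pExt E s (σ * z) :=
    fun z => by
      ext s
      rw [deriv_const_mul_field]
      rfl
  have hdtt : ∀ s z, deriv (fun r => deriv (fun q => σ * pEx E q (σ * z)) r) s
      = σ * pExtt E s (σ * z) := fun s z => by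
    simp only [hdt]
    rw [deriv_const_mul_field]
    rfl
  have hstable : ∀ t ∈ Ioo α β, σ * pEx E t (σ * (σ * x t)) = 1 →
      (∀ᶠ z in 𝓝[<] (σ * x t), σ * pEx E t (σ * z) ≤ 1) ∧
      (deriv (fun z => σ * pEx E t (σ * z)) (σ * x t) = 0 →
        ∀ᶠ z in 𝓝 (σ * x t), σ * pEx E t (σ * z) ≤ 1) := fun t ht h1 => by
    have hc : Continuous (pEx E t) := (contDiff_slice_snd hEx t).continuous
    refine eventually_le_one_of_not_eventually_one_lt (by fun_prop) h1
      (hS.not_eventually_one_lt hE hσ (hJ t ht)) fun h2 h3 => ?_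
    rw [hσσ] at h1
    rw [hdzz, hσσ, mul_eq_zero] at h3
    rw [hdz] at h2
    simp only [hσσ] at h2
    exact (hgood t ht).1.2 (Or.inl (Or.inr ⟨(t, x t),
      ⟨hIoo t ht, hpm h1, h2, h3.resolve_left hσ0⟩, rfl⟩))
  refine ⟨?_, fun t ht => continuousAt_const.mul (hcont t ht), ?_, fun t ht => ?_,
    fun t ht h1 => ?_, fun t ht h1 => (hstable t ht h1).1,
    fun t ht h1 h2 => ⟨?_, (hstable t ht h1).2 h2⟩, ?_⟩
  · exact contDiff_const.mul (hEx.comp (contDiff_fst.prodMk (contDiff_const.mul contDiff_snd)))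
  · intro t₁ h₁ t₂ h₂ h12
    have hsub : Icc t₁ t₂ ⊆ Ioo α β := fun t ht => ⟨h₁.1.trans_le ht.1, ht.2.trans_lt h₂.2⟩
    exact H₁ t₁ t₂ h12 (fun t ht => (hgood t (hsub ht)).1.1)
      (fun t ht => (hcont t (hsub ht)).continuousWithinAt) fun t ht =>
        ⟨(hgood t (hsub ht)).2.1.trans_le (min_le_left _ _),
          (hgood t (hsub ht)).2.2.trans_le (min_le_left _ _)⟩
  · simpa only [hσσ] using hS.mul_pEx_le_one hE hσ (hJ t ht)
  · simp only [hσσ] at h1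
    have h2 := hbox.1 t (x t) (hg2 t ht).1 (hg2 t ht).2
    have h3 : pEx E t (x t) < 1 ∧ -1 < pEx E t (x t) := by
      rcases hσ with rfl | rfl <;> constructor <;> linarith
    have := hED.eventually_eq hE hBV (hIoo t ht)
      (eventually_of_mem (Ioo_mem_nhds ht.1 ht.2) hcont) h3.1 h3.2
    exact this.mono fun s hs => by rw [hs]
  · rw [hdz] at h2
    simp only [hσσ] at h2
    rw [hσσ] at h1
    rw [hdt, hσσ]
    exact mul_ne_zero hσ0 fun h3 => (hgood t ht).1.2 (Or.inr ⟨(t, x t),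
      ⟨hIoo t ht, hpm h1, h2, h3⟩, rfl⟩)
  · refine hbox.2.imp (fun h s hs t ht => ?_) fun h s hs t ht => ?_
    · rw [hdt, hσσ]
      exact mul_ne_zero hσ0 (h s _ (hg2 s hs).1 (hg2 t ht).2)
    · rw [hdtt, hσσ]
      exact mul_ne_zero hσ0 (h s _ (hg2 s hs).1 (hg2 t ht).2)

theorem exists_contDiffOn_of_tendsto (hE : ContDiff ℝ 3 (Function.uncurry E))
    (hBV : BoundedVariationOn x (Icc 0 T)) (hS : StrongLS E x T) (hED : EDUB E x T)
    (hH4 : H4cond E T) {t₀ y₀ : ℝ} (ht₀ : t₀ ∈ Icc 0 T) {l : Filter ℝ} [l.NeBot] (hl : l ≤ 𝓝 t₀)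
    (hreg : ∀ᶠ t in l, t ∈ Icc 0 T \ exceptionalTimes E x T) (hx : Tendsto x l (𝓝 y₀)) :
    ∃ s ∈ l, ∀ α β, α < β → Ioo α β ⊆ s →
      (∃ b > α, ContDiffOn ℝ 1 x (Ioo α b)) ∧ ∃ a < β, ContDiffOn ℝ 1 x (Ioo a β) := by
  have hEx : ContDiff ℝ 2 (Function.uncurry (pEx E)) := contDiff_deriv_snd hE (by norm_num)
  have hlim : Tendsto (fun t => pEx E t (x t)) l (𝓝 (pEx E t₀ y₀)) :=
    (hEx.continuous.tendsto (t₀, y₀)).comp ((tendsto_id'.2 hl).prodMk_nhds hx)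
  have hnear : ∀ ε > 0, ∀ᶠ t in l, |t - t₀| < ε ∧ |x t - y₀| < ε := fun ε hε =>
    Filter.inter_mem (hl (Metric.ball_mem_nhds t₀ hε)) (hx.eventually (Metric.ball_mem_nhds y₀ hε))
  have hbound : ∀ {σ : ℝ}, (σ = 1 ∨ σ = -1) → σ * pEx E t₀ y₀ ≤ 1 := fun {σ} hσ =>
    le_of_tendsto (hlim.const_mul σ) (hreg.mono fun t ht =>
      hS.mul_pEx_le_one hE hσ ⟨ht.1, notMem_jumpSet_of_notMem_exceptionalTimes ht⟩)
  by_cases hσ : ∃ σ : ℝ, (σ = 1 ∨ σ = -1) ∧ σ * pEx E t₀ y₀ = 1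
  · obtain ⟨σ, hσ, h0⟩ := hσ
    obtain ⟨ε, hε, H⟩ := exists_slidesOn hE hBV hS hED hH4 ht₀ hσ h0
    refine ⟨_, hreg.and (hnear ε hε), fun α β hαβ hsub => ?_⟩
    have hxx : x = fun t => σ * (σ * x t) := by
      ext t
      rcases hσ with rfl | rfl <;> ring
    obtain ⟨⟨b, hb, hb'⟩, a, ha, ha'⟩ := (H α β fun t ht => hsub ht).exists_contDiffOn hαβ
    rw [hxx]
    exact ⟨⟨b, hb, contDiffOn_const.mul hb'⟩, a, ha, contDiffOn_const.mul ha'⟩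
  · push Not at hσ
    have h1 : pEx E t₀ y₀ < 1 := by
      simpa using lt_of_le_of_ne (hbound (Or.inl rfl)) (hσ 1 (Or.inl rfl))
    have h2 : -1 < pEx E t₀ y₀ := by
      linarith [lt_of_le_of_ne (hbound (Or.inr rfl)) (hσ (-1) (Or.inr rfl))]
    refine ⟨_, hreg.and ((hlim.eventually (gt_mem_nhds h1)).and (hlim.eventually (lt_mem_nhds h2))),
      fun α β hαβ hsub => ?_⟩
    have : ContDiffOn ℝ 1 x (Ioo α β) := fun t ht =>
      (contDiffAt_const.congr_of_eventuallyEq (hED.eventually_eq hE hBV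
        (mem_Ioo_of_notMem_exceptionalTimes (hsub ht).1)
        (eventually_of_mem (Ioo_mem_nhds ht.1 ht.2) fun s hs =>
          continuousAt_of_notMem_exceptionalTimes (hsub hs).1)
        (hsub ht).2.1 (hsub ht).2.2)).contDiffWithinAt
    exact ⟨⟨β, hαβ, this⟩, α, hαβ, this⟩

theorem eventually_notMem_of_finite {S : Set ℝ} (hS : S.Finite) (t : ℝ) :
    ∀ᶠ s in 𝓝[≠] t, s ∉ S := by
  have : (S \ {t})ᶜ ∈ 𝓝 t := hS.sdiff.isClosed.isOpen_compl.mem_nhds (by simp)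
  filter_upwards [nhdsWithin_le_nhds this, self_mem_nhdsWithin] with s hs hne hmem
  exact hs ⟨hmem, hne⟩

theorem exists_contDiffOn_Ioo_right (hE : ContDiff ℝ 3 (Function.uncurry E))
    (hBV : BoundedVariationOn x (Icc 0 T)) (hJ : (JumpSet x T).Finite) (hS : StrongLS E x T)
    (hED : EDUB E x T) (hH1 : H1cond E T) (hH3 : H3cond E T) (hH4 : H4cond E T) {t₀ : ℝ}
    (ht₀ : t₀ ∈ Ico 0 T) : ∃ b > t₀, ContDiffOn ℝ 1 x (Ioo t₀ b) := by
  obtain ⟨y₀, hy₀⟩ := hBV.exists_tendsto_right t₀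
  have hmem : Icc 0 T ∈ 𝓝[>] t₀ := mem_of_superset (Ioo_mem_nhdsGT ht₀.2) fun t ht =>
    ⟨ht₀.1.trans ht.1.le, ht.2.le⟩
  have hle : 𝓝[>] t₀ ≤ 𝓝[Icc 0 T ∩ Ioi t₀] t₀ :=
    le_inf nhdsWithin_le_nhds (le_principal_iff.2 (inter_mem hmem self_mem_nhdsWithin))
  obtain ⟨s, hs, H⟩ := exists_contDiffOn_of_tendsto hE hBV hS hED hH4
    (Ico_subset_Icc_self ht₀) (l := 𝓝[>] t₀) nhdsWithin_le_nhds
    (Filter.inter_mem hmem (nhdsGT_le_nhdsNE _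
      (eventually_notMem_of_finite (exceptionalTimes_finite hJ hH1 hH3) t₀))) (hy₀.mono_left hle)
  obtain ⟨b, hb, hsub⟩ := mem_nhdsGT_iff_exists_Ioo_subset.1 hs
  exact (H t₀ b hb hsub).1

theorem exists_contDiffOn_Ioo_left (hE : ContDiff ℝ 3 (Function.uncurry E))
    (hBV : BoundedVariationOn x (Icc 0 T)) (hJ : (JumpSet x T).Finite) (hS : StrongLS E x T)
    (hED : EDUB E x T) (hH1 : H1cond E T) (hH3 : H3cond E T) (hH4 : H4cond E T) {t₀ : ℝ}
    (ht₀ : t₀ ∈ Ioc 0 T) : ∃ a < t₀, ContDiffOn ℝ 1 x (Ioo a t₀) := by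
  obtain ⟨y₀, hy₀⟩ := hBV.exists_tendsto_left t₀
  have hmem : Icc 0 T ∈ 𝓝[<] t₀ := mem_of_superset (Ioo_mem_nhdsLT ht₀.1) fun t ht =>
    ⟨ht.1.le, ht.2.le.trans ht₀.2⟩
  have hle : 𝓝[<] t₀ ≤ 𝓝[Icc 0 T ∩ Iio t₀] t₀ :=
    le_inf nhdsWithin_le_nhds (le_principal_iff.2 (inter_mem hmem self_mem_nhdsWithin))
  obtain ⟨s, hs, H⟩ := exists_contDiffOn_of_tendsto hE hBV hS hED hH4
    (Ioc_subset_Icc_self ht₀) (l := 𝓝[<] t₀) nhdsWithin_le_nhds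
    (Filter.inter_mem hmem (nhdsLT_le_nhdsNE _
      (eventually_notMem_of_finite (exceptionalTimes_finite hJ hH1 hH3) t₀))) (hy₀.mono_left hle)
  obtain ⟨a, ha, hsub⟩ := mem_nhdsLT_iff_exists_Ioo_subset.1 hs
  exact (H a t₀ ha hsub).2

end Local

theorem finite_not_contDiffAt {x : ℝ → ℝ} {T : ℝ}
    (hR : ∀ t ∈ Ico 0 T, ∃ b > t, ContDiffOn ℝ 1 x (Ioo t b))
    (hL : ∀ t ∈ Ioc 0 T, ∃ a < t, ContDiffOn ℝ 1 x (Ioo a t)) :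
    {t ∈ Ioo 0 T | ¬ ContDiffAt ℝ 1 x t}.Finite := by
  set B := {t ∈ Ioo 0 T | ¬ ContDiffAt ℝ 1 x t} with hB
  have hloc : ∀ t ∈ Icc 0 T, ∃ U ∈ 𝓝 t, (U ∩ B).Finite := by
    intro t ht
    have h1 : ∀ᶠ s in 𝓝[>] t, s ∉ B := by
      rcases ht.2.lt_or_eq with hlt | rfl
      · obtain ⟨b, hb, hc⟩ := hR t ⟨ht.1, hlt⟩
        filter_upwards [Ioo_mem_nhdsGT hb] with s hs hsB
        exact hsB.2 (hc.contDiffAt (Ioo_mem_nhds hs.1 hs.2))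
      · filter_upwards [self_mem_nhdsWithin] with s hs hsB
        exact lt_asymm hs hsB.1.2
    have h2 : ∀ᶠ s in 𝓝[<] t, s ∉ B := by
      rcases ht.1.lt_or_eq with hlt | rfl
      · obtain ⟨a, ha, hc⟩ := hL t ⟨hlt, ht.2⟩
        filter_upwards [Ioo_mem_nhdsLT ha] with s hs hsB
        exact hsB.2 (hc.contDiffAt (Ioo_mem_nhds hs.1 hs.2))
      · filter_upwards [self_mem_nhdsWithin] with s hs hsB
        exact lt_asymm hs hsB.1.1
    have h3 : ∀ᶠ s in 𝓝[≠] t, s ∉ B := by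
      rw [← nhdsLT_sup_nhdsGT]
      exact eventually_sup.2 ⟨h2, h1⟩
    refine ⟨_, eventually_nhdsWithin_iff.1 h3, (Set.finite_singleton t).subset fun s hs => ?_⟩
    by_contra hne
    exact hs.1 hne hs.2
  choose! U hU hUf using hloc
  obtain ⟨F, hF, hcov⟩ := isCompact_Icc.elim_nhds_subcover U hU
  refine ((F.finite_toSet.biUnion fun t ht => hUf t (hF t ht))).subset fun s hs => ?_
  obtain ⟨t, ht, hst⟩ := mem_iUnion₂.1 (hcov (Ioo_subset_Icc_self hs.1))
  exact mem_iUnion₂.2 ⟨t, ht, hst, hs⟩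

/-- A finite set of points cuts `[a, b]` into finitely many intervals. -/
theorem exists_partition_Icc {a b : ℝ} (hab : a < b) {B : Set ℝ} (hB : B.Finite) :
    ∃ (M : ℕ) (I : Fin M → Set ℝ), (∀ n, ∃ c d : ℝ, c < d ∧ I n = Ioo c d) ∧
      (∀ m n, m ≠ n → Disjoint (I m) (I n)) ∧ Icc a b = ⋃ n, closure (I n) ∧
      ∀ n, I n ⊆ Ioo a b \ B := by
  classical
  set F : Finset ℝ := insert a (insert b (hB.toFinset.filter (· ∈ Ioo a b))) with hF
  have haF : a ∈ F := by simp [hF]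
  have hbF : b ∈ F := by simp [hF]
  have hFI : ∀ t ∈ F, t ∈ Icc a b := by
    intro t ht
    simp only [hF, Finset.mem_insert, Finset.mem_filter] at ht
    rcases ht with rfl | rfl | ⟨-, ht⟩
    · exact left_mem_Icc.2 hab.le
    · exact right_mem_Icc.2 hab.le
    · exact Ioo_subset_Icc_self ht
  obtain ⟨M, hM⟩ : ∃ M, F.card = M + 1 :=
    Nat.exists_eq_succ_of_ne_zero (Finset.card_pos.2 ⟨a, haF⟩).ne'
  set e := F.orderEmbOfFin hM with he
  have hmem : ∀ n, e n ∈ F := fun n => Finset.orderEmbOfFin_mem F hM n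
  have hsurj : ∀ t ∈ F, ∃ n, e n = t := fun t ht => by
    have : t ∈ Set.range e := by rw [he, Finset.range_orderEmbOfFin]; exact ht
    exact this
  have hlt : ∀ n : Fin M, e n.castSucc < e n.succ := fun n => e.strictMono n.castSucc_lt_succ
  refine ⟨M, fun n => Ioo (e n.castSucc) (e n.succ), fun n => ⟨_, _, hlt n, rfl⟩, ?_, ?_, ?_⟩
  · have key : ∀ m n : Fin M, m < n →
        Disjoint (Ioo (e m.castSucc) (e m.succ)) (Ioo (e n.castSucc) (e n.succ)) := by
      intro m n hmn
      refine Set.disjoint_left.2 fun t h1 h2 => ?_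
      have : e m.succ ≤ e n.castSucc := e.monotone (by
        rw [Fin.le_def]; simpa using hmn)
      linarith [h1.2, h2.1]
    intro m n hmn
    rcases hmn.lt_or_gt with h | h
    · exact key m n h
    · exact (key n m h).symm
  · ext t
    simp only [mem_iUnion, fun n => closure_Ioo (hlt n).ne]
    constructor
    · intro ht
      rcases ht.2.lt_or_eq with htb | rfl
      · obtain ⟨i, hi⟩ := hsurj a haF
        obtain ⟨n, hn, hmax⟩ := (Finset.univ.filter fun n => e n ≤ t).exists_maximal
          ⟨i, by simpa [hi] using ht.1⟩
        obtain ⟨j, hj⟩ := hsurj b hbF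
        have hn' : e n ≤ t := by simpa using hn
        have hnj : n < j := e.lt_iff_lt.1 (by rw [hj]; exact hn'.trans_lt htb)
        have hnl : n ≠ Fin.last M := (hnj.trans_le (Fin.le_last j)).ne
        refine ⟨n.castPred hnl, by simpa using hn', ?_⟩
        by_contra! h
        have h3 := hmax (by simpa using h.le) (by simp [Fin.le_def])
        simp [Fin.le_def] at h3
      · obtain ⟨i, hi⟩ := hsurj a haF
        obtain ⟨j, hj⟩ := hsurj t hbF
        have hij : i < j := e.lt_iff_lt.1 (by rw [hi, hj]; exact hab)
        have hj0 : j ≠ 0 := ((Fin.zero_le i).trans_lt hij).ne'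
        refine ⟨j.pred hj0, ?_, ?_⟩
        · rw [← hj]
          exact e.monotone (by simp [Fin.le_def])
        · simp [hj]
    · rintro ⟨n, hn⟩
      exact ⟨(hFI _ (hmem _)).1.trans hn.1, hn.2.trans (hFI _ (hmem _)).2⟩
  · intro n t ht
    have htI : t ∈ Ioo a b :=
      ⟨(hFI _ (hmem _)).1.trans_lt ht.1, ht.2.trans_le (hFI _ (hmem _)).2⟩
    refine ⟨htI, fun htB => ?_⟩
    obtain ⟨k, hk⟩ := hsurj t (by simp [hF, htB, htI.1, htI.2])
    rw [← hk] at ht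
    have h1 := e.lt_iff_lt.1 ht.1
    have h2 := e.lt_iff_lt.1 ht.2
    rw [Fin.lt_def] at h1 h2
    simp at h1 h2
    omega

/-- under (H1), (H3) and (H4), `[0,T]` is a finite union of closures of disjoint
open intervals on each of which `x` is `C¹`. -/
theorem piecewise_C1
    (T : ℝ) (hT : 0 < T) (E : ℝ → ℝ → ℝ)
    (hE : ContDiff ℝ 3 (Function.uncurry E))
    (x : ℝ → ℝ) (hBV : BoundedVariationOn x (Set.Icc 0 T))
    (hJfin : (JumpSet x T).Finite)
    (hSLS : StrongLS E x T) (hED : EDUB E x T)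
    (hH1 : H1cond E T) (hH3 : H3cond E T) (hH4 : H4cond E T) :
    ∃ (M : ℕ) (I : Fin M → Set ℝ),
      (∀ n, ∃ a b : ℝ, a < b ∧ I n = Set.Ioo a b) ∧
      (∀ m n, m ≠ n → Disjoint (I m) (I n)) ∧
      Set.Icc 0 T = ⋃ n, closure (I n) ∧
      ∀ n, ContDiffOn ℝ 1 x (I n) := by
  obtain ⟨M, I, h1, h2, h3, h4⟩ := exists_partition_Icc hT (finite_not_contDiffAt
    (fun t ht => exists_contDiffOn_Ioo_right hE hBV hJfin hSLS hED hH1 hH3 hH4 ht)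
    (fun t ht => exists_contDiffOn_Ioo_left hE hBV hJfin hSLS hED hH1 hH3 hH4 ht))
  refine ⟨M, I, h1, h2, h3, fun n t ht => ContDiffAt.contDiffWithinAt ?_⟩
  by_contra hn
  exact (h4 n ht).2 ⟨(h4 n ht).1, hn⟩
end

section
/- Assume (H5). Then every BV function x:[0,T]→ℝ satisfying the weak local stability and the energy-dissipation upper bound has only finitely many jumps. -/
open Set Filter Topology MeasureTheory

/-- A function whose slope lies strictly between `-1` and `1` cannot decrease by as much as the
distance between two different points. -/
lemma eq_of_sub_le_neg_abs_of_abs_deriv_lt_one {f f' : ℝ → ℝ} {u v a b : ℝ}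
    (hf : ∀ z, HasDerivAt f (f' z) z) (hlt : ∀ z ∈ Icc u v, |f' z| < 1)
    (ha : a ∈ Icc u v) (hb : b ∈ Icc u v) (hab : f b - f a ≤ -|b - a|) : a = b := by
  have hc : Continuous f := continuous_iff_continuousAt.2 fun z => (hf z).continuousAt
  rcases lt_trichotomy a b with h | h | h
  · obtain ⟨ξ, hξ, he⟩ := exists_hasDerivAt_eq_slope f f' h hc.continuousOn fun z _ => hf z
    have := abs_lt.1 (hlt ξ ⟨ha.1.trans hξ.1.le, hξ.2.le.trans hb.2⟩)
    rw [eq_div_iff (sub_pos.2 h).ne'] at he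
    rw [abs_of_pos (sub_pos.2 h)] at hab
    nlinarith
  · exact h
  · obtain ⟨ξ, hξ, he⟩ := exists_hasDerivAt_eq_slope f f' h hc.continuousOn fun z _ => hf z
    have := abs_lt.1 (hlt ξ ⟨hb.1.trans hξ.1.le, hξ.2.le.trans ha.2⟩)
    rw [eq_div_iff (sub_pos.2 h).ne'] at he
    rw [abs_of_neg (sub_neg.2 h)] at hab
    nlinarith

/-- A decreasing function, strictly convex or strictly concave, admits no energetic jump between
points where its slope is at least `-1`. -/
lemma jump_trivial_of_deriv_neg {f f' f'' : ℝ → ℝ} {u v a b c : ℝ}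
    (hf : ∀ z, HasDerivAt f (f' z) z) (hf' : ∀ z, HasDerivAt f' (f'' z) z)
    (hneg : ∀ z ∈ Icc u v, f' z < 0)
    (hsign : (∀ z ∈ Icc u v, 0 < f'' z) ∨ (∀ z ∈ Icc u v, f'' z < 0))
    (ha : a ∈ Icc u v) (hb : b ∈ Icc u v) (hc : c ∈ Icc u v)
    (hfa : -1 ≤ f' a) (hfc : -1 ≤ f' c)
    (hab : f b - f a ≤ -|b - a|) (hbc : f c - f b ≤ -|c - b|) : a = b ∧ b = c := by
  have hcont : Continuous f := continuous_iff_continuousAt.2 fun z => (hf z).continuousAt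
  have hcont' : Continuous f' := continuous_iff_continuousAt.2 fun z => (hf' z).continuousAt
  have hanti : StrictAntiOn f (Icc u v) :=
    strictAntiOn_of_deriv_neg (convex_Icc u v) hcont.continuousOn fun z hz => by
      rw [(hf z).deriv]; exact hneg z (interior_subset hz)
  have h1 : a ≤ b := by
    by_contra! h
    linarith [hanti hb ha h, abs_nonneg (b - a)]
  have h2 : b ≤ c := by
    by_contra! h
    linarith [hanti hc hb h, abs_nonneg (c - b)]
  rw [abs_of_nonneg (sub_nonneg.2 h1)] at hab
  rw [abs_of_nonneg (sub_nonneg.2 h2)] at hbc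
  suffices hac : ¬ a < c by
    constructor <;> linarith
  intro hac
  obtain ⟨ξ, hξ, he⟩ := exists_hasDerivAt_eq_slope f f' hac hcont.continuousOn fun z _ => hf z
  have hξI : ξ ∈ Icc u v := ⟨ha.1.trans hξ.1.le, hξ.2.le.trans hc.2⟩
  rw [eq_div_iff (sub_pos.2 hac).ne'] at he
  have hle : f' ξ ≤ -1 := by
    by_contra! h
    nlinarith
  rcases hsign with hs | hs
  · have hmono : StrictMonoOn f' (Icc u v) :=
      strictMonoOn_of_deriv_pos (convex_Icc u v) hcont'.continuousOn fun z hz => by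
        rw [(hf' z).deriv]; exact hs z (interior_subset hz)
    linarith [hmono ha hξI hξ.1]
  · have hanti' : StrictAntiOn f' (Icc u v) :=
      strictAntiOn_of_deriv_neg (convex_Icc u v) hcont'.continuousOn fun z hz => by
        rw [(hf' z).deriv]; exact hs z (interior_subset hz)
    linarith [hanti' hξI hc hξ.2]

/-- The mirror image of `jump_trivial_of_deriv_neg`, for increasing functions. -/
lemma jump_trivial_of_deriv_pos {f f' f'' : ℝ → ℝ} {u v a b c : ℝ}
    (hf : ∀ z, HasDerivAt f (f' z) z) (hf' : ∀ z, HasDerivAt f' (f'' z) z)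
    (hpos : ∀ z ∈ Icc u v, 0 < f' z)
    (hsign : (∀ z ∈ Icc u v, 0 < f'' z) ∨ (∀ z ∈ Icc u v, f'' z < 0))
    (ha : a ∈ Icc u v) (hb : b ∈ Icc u v) (hc : c ∈ Icc u v)
    (hfa : f' a ≤ 1) (hfc : f' c ≤ 1)
    (hab : f b - f a ≤ -|b - a|) (hbc : f c - f b ≤ -|c - b|) : a = b ∧ b = c := by
  rw [abs_sub_comm] at hab hbc
  obtain ⟨h1, h2⟩ := jump_trivial_of_deriv_neg (f := fun z => -f z) (f' := fun z => -f' z)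
    (f'' := fun z => -f'' z) (a := c) (b := b) (c := a) (fun z => (hf z).neg)
    (fun z => (hf' z).neg) (fun z hz => neg_neg_of_pos (hpos z hz))
    (hsign.symm.imp (fun h z hz => neg_pos.2 (h z hz)) fun h z hz => neg_neg_of_pos (h z hz))
    hc hb ha (neg_le_neg hfc) (neg_le_neg hfa) (by linarith) (by linarith)
  exact ⟨h2.symm, h1.symm⟩

lemma ContDiff.uncurry_deriv_snd {F : ℝ → ℝ → ℝ} {m n : WithTop ℕ∞}
    (hF : ContDiff ℝ m (Function.uncurry F)) (hnm : n + 1 ≤ m) :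
    ContDiff ℝ n (Function.uncurry fun t y => deriv (F t) y) := by
  have h : ContDiff ℝ m (Function.uncurry fun (p : ℝ × ℝ) (z : ℝ) => F p.1 z) :=
    hF.comp (f := fun q : (ℝ × ℝ) × ℝ => (q.1.1, q.2)) (by fun_prop)
  exact h.fderiv_apply (g := fun p : ℝ × ℝ => p.2) (k := fun _ => (1 : ℝ)) contDiff_snd
    contDiff_const hnm

lemma ContDiff.uncurry_deriv_fst {F : ℝ → ℝ → ℝ} {m n : WithTop ℕ∞}
    (hF : ContDiff ℝ m (Function.uncurry F)) (hnm : n + 1 ≤ m) :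
    ContDiff ℝ n (Function.uncurry fun t y => deriv (fun s => F s y) t) := by
  have h : ContDiff ℝ m (Function.uncurry fun (p : ℝ × ℝ) (s : ℝ) => F s p.2) :=
    hF.comp (f := fun q : (ℝ × ℝ) × ℝ => (q.2, q.1.2)) (by fun_prop)
  exact h.fderiv_apply (g := fun p : ℝ × ℝ => p.1) (k := fun _ => (1 : ℝ)) contDiff_fst
    contDiff_const hnm

lemma ContDiff.hasDerivAt_snd {F : ℝ → ℝ → ℝ} {m : WithTop ℕ∞}
    (hF : ContDiff ℝ m (Function.uncurry F)) (hm : m ≠ 0) (t y : ℝ) :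
    HasDerivAt (F t) (deriv (F t) y) y := by
  have h : ContDiff ℝ m (F t) :=
    hF.comp (f := fun z : ℝ => (t, z)) (by fun_prop)
  exact (h.differentiable hm y).hasDerivAt

/-- A property holding near `(t₀, y₀)` holds on a product of balls, the second one closed. -/
lemma exists_forall_Icc_of_eventually_nhds {P : ℝ × ℝ → Prop} {t₀ y₀ : ℝ}
    (h : ∀ᶠ p in 𝓝 (t₀, y₀), P p) :
    ∃ ε > 0, ∀ t, |t - t₀| < ε → ∀ z ∈ Icc (y₀ - ε) (y₀ + ε), P (t, z) := by
  obtain ⟨δ, hδ, h⟩ := Metric.eventually_nhds_iff.1 h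
  refine ⟨δ / 2, half_pos hδ, fun t ht z hz => h ?_⟩
  rw [Prod.dist_eq, max_lt_iff, Real.dist_eq, Real.dist_eq]
  exact ⟨by dsimp only; linarith, abs_lt.2 ⟨by dsimp only; linarith [hz.1],
    by dsimp only; linarith [hz.2]⟩⟩

/-- Near a point where `∂ₓE = ±1` and `∂ₓₓE = 0` do not hold together, stable energetic jumps are
trivial. -/
lemma exists_nhds_jump_trivial {E : ℝ → ℝ → ℝ} (hE : ContDiff ℝ 3 (Function.uncurry E))
    {t₀ y₀ : ℝ} (h5 : (pEx E t₀ y₀ = -1 ∨ pEx E t₀ y₀ = 1) → pExx E t₀ y₀ ≠ 0) :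
    ∃ ε > 0, ∀ t, |t - t₀| < ε → ∀ a ∈ Icc (y₀ - ε) (y₀ + ε), ∀ b ∈ Icc (y₀ - ε) (y₀ + ε),
      ∀ c ∈ Icc (y₀ - ε) (y₀ + ε), |pEx E t a| ≤ 1 → |pEx E t c| ≤ 1 →
      E t b - E t a ≤ -|b - a| → E t c - E t b ≤ -|c - b| → a = b ∧ b = c := by
  have hEx : ContDiff ℝ 2 (Function.uncurry (pEx E)) := hE.uncurry_deriv_snd (by norm_num)
  have hExx : ContDiff ℝ 1 (Function.uncurry (pExx E)) := hEx.uncurry_deriv_snd (by norm_num)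
  have hd : ∀ t z, HasDerivAt (E t) (pEx E t z) z := hE.hasDerivAt_snd (by norm_num)
  have hd' : ∀ t z, HasDerivAt (pEx E t) (pExx E t z) z := hEx.hasDerivAt_snd (by norm_num)
  have hc := hEx.continuous.continuousAt (x := (t₀, y₀))
  have hc' := hExx.continuous.continuousAt (x := (t₀, y₀))
  have key : pExx E t₀ y₀ ≠ 0 → ∃ ε > 0, ∀ t, |t - t₀| < ε →
      ((∀ z ∈ Icc (y₀ - ε) (y₀ + ε), 0 < pExx E t z) ∨
        ∀ z ∈ Icc (y₀ - ε) (y₀ + ε), pExx E t z < 0) := by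
    intro h
    rcases h.lt_or_gt with h | h
    · obtain ⟨ε, hε, H⟩ := exists_forall_Icc_of_eventually_nhds (hc'.eventually_lt_const h)
      exact ⟨ε, hε, fun t ht => Or.inr (H t ht)⟩
    · obtain ⟨ε, hε, H⟩ := exists_forall_Icc_of_eventually_nhds (hc'.eventually_const_lt h)
      exact ⟨ε, hε, fun t ht => Or.inl (H t ht)⟩
  have hsub : ∀ {ε δ : ℝ}, Icc (y₀ - min ε δ) (y₀ + min ε δ) ⊆ Icc (y₀ - ε) (y₀ + ε) ∩
      Icc (y₀ - δ) (y₀ + δ) := fun {ε δ} z hz =>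
    ⟨⟨by linarith [hz.1, min_le_left ε δ], by linarith [hz.2, min_le_left ε δ]⟩,
      by linarith [hz.1, min_le_right ε δ], by linarith [hz.2, min_le_right ε δ]⟩
  rcases lt_trichotomy |pEx E t₀ y₀| 1 with h | h | h
  · obtain ⟨ε, hε, H⟩ := exists_forall_Icc_of_eventually_nhds (hc.abs.eventually_lt_const h)
    exact ⟨ε, hε, fun t ht a ha b hb c hc _ _ hab hbc =>
      ⟨eq_of_sub_le_neg_abs_of_abs_deriv_lt_one (hd t) (H t ht) ha hb hab,
        eq_of_sub_le_neg_abs_of_abs_deriv_lt_one (hd t) (H t ht) hb hc hbc⟩⟩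
  · rcases (abs_eq zero_le_one).1 h with h | h
    · obtain ⟨ε, hε, H⟩ := key (h5 (Or.inr h))
      obtain ⟨δ, hδ, K⟩ := exists_forall_Icc_of_eventually_nhds
        (hc.eventually_const_lt (show (0 : ℝ) < pEx E t₀ y₀ by rw [h]; norm_num))
      exact ⟨min ε δ, lt_min hε hδ, fun t ht a ha b hb c hc ha' hc' hab hbc =>
        jump_trivial_of_deriv_pos (hd t) (hd' t)
          (fun z hz => K t (ht.trans_le (min_le_right _ _)) z (hsub hz).2)
          ((H t (ht.trans_le (min_le_left _ _))).imp (fun H z hz => H z (hsub hz).1)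
            fun H z hz => H z (hsub hz).1)
          ha hb hc (abs_le.1 ha').2 (abs_le.1 hc').2 hab hbc⟩
    · obtain ⟨ε, hε, H⟩ := key (h5 (Or.inl h))
      obtain ⟨δ, hδ, K⟩ := exists_forall_Icc_of_eventually_nhds
        (hc.eventually_lt_const (show pEx E t₀ y₀ < (0 : ℝ) by rw [h]; norm_num))
      exact ⟨min ε δ, lt_min hε hδ, fun t ht a ha b hb c hc ha' hc' hab hbc =>
        jump_trivial_of_deriv_neg (hd t) (hd' t)
          (fun z hz => K t (ht.trans_le (min_le_right _ _)) z (hsub hz).2)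
          ((H t (ht.trans_le (min_le_left _ _))).imp (fun H z hz => H z (hsub hz).1)
            fun H z hz => H z (hsub hz).1)
          ha hb hc (abs_le.1 ha').1 (abs_le.1 hc').1 hab hbc⟩
  · obtain ⟨ε, hε, H⟩ := exists_forall_Icc_of_eventually_nhds (hc.abs.eventually_const_lt h)
    exact ⟨ε, hε, fun t ht a ha b hb c hc ha' => absurd ha' (H t ht a ha).not_ge⟩

/-- The energy-dissipation upper bound, with the power term estimated by its length. -/
lemma EDUB.exists_sub_le {E : ℝ → ℝ → ℝ} {x : ℝ → ℝ} {T : ℝ}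
    (hED : EDUB E x T) (hE : ContDiff ℝ 3 (Function.uncurry E))
    (hBV : BoundedVariationOn x (Icc 0 T)) :
    ∃ C, ∀ s t, 0 ≤ s → s ≤ t → t ≤ T →
      E t (x t) - E s (x s) ≤ C * (t - s) - |x t - x s| := by
  have hEt : ContDiff ℝ 2 (Function.uncurry (pEt E)) := hE.uncurry_deriv_fst (by norm_num)
  set R := (eVariationOn x (Icc 0 T)).toReal
  obtain ⟨C, hC⟩ := (isCompact_Icc (a := (0 : ℝ)) (b := T)).prod
    (isCompact_Icc (a := x 0 - R) (b := x 0 + R)) |>.exists_bound_of_continuousOn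
    hEt.continuous.continuousOn
  refine ⟨C, fun s t hs hst ht => ?_⟩
  have h0 : (0 : ℝ) ∈ Icc 0 T := ⟨le_rfl, hs.trans (hst.trans ht)⟩
  have hint : |∫ r in s..t, pEt E r (x r)| ≤ C * |t - s| :=
    intervalIntegral.norm_integral_le_of_norm_le_const (C := C) fun r hr => by
      replace hr := uIoc_of_le hst ▸ hr
      have hrT : r ∈ Icc 0 T := ⟨hs.trans hr.1.le, hr.2.trans ht⟩
      have := abs_le.1 (Real.dist_eq (x r) (x 0) ▸ hBV.dist_le hrT h0)
      exact hC (r, x r) ⟨hrT, by linarith, by linarith⟩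
  have hdiss : |x t - x s| ≤ Diss x s t := by
    rw [← Real.dist_eq]
    exact (hBV.mono (Icc_subset_Icc hs ht)).dist_le (right_mem_Icc.2 hst) (left_mem_Icc.2 hst)
  rw [abs_of_nonneg (sub_nonneg.2 hst)] at hint
  linarith [hED s t hs hst ht, le_abs_self (∫ r in s..t, pEt E r (x r))]

/-- Weak local stability passes to one-sided limits, since continuity points are dense. -/
lemma WeakLS.abs_le_of_tendsto {E : ℝ → ℝ → ℝ} {x : ℝ → ℝ} {T t a : ℝ} {S : Set ℝ}
    (hWLS : WeakLS E x T) (hE : ContDiff ℝ 3 (Function.uncurry E))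
    (hBV : BoundedVariationOn x (Icc 0 T)) (hS : IsOpen S) (hST : S ⊆ Icc 0 T)
    (ht : t ∈ closure S) (hx : Tendsto x (𝓝[S] t) (𝓝 a)) : |pEx E t a| ≤ 1 := by
  have hEx : ContDiff ℝ 2 (Function.uncurry (pEx E)) := hE.uncurry_deriv_snd (by norm_num)
  have hdense : Dense {s | s ∈ Icc 0 T → DifferentiableWithinAt ℝ x (Icc 0 T) s} :=
    Measure.dense_of_ae hBV.locallyBoundedVariationOn.ae_differentiableWithinAt_of_mem
  have hfreq : ∃ᶠ s in 𝓝[S] t, |pEx E s (x s)| ≤ 1 := by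
    rw [frequently_nhdsWithin_iff]
    refine mem_closure_iff_frequently.1 (closure_mono ?_ <| closure_minimal (hdense.open_subset_closure_inter hS)
      isClosed_closure ht)
    rintro s ⟨hs, hd⟩
    exact ⟨hWLS s (hST hs) (hd (hST hs)).continuousWithinAt, hs⟩
  have hlim : Tendsto (fun s => |pEx E s (x s)|) (𝓝[S] t) (𝓝 |pEx E t a|) :=
    ((hEx.continuous.tendsto (t, a)).comp
      ((tendsto_id.mono_left nhdsWithin_le_nhds).prodMk_nhds hx)).abs
  exact isClosed_Iic.mem_of_frequently_of_tendsto hfreq hlim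

/-- The energy inequality between the left limit and the value at an interior time. -/
lemma energy_jump_left {E : ℝ → ℝ → ℝ} {x : ℝ → ℝ} {C T t a : ℝ}
    (hE : Continuous (Function.uncurry E))
    (h : ∀ s t, 0 ≤ s → s ≤ t → t ≤ T → E t (x t) - E s (x s) ≤ C * (t - s) - |x t - x s|)
    (ht : t ∈ Ioo 0 T) (hx : Tendsto x (𝓝[<] t) (𝓝 a)) :
    E t (x t) - E t a ≤ -|x t - a| := by
  have hid : Tendsto (fun s : ℝ => s) (𝓝[<] t) (𝓝 t) := nhdsWithin_le_nhds
  have hEs : Tendsto (fun s => E s (x s)) (𝓝[<] t) (𝓝 (E t a)) :=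
    (hE.tendsto (t, a)).comp (hid.prodMk_nhds hx)
  have h1 := hEs.const_sub (E t (x t))
  have h2 := ((hid.const_sub t).const_mul C).sub (hx.const_sub (x t)).abs
  rw [sub_self, mul_zero, zero_sub] at h2
  refine le_of_tendsto_of_tendsto h1 h2 ?_
  filter_upwards [Ioo_mem_nhdsLT ht.1] with s hs
  exact h s t hs.1.le hs.2.le ht.2.le

/-- The right-hand counterpart of `energy_jump_left`. -/
lemma energy_jump_right {E : ℝ → ℝ → ℝ} {x : ℝ → ℝ} {C T t c : ℝ}
    (hE : Continuous (Function.uncurry E))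
    (h : ∀ s t, 0 ≤ s → s ≤ t → t ≤ T → E t (x t) - E s (x s) ≤ C * (t - s) - |x t - x s|)
    (ht : t ∈ Ioo 0 T) (hx : Tendsto x (𝓝[>] t) (𝓝 c)) :
    E t c - E t (x t) ≤ -|c - x t| := by
  have hid : Tendsto (fun s : ℝ => s) (𝓝[>] t) (𝓝 t) := nhdsWithin_le_nhds
  have hEs : Tendsto (fun s => E s (x s)) (𝓝[>] t) (𝓝 (E t c)) :=
    (hE.tendsto (t, c)).comp (hid.prodMk_nhds hx)
  have h1 := hEs.sub_const (E t (x t))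
  have h2 := ((hid.sub_const t).const_mul C).sub (hx.sub_const (x t)).abs
  rw [sub_self, mul_zero, zero_sub] at h2
  refine le_of_tendsto_of_tendsto h1 h2 ?_
  filter_upwards [Ioo_mem_nhdsGT ht.2] with s hs
  exact h t s ht.1.le hs.1.le hs.2.le

lemma BoundedVariationOn.exists_tendsto_nhdsLT {x : ℝ → ℝ} {T t : ℝ}
    (hBV : BoundedVariationOn x (Icc 0 T)) (ht : t ∈ Ioc 0 T) :
    ∃ a, Tendsto x (𝓝[<] t) (𝓝 a) ∧ Tendsto x (𝓝[Ioo 0 t] t) (𝓝 a) := by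
  obtain ⟨a, ha⟩ := hBV.exists_tendsto_left t
  have h : Tendsto x (𝓝[Ioo 0 t] t) (𝓝 a) :=
    ha.mono_left (nhdsWithin_mono t fun s hs => ⟨⟨hs.1.le, hs.2.le.trans ht.2⟩, hs.2⟩)
  exact ⟨a, by rwa [nhdsWithin_Ioo_eq_nhdsLT ht.1] at h, h⟩

lemma BoundedVariationOn.exists_tendsto_nhdsGT {x : ℝ → ℝ} {T t : ℝ}
    (hBV : BoundedVariationOn x (Icc 0 T)) (ht : t ∈ Ico 0 T) :
    ∃ c, Tendsto x (𝓝[>] t) (𝓝 c) ∧ Tendsto x (𝓝[Ioo t T] t) (𝓝 c) := by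
  obtain ⟨c, hc⟩ := hBV.exists_tendsto_right t
  have h : Tendsto x (𝓝[Ioo t T] t) (𝓝 c) :=
    hc.mono_left (nhdsWithin_mono t fun s hs => ⟨⟨ht.1.trans hs.1.le, hs.2.le⟩, hs.1⟩)
  exact ⟨c, by rwa [nhdsWithin_Ioo_eq_nhdsGT ht.2] at h, h⟩

/-- If `x` converges along an open set `S` at `t₀`, then `x` is continuous at the points of `S`
near `t₀`. -/
lemma eventually_continuousAt_of_tendsto {T : ℝ} {E : ℝ → ℝ → ℝ}
    (hE : ContDiff ℝ 3 (Function.uncurry E)) (hH5 : H5cond E T) {x : ℝ → ℝ}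
    (hBV : BoundedVariationOn x (Icc 0 T)) (hWLS : WeakLS E x T) (hED : EDUB E x T)
    {S : Set ℝ} (hS : IsOpen S) (hST : S ⊆ Ioo 0 T) {t₀ y₀ : ℝ} (ht₀ : t₀ ∈ Icc 0 T)
    (hx : Tendsto x (𝓝[S] t₀) (𝓝 y₀)) : ∀ᶠ t in 𝓝[S] t₀, ContinuousAt x t := by
  obtain ⟨ε, hε, H⟩ := exists_nhds_jump_trivial hE (t₀ := t₀) (y₀ := y₀) fun h h0 =>
    eq_empty_iff_forall_notMem.1 hH5 (t₀, y₀) ⟨ht₀, h, h0⟩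
  obtain ⟨C, hC⟩ := hED.exists_sub_le hE hBV
  have hI : ∀ᶠ t in 𝓝[S] t₀, x t ∈ Icc (y₀ - ε) (y₀ + ε) :=
    hx (Icc_mem_nhds (by linarith) (by linarith))
  have hball : ∀ᶠ t in 𝓝[S] t₀, |t - t₀| < ε :=
    nhdsWithin_le_nhds (Metric.ball_mem_nhds t₀ hε)
  filter_upwards [eventually_eventually_nhdsWithin.2 hI, hI, hball, self_mem_nhdsWithin]
    with t htI hxt htε htS
  rw [hS.nhdsWithin_eq htS] at htI
  have htT := hST htS
  obtain ⟨a, ha, ha'⟩ := hBV.exists_tendsto_nhdsLT (Ioo_subset_Ioc_self htT)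
  obtain ⟨c, hc, hc'⟩ := hBV.exists_tendsto_nhdsGT (Ioo_subset_Ico_self htT)
  have haI := isClosed_Icc.mem_of_tendsto ha (htI.filter_mono nhdsWithin_le_nhds)
  have hcI := isClosed_Icc.mem_of_tendsto hc (htI.filter_mono nhdsWithin_le_nhds)
  have hsa : |pEx E t a| ≤ 1 := hWLS.abs_le_of_tendsto hE hBV isOpen_Ioo
    (fun s hs => ⟨hs.1.le, hs.2.le.trans htT.2.le⟩)
    (by rw [closure_Ioo htT.1.ne]; exact right_mem_Icc.2 htT.1.le) ha'
  have hsc : |pEx E t c| ≤ 1 := hWLS.abs_le_of_tendsto hE hBV isOpen_Ioo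
    (fun s hs => ⟨htT.1.le.trans hs.1.le, hs.2.le⟩)
    (by rw [closure_Ioo htT.2.ne]; exact left_mem_Icc.2 htT.2.le) hc'
  obtain ⟨rfl, rfl⟩ := H t htε a haI (x t) hxt c hcI hsa hsc
    (energy_jump_left hE.continuous hC htT ha) (energy_jump_right hE.continuous hC htT hc)
  exact continuousAt_iff_continuous_left'_right'.2 ⟨ha, hc⟩

/-- under (H5), every BV function satisfying the weak local stability and the
energy-dissipation upper bound has only finitely many jumps. -/
theorem finite_jumps
    (T : ℝ) (hT : 0 < T) (E : ℝ → ℝ → ℝ)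
    (hE : ContDiff ℝ 3 (Function.uncurry E))
    (hH5 : H5cond E T)
    (x : ℝ → ℝ) (hBV : BoundedVariationOn x (Set.Icc 0 T))
    (hWLS : WeakLS E x T) (hED : EDUB E x T) :
    (JumpSet x T).Finite := by
  by_contra hinf
  obtain ⟨t₀, ht₀, hacc⟩ := Set.Infinite.exists_accPt_of_subset_isCompact hinf
    (isCompact_Icc (a := (0 : ℝ)) (b := T)) fun t ht => ht.1
  rw [accPt_iff_frequently_nhdsNE, ← nhdsLT_sup_nhdsGT, frequently_sup] at hacc
  rcases hacc with hacc | hacc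
  · have h0 : 0 < t₀ := by
      by_contra! h
      refine hacc ?_
      filter_upwards [self_mem_nhdsWithin] with t ht hJ
      exact absurd hJ.1.1 (not_le.2 (lt_of_lt_of_le ht h))
    obtain ⟨y, -, hy⟩ := hBV.exists_tendsto_nhdsLT ⟨h0, ht₀.2⟩
    have := eventually_continuousAt_of_tendsto hE hH5 hBV hWLS hED isOpen_Ioo
      (Ioo_subset_Ioo_right ht₀.2) ht₀ hy
    rw [nhdsWithin_Ioo_eq_nhdsLT h0] at this
    exact hacc (this.mono fun t ht hJ => hJ.2 ht.continuousWithinAt)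
  · have h0 : t₀ < T := by
      by_contra! h
      refine hacc ?_
      filter_upwards [self_mem_nhdsWithin] with t ht hJ
      exact absurd hJ.1.2 (not_le.2 (lt_of_le_of_lt h ht))
    obtain ⟨y, -, hy⟩ := hBV.exists_tendsto_nhdsGT ⟨ht₀.1, h0⟩
    have := eventually_continuousAt_of_tendsto hE hH5 hBV hWLS hED isOpen_Ioo
      (Ioo_subset_Ioo_left ht₀.1) ht₀ hy
    rw [nhdsWithin_Ioo_eq_nhdsGT h0] at this
    exact hacc (this.mono fun t ht hJ => hJ.2 ht.continuousWithinAt)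
end

section
/- Assume (H5) and let x:[0,T]→ℝ be a BV function satisfying the weak local stability, with L := sup_{0≤t≤T}|x(t)| < ∞. Then there exists ε>0, independent of t, such that for every t∈[0,T] and every pair of distinct points y,z ∈ [−L,L] with |∂ₓ𝓔(t,y)| = 1 = |∂ₓ𝓔(t,z)|, one has |y−z| ≥ ε. -/
open Set Filter Topology MeasureTheory

theorem hasDerivAt_pEx {F : ℝ → ℝ → ℝ} (hF : Differentiable ℝ (Function.uncurry F)) (t y : ℝ) :
    HasDerivAt (F t) (fderiv ℝ (Function.uncurry F) (t, y) (0, 1)) y :=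
  (hF (t, y)).hasFDerivAt.comp_hasDerivAt y ((hasDerivAt_const y t).prodMk (hasDerivAt_id y))

theorem contDiff_uncurry_pEx {F : ℝ → ℝ → ℝ} {m n : WithTop ℕ∞}
    (hF : ContDiff ℝ n (Function.uncurry F)) (hmn : m + 1 ≤ n) :
    ContDiff ℝ m (Function.uncurry (pEx F)) := by
  have hd : Differentiable ℝ (Function.uncurry F) :=
    (hF.of_le (le_trans le_add_self hmn)).differentiable one_ne_zero
  have h : Function.uncurry (pEx F) = fun p => fderiv ℝ (Function.uncurry F) p (0, 1) := by
    ext ⟨t, y⟩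
    exact (hasDerivAt_pEx hd t y).deriv
  rw [h]
  exact (hF.fderiv_right hmn).clm_apply contDiff_const

theorem exists_pExx_eq_zero_of_pEx_eq {E : ℝ → ℝ → ℝ} {t y z : ℝ}
    (hc : Continuous (pEx E t)) (hyz : y ≠ z) (h : pEx E t y = pEx E t z) :
    ∃ c ∈ Set.uIcc y z, pExx E t c = 0 := by
  wlog hlt : y < z generalizing y z
  · rw [Set.uIcc_comm]
    exact this hyz.symm h.symm (lt_of_le_of_ne (not_lt.mp hlt) hyz.symm)
  obtain ⟨c, hcm, h0⟩ := exists_deriv_eq_zero hlt hc.continuousOn h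
  exact ⟨c, Set.Icc_subset_uIcc (Set.Ioo_subset_Icc_self hcm), h0⟩

/-- Near a point where `|∂ₓE| = 1` and `∂ₓₓE = 0` do not both hold, each time slice contains at
most one point with `|∂ₓE| = 1`. -/
theorem exists_ball_abs_pEx_eq_one_unique {E : ℝ → ℝ → ℝ}
    (hG : Continuous (Function.uncurry (pEx E))) (hH : Continuous (Function.uncurry (pExx E)))
    {p : ℝ × ℝ} (hp : |pEx E p.1 p.2| = 1 → pExx E p.1 p.2 ≠ 0) :
    ∃ r > 0, ∀ t y z, (t, y) ∈ Metric.ball p r → (t, z) ∈ Metric.ball p r →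
      |pEx E t y| = 1 → |pEx E t z| = 1 → y = z := by
  by_cases h1 : |pEx E p.1 p.2| = 1
  · have hH' : ∀ᶠ q in 𝓝 p, Function.uncurry (pExx E) q ≠ 0 :=
      hH.continuousAt.eventually_ne (hp h1)
    have hG' : ∀ᶠ q in 𝓝 p,
        dist (Function.uncurry (pEx E) q) (Function.uncurry (pEx E) p) < 1 :=
      hG.continuousAt.eventually (Metric.ball_mem_nhds _ one_pos)
    obtain ⟨r, hr, hball⟩ := Metric.eventually_nhds_iff_ball.mp (hH'.and hG')
    refine ⟨r, hr, fun t y z hy hz hy1 hz1 => ?_⟩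
    by_contra hyz
    have hdy : |pEx E t y - pEx E p.1 p.2| < 1 := (hball _ hy).2
    have hdz : |pEx E t z - pEx E p.1 p.2| < 1 := (hball _ hz).2
    have heq : pEx E t y = pEx E t z := by
      rw [abs_lt] at hdy hdz
      rcases eq_or_eq_neg_of_abs_eq hy1 with a | a <;>
        rcases eq_or_eq_neg_of_abs_eq hz1 with b | b <;> linarith
    obtain ⟨c, hc, h0⟩ := exists_pExx_eq_zero_of_pEx_eq
      (hG.comp (Continuous.prodMk_right t)) hyz heq
    refine (hball (t, c) ?_).1 h0
    rw [← ball_prod_same] at hy hz ⊢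
    refine ⟨hy.1, ?_⟩
    rw [← segment_eq_uIcc] at hc
    exact (convex_ball p.2 r).segment_subset hy.2 hz.2 hc
  · have hG' : ∀ᶠ q in 𝓝 p, |Function.uncurry (pEx E) q| ≠ 1 :=
      hG.abs.continuousAt.eventually_ne h1
    obtain ⟨r, hr, hball⟩ := Metric.eventually_nhds_iff_ball.mp hG'
    exact ⟨r, hr, fun t y z hy _ hy1 _ => absurd hy1 (hball _ hy)⟩

/-- under (H5) and weak local stability, with `L := sup_{[0,T]} |x|`, points of
`[−L,L]` where `|∂ₓ𝓔(t,·)| = 1` are uniformly `ε`-separated, with `ε` independent of `t`. -/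
theorem uniform_separation_of_critical_points
    (T : ℝ) (hT : 0 < T) (E : ℝ → ℝ → ℝ)
    (hE : ContDiff ℝ 3 (Function.uncurry E))
    (hH5 : H5cond E T)
    (x : ℝ → ℝ) (hBV : BoundedVariationOn x (Set.Icc 0 T))
    (hWLS : WeakLS E x T)
    (L : ℝ) (hL : L = ⨆ t : Set.Icc (0:ℝ) T, |x t|) :
    ∃ ε > (0:ℝ), ∀ t ∈ Set.Icc 0 T, ∀ y ∈ Set.Icc (-L) L, ∀ z ∈ Set.Icc (-L) L,
      y ≠ z → |pEx E t y| = 1 → |pEx E t z| = 1 → ε ≤ |y - z| := by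
  have hE1 : ContDiff ℝ 2 (Function.uncurry (pEx E)) := contDiff_uncurry_pEx hE (by norm_num)
  have hE2 : ContDiff ℝ 1 (Function.uncurry (pExx E)) := contDiff_uncurry_pEx hE1 (by norm_num)
  have hcrit : ∀ p : ℝ × ℝ, p ∈ Set.Icc 0 T ×ˢ Set.Icc (-L) L →
      |pEx E p.1 p.2| = 1 → pExx E p.1 p.2 ≠ 0 := fun p hp h1 h0 =>
    Set.eq_empty_iff_forall_notMem.mp hH5 p ⟨hp.1, (eq_or_eq_neg_of_abs_eq h1).symm, h0⟩
  choose! r hr hunique using fun p hp =>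
    exists_ball_abs_pEx_eq_one_unique hE1.continuous hE2.continuous (hcrit p hp)
  have hK : IsCompact (Set.Icc 0 T ×ˢ Set.Icc (-L) L) := isCompact_Icc.prod isCompact_Icc
  obtain ⟨δ, hδ, hcover⟩ := lebesgue_number_lemma_of_metric hK
    (c := fun p : ↥(Set.Icc 0 T ×ˢ Set.Icc (-L) L) => Metric.ball (p : ℝ × ℝ) (r p))
    (fun _ => Metric.isOpen_ball)
    (fun p hp => Set.mem_iUnion.mpr ⟨⟨p, hp⟩, Metric.mem_ball_self (hr p hp)⟩)
  refine ⟨δ, hδ, fun t ht y hy z hz hyz hy1 hz1 => ?_⟩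
  by_contra! hlt
  obtain ⟨⟨p, hp⟩, hsub⟩ := hcover (t, y) ⟨ht, hy⟩
  refine hyz (hunique p hp t y z (hsub (Metric.mem_ball_self hδ)) (hsub ?_) hy1 hz1)
  rw [← ball_prod_same]
  exact ⟨Metric.mem_ball_self hδ, by rwa [Metric.mem_ball, dist_comm, Real.dist_eq]⟩
end

section
/- Let x:[0,T]→ℝ be a right-continuous BV function, with distributional derivative measure μ and singular part μ_s of μ with respect to Lebesgue measure, and let J be the jump set of x. Then the set A := {t∈(0,T)∖J : liminf_{h→0} |(x(t+h)−x(t))/h| < ∞} satisfies |μ_s|(A) = 0. -/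
open Set Filter Topology MeasureTheory

open ProbabilityTheory in
/-- Every real probability measure is the image of Lebesgue measure on `(0, 1)` under a quantile
function, i.e. a map which is Galois-adjoint to the cumulative distribution function. -/
lemma exists_quantile (P : Measure ℝ) [IsProbabilityMeasure P] :
    ∃ τ : ℝ → ℝ, AEMeasurable τ (volume.restrict (Ioo 0 1)) ∧
      Measure.map τ (volume.restrict (Ioo 0 1)) = P ∧
      ∀ y ∈ Ioo (0 : ℝ) 1, ∀ t, τ y ≤ t ↔ y ≤ cdf P t := by
  set τ : ℝ → ℝ := fun y => sInf {t | y ≤ cdf P t}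
  have galois : ∀ y ∈ Ioo (0 : ℝ) 1, ∀ t, τ y ≤ t ↔ y ≤ cdf P t := by
    intro y hy t
    have hne : {t | y ≤ cdf P t}.Nonempty :=
      ((tendsto_cdf_atTop P).eventually_const_le hy.2).exists
    have hbdd : BddBelow {t | y ≤ cdf P t} := by
      obtain ⟨b, hb⟩ := ((tendsto_cdf_atBot P).eventually_lt_const hy.1).exists
      refine ⟨b, fun s hs => ?_⟩
      by_contra! hsb
      have hs' : y ≤ cdf P s := hs
      exact absurd (hs'.trans (monotone_cdf P hsb.le)) hb.not_ge
    refine ⟨fun h => ?_, fun h => csInf_le hbdd h⟩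
    have hlim : Tendsto (cdf P) (𝓝[>] t) (𝓝 (cdf P t)) :=
      ((cdf P).right_continuous t).mono_left (nhdsWithin_mono _ Ioi_subset_Ici_self)
    refine ge_of_tendsto hlim (eventually_nhdsWithin_of_forall fun s hs => ?_)
    obtain ⟨r, hr, hrs⟩ := exists_lt_of_csInf_lt hne (h.trans_lt hs)
    exact le_trans hr (monotone_cdf P hrs.le)
  have hτ : AEMeasurable τ (volume.restrict (Ioo 0 1)) :=
    aemeasurable_restrict_of_monotoneOn measurableSet_Ioo fun y hy z hz hyz =>
      (galois y hy _).2 (hyz.trans ((galois z hz _).1 le_rfl))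
  refine ⟨τ, hτ, ?_, galois⟩
  refine Measure.ext_of_Iic _ _ fun a => ?_
  rw [Measure.map_apply_of_aemeasurable hτ measurableSet_Iic, ← ofReal_cdf P a,
    Measure.restrict_apply₀' measurableSet_Ioo.nullMeasurableSet]
  have h0 := cdf_nonneg P a
  have h1 := cdf_le_one P a
  apply le_antisymm
  · calc volume (τ ⁻¹' Iic a ∩ Ioo 0 1) ≤ volume (Ioc 0 (cdf P a)) :=
          measure_mono fun y hy => ⟨hy.2.1, (galois y hy.2 a).1 hy.1⟩
      _ = _ := by simp
  · calc ENNReal.ofReal (cdf P a) = volume (Ioo 0 (cdf P a)) := by simp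
      _ ≤ volume (τ ⁻¹' Iic a ∩ Ioo 0 1) := measure_mono fun y hy =>
          have hy' : y ∈ Ioo (0 : ℝ) 1 := ⟨hy.1, hy.2.trans_le h1⟩
          ⟨(galois y hy' a).2 hy.2.le, hy'⟩

open ProbabilityTheory in
/-- Differentiation of `∫ f dP` with respect to `P` along intervals with one endpoint at the
base point, at `P`-almost every point where the cumulative distribution function is continuous
and locally injective. -/
lemma ae_tendsto_setIntegral_Iic_div_cdf (P : Measure ℝ) [IsProbabilityMeasure P]
    {f : ℝ → ℝ} (hf : Integrable f P) :
    ∀ᵐ t ∂P, ContinuousAt (cdf P) t → (∀ᶠ s in 𝓝[≠] t, cdf P s ≠ cdf P t) →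
      Tendsto (fun s => ((∫ u in Iic s, f u ∂P) - ∫ u in Iic t, f u ∂P) / (cdf P s - cdf P t))
        (𝓝[≠] t) (𝓝 (f t)) := by
  obtain ⟨τ, hτ, hmap, galois⟩ := exists_quantile P
  set V := cdf P
  set h : ℝ → ℝ := (Ioo (0 : ℝ) 1).indicator (fun y => f (τ y)) with hh
  have hfm : Integrable f (Measure.map τ (volume.restrict (Ioo 0 1))) := hmap ▸ hf
  have hint : Integrable h :=
    (integrable_indicator_iff measurableSet_Ioo).2 (hfm.comp_aemeasurable hτ)
  have hF : ∀ s, ∫ u in Iic s, f u ∂P = ∫ y in Iic (V s), h y := by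
    intro s
    conv_lhs => rw [← hmap]
    rw [setIntegral_map measurableSet_Iic hfm.aestronglyMeasurable hτ,
      Measure.restrict_restrict' measurableSet_Ioo, hh, setIntegral_indicator measurableSet_Ioo]
    congr 2
    ext y
    exact and_congr_left fun hy => galois y hy s
  have hder : ∀ᵐ y, HasDerivAt (fun y => ∫ z in Iic y, h z) (h y) y := by
    filter_upwards [LocallyIntegrable.ae_hasDerivAt_integral hint.locallyIntegrable] with y hy
    refine ((hy 0).add_const (∫ z in Iic (0 : ℝ), h z)).congr_of_eventuallyEq
      (Eventually.of_forall fun z => ?_)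
    have := intervalIntegral.integral_Iic_sub_Iic (hint.integrableOn (s := Iic 0))
      (hint.integrableOn (s := Iic z))
    dsimp only
    linarith
  set N : Set ℝ := toMeasurable volume {y | ¬ HasDerivAt (fun y => ∫ z in Iic y, h z) (h y) y}
  have hN : volume N = 0 := by rw [measure_toMeasurable]; exact hder
  have hbad : P {t | ContinuousAt V t ∧ (V t ∈ N ∨ V t ∉ Ioo 0 1)} = 0 := by
    have hm : MeasurableSet {t | ContinuousAt V t ∧ (V t ∈ N ∨ V t ∉ Ioo 0 1)} :=
      (measurableSet_of_continuousAt V).inter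
        (V.mono.measurable ((measurableSet_toMeasurable _ _).union measurableSet_Ioo.compl))
    conv_lhs => rw [← hmap]
    rw [Measure.map_apply_of_aemeasurable hτ hm,
      Measure.restrict_apply₀' measurableSet_Ioo.nullMeasurableSet]
    refine measure_mono_null ?_ hN
    rintro y ⟨⟨hc, hyN⟩, hy⟩
    have hVτ : V (τ y) = y := by
      refine le_antisymm ?_ ((galois y hy _).1 le_rfl)
      have hlim : Tendsto V (𝓝[<] (τ y)) (𝓝 (V (τ y))) := hc.tendsto.mono_left nhdsWithin_le_nhds
      refine le_of_tendsto hlim (eventually_nhdsWithin_of_forall fun s hs => ?_)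
      by_contra! hlt
      exact absurd ((galois y hy s).2 hlt.le) (not_le.2 hs)
    rw [hVτ] at hyN
    exact hyN.resolve_right (not_not.2 hy)
  filter_upwards [measure_eq_zero_iff_ae_notMem.1 hbad] with t ht hc hinj
  have hyI : V t ∈ Ioo (0 : ℝ) 1 := by
    by_contra hcon
    exact ht ⟨hc, Or.inr hcon⟩
  have hd : HasDerivAt (fun y => ∫ z in Iic y, h z) (h (V t)) (V t) := by
    by_contra hcon
    exact ht ⟨hc, Or.inl (subset_toMeasurable _ _ hcon)⟩
  have hτV : τ (V t) = t := by
    refine le_antisymm ((galois _ hyI t).2 le_rfl) ?_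
    by_contra! hlt
    have hinj' : ∀ᶠ s in 𝓝[<] t, V s ≠ V t :=
      hinj.filter_mono (nhdsWithin_mono _ fun s hs => ne_of_lt hs)
    obtain ⟨s, hs, hsτ, hst⟩ := (hinj'.and (Ioo_mem_nhdsLT hlt)).exists
    exact hs (le_antisymm (V.mono hst.le) ((galois _ hyI s).1 hsτ.le))
  have hval : h (V t) = f t := by rw [hh, indicator_of_mem hyI, hτV]
  rw [hval, hasDerivAt_iff_tendsto_slope] at hd
  have hV : Tendsto V (𝓝[≠] t) (𝓝[≠] (V t)) :=
    tendsto_nhdsWithin_iff.2 ⟨hc.tendsto.mono_left nhdsWithin_le_nhds, hinj⟩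
  refine (hd.comp hV).congr fun s => ?_
  simp only [Function.comp, slope_def_field, hF]

/-- A point which is not an atom of `P` is a continuity point of the cumulative distribution
function. -/
lemma ProbabilityTheory.continuousAt_cdf_of_measure_singleton_eq_zero (P : Measure ℝ)
    [IsProbabilityMeasure P] {t : ℝ} (ht : P {t} = 0) : ContinuousAt (cdf P) t := by
  rw [← measure_cdf P, StieltjesFunction.measure_singleton, ENNReal.ofReal_eq_zero] at ht
  rw [(cdf P).mono.continuousAt_iff_leftLim_eq_rightLim, (cdf P).rightLim_eq]
  exact le_antisymm ((cdf P).mono.leftLim_le le_rfl) (by linarith)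

/-- The total variation of a signed measure vanishes on a measurable set all of whose measurable
subsets have measure zero. -/
lemma totalVariation_eq_zero_of_forall_subset {α : Type*} [MeasurableSpace α]
    (μ : SignedMeasure α) {Z : Set α}
    (hZ : MeasurableSet Z) (h : ∀ E ⊆ Z, MeasurableSet E → μ E = 0) : μ.totalVariation Z = 0 := by
  obtain ⟨i, hi, hi₁, hi₂, hpos, hneg⟩ := μ.toJordanDecomposition_spec
  rw [SignedMeasure.totalVariation, Measure.add_apply, hpos, hneg,
    SignedMeasure.toMeasureOfZeroLE_apply _ _ _ hZ, SignedMeasure.toMeasureOfLEZero_apply _ _ _ hZ]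
  have h₁ := h (i ∩ Z) inter_subset_right (hi.inter hZ)
  have h₂ := h (iᶜ ∩ Z) inter_subset_right (hi.compl.inter hZ)
  simp [h₁, h₂]

/-- The total variation of the singular part vanishes on `A` as soon as the total variation
vanishes on every Lebesgue-null part of `A`. -/
lemma singularPart_totalVariation_eq_zero (μ : SignedMeasure ℝ) {A : Set ℝ}
    (h : ∀ S, MeasurableSet S → volume S = 0 → μ.totalVariation (A ∩ S) = 0) :
    (μ.singularPart volume).totalVariation A = 0 := by
  have key : ∀ p : Measure ℝ, IsFiniteMeasure p → p ≤ μ.totalVariation →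
      p.singularPart volume A = 0 := by
    intro p _ hp
    obtain ⟨S, hS, hS₁, hS₂⟩ := p.mutuallySingular_singularPart volume
    refine measure_mono_null (t := (A ∩ Sᶜ) ∪ S) (fun a ha => ?_) (measure_union_null ?_ hS₁)
    · by_cases haS : a ∈ S
      · exact Or.inr haS
      · exact Or.inl ⟨ha, haS⟩
    · exact le_antisymm ((p.singularPart_le volume _).trans ((hp _).trans (h _ hS.compl hS₂).le))
        bot_le
  rw [SignedMeasure.singularPart_totalVariation, Measure.add_apply,
    key _ inferInstance (Measure.le_add_right le_rfl),
    key _ inferInstance (Measure.le_add_left le_rfl), add_zero]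

/-- If the lower limit of the absolute difference quotients is finite, the increments are
frequently bounded by a fixed multiple of the step. -/
lemma exists_frequently_abs_sub_le_of_liminf_lt_top {x : ℝ → ℝ} {t : ℝ}
    (h : liminf (fun h => ENNReal.ofReal |(x (t + h) - x t) / h|) (𝓝[≠] (0 : ℝ)) < ⊤) :
    ∃ C : ℝ, ∃ᶠ s in 𝓝[≠] t, |x s - x t| ≤ C * |s - t| := by
  obtain ⟨C, hC, hCtop⟩ := exists_between h
  refine ⟨C.toReal, ?_⟩
  have hfreq := frequently_lt_of_liminf_lt (by isBoundedDefault) hC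
  have hmap : Tendsto (fun h => t + h) (𝓝[≠] (0 : ℝ)) (𝓝[≠] t) := by
    refine tendsto_nhdsWithin_iff.2
      ⟨?_, eventually_nhdsWithin_of_forall fun h hh => by simpa using hh⟩
    have : Tendsto (fun h => t + h) (𝓝 (0 : ℝ)) (𝓝 (t + 0)) :=
      (continuous_const_add t).tendsto 0
    simpa using this.mono_left nhdsWithin_le_nhds
  refine hmap.frequently ((hfreq.and_eventually self_mem_nhdsWithin).mono ?_)
  rintro h ⟨hlt, hne⟩
  have hle := (ENNReal.ofReal_le_iff_le_toReal hCtop.ne).1 hlt.le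
  rw [abs_div, div_le_iff₀ (abs_pos.2 hne)] at hle
  simpa using hle

/-- for a right-continuous BV function `x` with derivative measure `μ`, the set
`A` of non-jump points where `liminf_{h→0} |(x(t+h)−x(t))/h| < ∞` is `|μ_s|`-null. -/
theorem singular_part_null_on_finite_liminf_set
    (T : ℝ) (hT : 0 < T) (x : ℝ → ℝ)
    (hBV : BoundedVariationOn x (Set.Icc 0 T))
    (hrc : ∀ t ∈ Set.Ico 0 T, Filter.Tendsto x (𝓝[>] t) (𝓝 (x t)))
    (μ : MeasureTheory.SignedMeasure ℝ) (c : ℝ)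
    (hμ : ∀ t ∈ Set.Icc 0 T, x t = c + μ (Set.Ioc 0 t)) :
    (μ.singularPart MeasureTheory.volume).totalVariation
      {t ∈ Set.Ioo 0 T \ JumpSet x T |
        Filter.liminf (fun h => ENNReal.ofReal |(x (t + h) - x t) / h|) (𝓝[≠] (0:ℝ)) < ⊤}
      = 0 := by
  set ν : Measure ℝ := volume.restrict (Ioc 0 T) + μ.totalVariation
  have hν0 : ν univ ≠ 0 := by simp [ν, hT]
  have : NeZero ν := ⟨fun h => hν0 (by simp [h])⟩
  set P : Measure ℝ := (ν univ)⁻¹ • ν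
  have : IsProbabilityMeasure P := isProbabilityMeasureSMul
  have hνP : ν ≪ P := Measure.absolutelyContinuous_smul (ENNReal.inv_ne_zero.2 (measure_ne_top _ _))
  have hvolP : volume.restrict (Ioc 0 T) ≪ P :=
    (Measure.absolutelyContinuous_of_le (Measure.le_add_right le_rfl)).trans hνP
  have hμP : μ.totalVariation ≪ P :=
    (Measure.absolutelyContinuous_of_le (Measure.le_add_left le_rfl)).trans hνP
  set g : ℝ → ℝ := μ.rnDeriv P
  have hgint : Integrable g P := SignedMeasure.integrable_rnDeriv μ P
  have hμg : ∀ E, MeasurableSet E → μ E = ∫ u in E, g u ∂P := by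
    intro E hE
    rw [← withDensityᵥ_apply hgint hE, SignedMeasure.withDensityᵥ_rnDeriv_eq]
    rw [SignedMeasure.absolutelyContinuous_ennreal_iff,
      VectorMeasure.ennrealToMeasure_toENNRealVectorMeasure]
    exact hμP
  set k : ℝ → ℝ := fun u => ((volume.restrict (Ioc 0 T)).rnDeriv P u).toReal
  have hkint : Integrable k P := Measure.integrable_toReal_rnDeriv
  have hk : ∀ E, ∫ u in E, k u ∂P = (volume.restrict (Ioc 0 T)).real E :=
    fun E => Measure.setIntegral_toReal_rnDeriv hvolP E
  have hkIic : ∀ t ∈ Icc 0 T, ∫ u in Iic t, k u ∂P = t := by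
    intro t ht
    have : Iic t ∩ Ioc 0 T = Ioc 0 t := by
      ext u; simp only [mem_inter_iff, mem_Iic, mem_Ioc]; grind
    rw [hk, measureReal_restrict_apply measurableSet_Iic, this]
    simp [ht.1]
  have hxIic : ∀ t ∈ Icc 0 T, ∫ u in Iic t, g u ∂P = x t - c + ∫ u in Iic 0, g u ∂P := by
    intro t ht
    rw [hμ t ht, hμg _ measurableSet_Ioc, ← Iic_union_Ioc_eq_Iic ht.1,
      setIntegral_union (Iic_disjoint_Ioc le_rfl) measurableSet_Ioc
        hgint.integrableOn hgint.integrableOn]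
    ring
  have hV : ∀ s ∈ Icc 0 T, ∀ t ∈ Icc 0 T, s < t → ProbabilityTheory.cdf P s ≠
      ProbabilityTheory.cdf P t := by
    intro s hs t ht hst heq
    have h0 : P (Ioc s t) = 0 := by
      rw [← ProbabilityTheory.measure_cdf P, StieltjesFunction.measure_Ioc, heq]
      simp
    have h1 := hvolP h0
    rw [Measure.restrict_apply measurableSet_Ioc,
      inter_eq_self_of_subset_left (Ioc_subset_Ioc hs.1 ht.2)] at h1
    simp [hst.not_ge] at h1
  refine singularPart_totalVariation_eq_zero μ fun S hS hS0 => ?_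
  have hkS : ∀ᵐ t ∂P, t ∈ S → k t = 0 := by
    have h0 : ∫ u in S, k u ∂P = 0 := by
      rw [hk, measureReal_def, Measure.absolutelyContinuous_of_le Measure.restrict_le_self hS0,
        ENNReal.toReal_zero]
    rw [setIntegral_eq_zero_iff_of_nonneg_ae (Eventually.of_forall fun _ => ENNReal.toReal_nonneg)
      hkint.integrableOn] at h0
    exact (ae_restrict_iff' hS).1 h0
  have hzero : μ.totalVariation {t | g t = 0} = 0 := by
    have hZ : MeasurableSet {t | g t = 0} :=
      (SignedMeasure.measurable_rnDeriv μ P) (measurableSet_singleton 0)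
    refine totalVariation_eq_zero_of_forall_subset μ hZ fun E hE hEm => ?_
    rw [hμg E hEm]
    exact setIntegral_eq_zero_of_forall_eq_zero fun t ht => hE ht
  have hae : ∀ᵐ t ∂P, t ∈ {t ∈ Set.Ioo 0 T \ JumpSet x T |
        Filter.liminf (fun h => ENNReal.ofReal |(x (t + h) - x t) / h|) (𝓝[≠] (0:ℝ)) < ⊤} ∩ S →
      g t = 0 := by
    filter_upwards [hkS, ae_tendsto_setIntegral_Iic_div_cdf P hgint,
      ae_tendsto_setIntegral_Iic_div_cdf P hkint] with t hkt hgd hkd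
    rintro ⟨⟨⟨htT, htJ⟩, hlim⟩, htS⟩
    have htI : t ∈ Icc 0 T := Ioo_subset_Icc_self htT
    have hnhds : Icc 0 T ∈ 𝓝 t := Icc_mem_nhds htT.1 htT.2
    have hxc : ContinuousAt x t := by
      by_contra hcon
      exact htJ ⟨htI, fun h => hcon (h.continuousAt hnhds)⟩
    by_cases hPt : P {t} = 0
    · have hcont := ProbabilityTheory.continuousAt_cdf_of_measure_singleton_eq_zero P hPt
      have hIcc : ∀ᶠ s in 𝓝[≠] t, s ∈ Icc 0 T := nhdsWithin_le_nhds hnhds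
      have hinj : ∀ᶠ s in 𝓝[≠] t, ProbabilityTheory.cdf P s ≠ ProbabilityTheory.cdf P t := by
        filter_upwards [hIcc, self_mem_nhdsWithin] with s hs hst
        rcases lt_or_gt_of_ne hst with h | h
        · exact hV s hs t htI h
        · exact (hV t htI s hs h).symm
      have hgd := hgd hcont hinj
      have hkd := hkd hcont hinj
      rw [hkt htS] at hkd
      obtain ⟨C, hC⟩ := exists_frequently_abs_sub_le_of_liminf_lt_top hlim
      have hle : |g t| - C * |(0 : ℝ)| ≤ 0 := by
        refine le_of_tendsto_of_frequently (hgd.abs.sub (hkd.abs.const_mul C)) ?_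
        refine (hC.and_eventually (hIcc.and hinj)).mono ?_
        rintro s ⟨hs, hsI, hsV⟩
        rw [hxIic s hsI, hxIic t htI, hkIic s hsI, hkIic t htI, abs_div, abs_div, ← mul_div_assoc,
          ← sub_div]
        refine div_nonpos_of_nonpos_of_nonneg ?_ (abs_nonneg _)
        have : x s - c + ∫ u in Iic 0, g u ∂P - (x t - c + ∫ u in Iic 0, g u ∂P) = x s - x t := by
          ring
        rw [this]
        exact sub_nonpos.2 hs
      simpa using hle
    · have hIoc : ∀ s ∈ Icc 0 T, s ≤ t → ∫ u in Ioc s t, g u ∂P = x t - x s := by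
        intro s hs hst
        have h1 := hxIic t htI
        rw [← Iic_union_Ioc_eq_Iic hst,
          setIntegral_union (Iic_disjoint_Ioc le_rfl) measurableSet_Ioc
          hgint.integrableOn hgint.integrableOn, hxIic s hs] at h1
        linarith
      obtain ⟨u, humono, hut, hu⟩ := exists_seq_strictMono_tendsto t
      have hinter : ⋂ n, Ioc (u n) t = {t} := by
        ext r
        simp only [mem_iInter, mem_Ioc, mem_singleton_iff]
        refine ⟨fun hr => le_antisymm (hr 0).2 (le_of_tendsto' hu fun n => (hr n).1.le), ?_⟩
        rintro rfl n
        exact ⟨hut n, le_rfl⟩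
      have h1 := tendsto_setIntegral_of_antitone (μ := P) (f := g) (s := fun n => Ioc (u n) t)
        (fun _ => measurableSet_Ioc)
        (fun m n hmn => Ioc_subset_Ioc_left (humono.monotone hmn)) ⟨0, hgint.integrableOn⟩
      have h2 : Tendsto (fun n => ∫ r in Ioc (u n) t, g r ∂P) atTop (𝓝 (x t - x t)) := by
        refine (tendsto_const_nhds.sub (hxc.tendsto.comp hu)).congr' ?_
        filter_upwards [hu.eventually_mem hnhds] with n hn
        exact (hIoc _ hn (hut n).le).symm
      have h3 := tendsto_nhds_unique h1 h2
      rw [hinter, integral_singleton, sub_self, smul_eq_mul] at h3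
      exact (mul_eq_zero.1 h3).resolve_left
        (ENNReal.toReal_ne_zero.2 ⟨hPt, measure_ne_top _ _⟩)
  refine measure_mono_null (fun t ht => ?_) (measure_union_null (hμP hae) hzero)
  by_cases hgt : g t = 0
  · exact Or.inr hgt
  · exact Or.inl fun h => hgt (h ht)
end

section
/- Assume the BV function x:[0,T]→ℝ satisfies the weak local stability and the energy-dissipation upper bound, and assume (H1) holds with the stronger requirement that the set there be empty on (0,T). Then the set B := {t∈(0,T)∖J : lim_{h→0} |(x(t+h)−x(t))/h| = ∞} is at most countable; consequently |μ_s|(B) = 0, where μ_s is the singular part of the derivative measure of x. -/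
open Set Filter Topology MeasureTheory

/-- If the difference quotient of `x` blows up at `t`, the increments of a differentiable function
along the graph of `x` are governed by its partial derivative in the second variable. -/
lemma tendsto_increment_div_of_blowup {F : ℝ × ℝ → ℝ} {x : ℝ → ℝ} {t : ℝ}
    (hF : DifferentiableAt ℝ F (t, x t)) (hx : ContinuousAt x t)
    (hB : Tendsto (fun h => |(x (t + h) - x t) / h|) (𝓝[≠] (0 : ℝ)) atTop) :
    Tendsto (fun h => (F (t + h, x (t + h)) - F (t, x t)) / (x (t + h) - x t)) (𝓝[≠] (0 : ℝ))
      (𝓝 (deriv (fun z => F (t, z)) (x t))) := by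
  set L := fderiv ℝ F (t, x t) with hL
  have hd : deriv (fun z => F (t, z)) (x t) = L (0, 1) := by
    have h1 : HasDerivAt (fun z : ℝ => (t, z)) ((0 : ℝ), (1 : ℝ)) (x t) :=
      (hasDerivAt_const _ _).prodMk (hasDerivAt_id _)
    exact (hF.hasFDerivAt.comp_hasDerivAt (x t) h1).deriv
  have hshift : Tendsto (fun h : ℝ => t + h) (𝓝[≠] (0 : ℝ)) (𝓝 t) := by
    have : Tendsto (fun h : ℝ => t + h) (𝓝 0) (𝓝 (t + 0)) :=
      (continuous_const.add continuous_id).tendsto 0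
    rw [add_zero] at this
    exact this.mono_left nhdsWithin_le_nhds
  have hk : Tendsto (fun h : ℝ => (t + h, x (t + h))) (𝓝[≠] (0 : ℝ)) (𝓝 (t, x t)) :=
    hshift.prodMk_nhds (hx.tendsto.comp hshift)
  have ho := hF.hasFDerivAt.isLittleO.comp_tendsto hk
  have hgt : ∀ᶠ h in 𝓝[≠] (0 : ℝ), |h| ≤ |x (t + h) - x t| ∧ x (t + h) - x t ≠ 0 := by
    filter_upwards [hB.eventually_ge_atTop 1, self_mem_nhdsWithin] with h h1 h0
    have h0' : 0 < |h| := abs_pos.2 h0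
    rw [abs_div, le_div_iff₀ h0', one_mul] at h1
    exact ⟨h1, abs_pos.1 (h0'.trans_le h1)⟩
  have hO : (fun h : ℝ => (t + h, x (t + h)) - (t, x t)) =O[𝓝[≠] (0 : ℝ)]
      fun h => x (t + h) - x t := by
    refine Asymptotics.IsBigO.of_bound 1 ?_
    filter_upwards [hgt] with h hh
    simpa [Prod.norm_def] using hh.1
  have hr := (ho.trans_isBigO hO).tendsto_div_nhds_zero
  have hq : Tendsto (fun h => h / (x (t + h) - x t)) (𝓝[≠] (0 : ℝ)) (𝓝 0) := by
    rw [tendsto_zero_iff_abs_tendsto_zero]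
    refine hB.inv_tendsto_atTop.congr fun h => ?_
    simp [abs_div]
  have hsum := (hr.add (hq.mul_const (L (1, 0)))).add_const (L (0, 1))
  rw [hd]
  simp only [zero_mul, zero_add] at hsum
  refine hsum.congr' ?_
  filter_upwards [hgt] with h hh
  have hlin : L ((t + h, x (t + h)) - (t, x t)) = h * L (1, 0) + (x (t + h) - x t) * L (0, 1) := by
    have : (t + h, x (t + h)) - (t, x t)
        = h • ((1 : ℝ), (0 : ℝ)) + (x (t + h) - x t) • ((0 : ℝ), (1 : ℝ)) := by
      ext <;> simp
    rw [this, map_add, map_smul, map_smul, smul_eq_mul, smul_eq_mul]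
  have h0 := hh.2
  simp only [Function.comp_apply, ← hL, hlin]
  field_simp
  ring

lemma contDiff_deriv_snd_s9 {F : ℝ × ℝ → ℝ} {m n : WithTop ℕ∞} (hF : ContDiff ℝ n F)
    (hmn : m + 1 ≤ n) : ContDiff ℝ m fun p : ℝ × ℝ => deriv (fun z => F (p.1, z)) p.2 := by
  have hdiff : Differentiable ℝ F := hF.differentiable (by rintro rfl; simp at hmn)
  have : (fun p : ℝ × ℝ => deriv (fun z => F (p.1, z)) p.2) = fun p => fderiv ℝ F p (0, 1) := by
    ext p
    have h1 : HasDerivAt (fun z : ℝ => (p.1, z)) ((0 : ℝ), (1 : ℝ)) p.2 :=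
      (hasDerivAt_const _ _).prodMk (hasDerivAt_id _)
    exact ((hdiff p).hasFDerivAt.comp_hasDerivAt p.2 h1).deriv
  rw [this]
  exact (hF.fderiv_right hmn).clm_apply contDiff_const

lemma continuous_deriv_fst {F : ℝ × ℝ → ℝ} (hF : ContDiff ℝ 1 F) :
    Continuous fun p : ℝ × ℝ => deriv (fun s => F (s, p.2)) p.1 := by
  have : (fun p : ℝ × ℝ => deriv (fun s => F (s, p.2)) p.1) = fun p => fderiv ℝ F p (1, 0) := by
    ext p
    have h1 : HasDerivAt (fun s : ℝ => (s, p.2)) ((1 : ℝ), (0 : ℝ)) p.1 :=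
      (hasDerivAt_id _).prodMk (hasDerivAt_const _ _)
    exact ((hF.differentiable one_ne_zero p).hasFDerivAt.comp_hasDerivAt p.1 h1).deriv
  rw [this]
  exact (hF.continuous_fderiv one_ne_zero).clm_apply continuous_const

lemma abs_sub_le_diss {x : ℝ → ℝ} {T a b : ℝ} (hBV : BoundedVariationOn x (Icc 0 T))
    (ha : 0 ≤ a) (hab : a ≤ b) (hb : b ≤ T) : |x b - x a| ≤ Diss x a b := by
  have hfin : eVariationOn x (Icc a b) ≠ ⊤ := hBV.mono (Icc_subset_Icc ha hb)
  have h := eVariationOn.edist_le x (right_mem_Icc.2 hab) (left_mem_Icc.2 hab)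
  have h' := ENNReal.toReal_mono hfin h
  rwa [edist_dist, ENNReal.toReal_ofReal dist_nonneg, Real.dist_eq] at h'

/-- A function of bounded variation is continuous at some point of every open interval. -/
lemma exists_continuousAt_of_boundedVariationOn {x : ℝ → ℝ} {T a b : ℝ}
    (hBV : BoundedVariationOn x (Icc 0 T)) (ha : 0 ≤ a) (hab : a < b) (hb : b ≤ T) :
    ∃ s ∈ Ioo a b, ContinuousAt x s := by
  have hae := hBV.locallyBoundedVariationOn.ae_differentiableWithinAt_of_mem
  by_contra! hcon
  have hnull : volume (Ioo a b) = 0 := by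
    refine measure_mono_null (fun s hs => ?_) hae
    intro hd
    have hs' : s ∈ Ioo 0 T := ⟨ha.trans_lt hs.1, hs.2.trans_le hb⟩
    exact hcon s hs ((hd (Ioo_subset_Icc_self hs')).continuousWithinAt.continuousAt
      (Icc_mem_nhds hs'.1 hs'.2))
  simp [Real.volume_Ioo, hab.not_ge] at hnull

lemma frequently_right_of_continuousAt {x : ℝ → ℝ} {T t : ℝ}
    (hBV : BoundedVariationOn x (Icc 0 T)) (ht : t ∈ Ioo 0 T) :
    ∃ᶠ h in 𝓝[>] (0 : ℝ), t + h ∈ Ioo 0 T ∧ ContinuousAt x (t + h) := by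
  rw [(nhdsGT_basis (0 : ℝ)).frequently_iff]
  intro ε hε
  have hlt : t < min (t + ε) T := lt_min (by linarith) ht.2
  obtain ⟨s, hs, hc⟩ := exists_continuousAt_of_boundedVariationOn hBV ht.1.le hlt (min_le_right _ _)
  have h1 := hs.2.trans_le (min_le_left _ _)
  have h2 := hs.2.trans_le (min_le_right _ _)
  refine ⟨s - t, ⟨by linarith [hs.1], by linarith⟩, ?_⟩
  rw [add_sub_cancel]
  exact ⟨⟨ht.1.trans hs.1, h2⟩, hc⟩

lemma frequently_left_of_continuousAt {x : ℝ → ℝ} {T t : ℝ}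
    (hBV : BoundedVariationOn x (Icc 0 T)) (ht : t ∈ Ioo 0 T) :
    ∃ᶠ h in 𝓝[<] (0 : ℝ), t + h ∈ Ioo 0 T ∧ ContinuousAt x (t + h) := by
  rw [(nhdsLT_basis (0 : ℝ)).frequently_iff]
  intro ε hε
  have hlt : max (t + ε) 0 < t := max_lt (by linarith) ht.1
  obtain ⟨s, hs, hc⟩ := exists_continuousAt_of_boundedVariationOn hBV (le_max_right _ _) hlt ht.2.le
  have h1 := (le_max_left _ _).trans_lt hs.1
  have h2 := (le_max_right _ _).trans_lt hs.1
  refine ⟨s - t, ⟨by linarith, by linarith [hs.2]⟩, ?_⟩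
  rw [add_sub_cancel]
  exact ⟨⟨h2, hs.2.trans ht.2⟩, hc⟩

lemma continuousAt_of_notMem_jumpSet {x : ℝ → ℝ} {T t : ℝ} (ht : t ∈ Ioo 0 T \ JumpSet x T) :
    ContinuousAt x t := by
  have h : ContinuousWithinAt x (Icc 0 T) t := by
    by_contra hc
    exact ht.2 ⟨Ioo_subset_Icc_self ht.1, hc⟩
  exact h.continuousAt (Icc_mem_nhds ht.1.1 ht.1.2)

/-- The energy-dissipation upper bound near a continuity point, in difference-quotient form. -/
lemma EDUB.exists_eventually_mul_le {T : ℝ} {E : ℝ → ℝ → ℝ} {x : ℝ → ℝ} {t : ℝ}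
    (hE : ContDiff ℝ 1 (Function.uncurry E)) (hBV : BoundedVariationOn x (Icc 0 T))
    (hED : EDUB E x T) (ht : t ∈ Ioo 0 T) (hx : ContinuousAt x t) :
    ∃ C : ℝ, ∀ᶠ h in 𝓝[≠] (0 : ℝ),
      (E (t + h) (x (t + h)) - E t (x t)) / h ≤ C - |(x (t + h) - x t) / h| := by
  have hcont : ContinuousAt (fun s => pEt E s (x s)) t :=
    ((continuous_deriv_fst hE).continuousAt (x := (t, x t))).comp_of_eq
      (continuousAt_id.prodMk hx) rfl
  set C := |pEt E t (x t)| + 1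
  have hbd : ∀ᶠ s in 𝓝 t, |pEt E s (x s)| < C ∧ s ∈ Ioo 0 T :=
    (hcont.abs.eventually_lt_const (lt_add_one _)).and (Ioo_mem_nhds ht.1 ht.2)
  obtain ⟨δ, hδ, hball⟩ := Metric.eventually_nhds_iff.1 hbd
  refine ⟨C, ?_⟩
  have hsmall : ∀ᶠ h in 𝓝[≠] (0 : ℝ), |h| < δ := by
    refine nhdsWithin_le_nhds ?_
    simpa [Metric.ball, Real.dist_eq] using Metric.ball_mem_nhds (0 : ℝ) hδ
  have key : ∀ a b : ℝ, a < b → |a - t| < δ → |b - t| < δ →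
      (E b (x b) - E a (x a)) / (b - a) ≤ C - |(x b - x a) / (b - a)| := by
    intro a b hab ha hb
    have ha' := (hball (y := a) (by rwa [Real.dist_eq])).2
    have hb' := (hball (y := b) (by rwa [Real.dist_eq])).2
    have hint : ‖∫ s in a..b, pEt E s (x s)‖ ≤ C * |b - a| := by
      refine intervalIntegral.norm_integral_le_of_norm_le_const fun s hs => ?_
      rw [uIoc_of_le hab.le] at hs
      refine ((hball ?_).1).le
      rw [Real.dist_eq, abs_lt] at *
      constructor <;> linarith [hs.1, hs.2, ha.1, hb.2]
    have h1 := hED a b ha'.1.le hab.le hb'.2.le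
    have h2 := abs_sub_le_diss hBV ha'.1.le hab.le hb'.2.le
    have hpos : 0 < b - a := sub_pos.2 hab
    rw [abs_of_pos hpos, Real.norm_eq_abs] at hint
    rw [abs_div, abs_of_pos hpos, div_le_iff₀ hpos, sub_mul, div_mul_cancel₀ _ hpos.ne']
    linarith [le_abs_self (∫ s in a..b, pEt E s (x s))]
  filter_upwards [hsmall, self_mem_nhdsWithin] with h hh h0
  rcases lt_or_gt_of_ne (show h ≠ 0 from h0) with hneg | hpos
  · have := key (t + h) t (by linarith) (by simpa using hh) (by simpa using hδ)
    have e : t - (t + h) = -h := by ring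
    rw [e, ← neg_sub (E (t + h) _), ← neg_sub (x (t + h)), neg_div_neg_eq, neg_div_neg_eq] at this
    exact this
  · have := key t (t + h) (by linarith) (by simpa using hδ) (by simpa using hh)
    rwa [add_sub_cancel_left] at this

/-- At a blow-up point the stability constraint is active, and `x` moves locally in the direction
opposite to `∂ₓ𝓔`. -/
lemma EDUB.pEx_of_blowup {T : ℝ} {E : ℝ → ℝ → ℝ} {x : ℝ → ℝ} {t : ℝ}
    (hE : ContDiff ℝ 1 (Function.uncurry E)) (hBV : BoundedVariationOn x (Icc 0 T))
    (hWLS : WeakLS E x T) (hED : EDUB E x T) (ht : t ∈ Ioo 0 T) (hx : ContinuousAt x t)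
    (hB : Tendsto (fun h => |(x (t + h) - x t) / h|) (𝓝[≠] (0 : ℝ)) atTop) :
    |pEx E t (x t)| = 1 ∧
      ∀ᶠ h in 𝓝[≠] (0 : ℝ), pEx E t (x t) * ((x (t + h) - x t) / h) < 0 := by
  obtain ⟨C, hC⟩ := hED.exists_eventually_mul_le hE hBV ht hx
  have hlim : Tendsto (fun h => (E (t + h) (x (t + h)) - E t (x t)) / (x (t + h) - x t))
      (𝓝[≠] (0 : ℝ)) (𝓝 (pEx E t (x t))) :=
    tendsto_increment_div_of_blowup (hE.differentiable one_ne_zero _) hx hB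
  set p := pEx E t (x t) with hp
  have hstep : ∀ᶠ h in 𝓝[≠] (0 : ℝ),
      (E (t + h) (x (t + h)) - E t (x t)) / (x (t + h) - x t) * ((x (t + h) - x t) / h)
        ≤ C - |(x (t + h) - x t) / h| := by
    filter_upwards [hC, hB.eventually_gt_atTop 0] with h h1 h2
    have : x (t + h) - x t ≠ 0 := by
      intro h3
      simp [h3] at h2
    rwa [div_mul_div_cancel₀ this]
  have hinv : Tendsto (fun h => C * |(x (t + h) - x t) / h|⁻¹) (𝓝[≠] (0 : ℝ)) (𝓝 0) := by
    simpa using hB.inv_tendsto_atTop.const_mul C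
  have hge : 1 ≤ |p| := by
    have hle : ∀ᶠ h in 𝓝[≠] (0 : ℝ), 1 - C * |(x (t + h) - x t) / h|⁻¹ ≤
        |(E (t + h) (x (t + h)) - E t (x t)) / (x (t + h) - x t)| := by
      filter_upwards [hstep, hB.eventually_gt_atTop 0] with h h1 h2
      set q := (x (t + h) - x t) / h
      set R := (E (t + h) (x (t + h)) - E t (x t)) / (x (t + h) - x t)
      have h3 : -(|R| * |q|) ≤ R * q := by
        rw [← abs_mul]
        exact neg_abs_le _
      refine le_of_mul_le_mul_right ?_ h2
      rw [sub_mul, mul_assoc, inv_mul_cancel₀ h2.ne']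
      linarith
    simpa using le_of_tendsto_of_tendsto (tendsto_const_nhds.sub hinv) hlim.abs hle
  have hle : |p| ≤ 1 :=
    hWLS t (Ioo_subset_Icc_self ht) hx.continuousWithinAt
  refine ⟨le_antisymm hle hge, ?_⟩
  have hp2 : 0 < p * p := by
    rw [← abs_mul_abs_self]
    positivity
  filter_upwards [hstep, hB.eventually_gt_atTop C, (hlim.const_mul p).eventually_const_lt hp2]
    with h h1 h2 h3
  set q := (x (t + h) - x t) / h
  set R := (E (t + h) (x (t + h)) - E t (x t)) / (x (t + h) - x t)
  have h4 : R * q < 0 := by linarith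
  by_contra! h5
  have h6 : (p * R) * (p * q) < 0 := by
    have : (p * R) * (p * q) = (p * p) * (R * q) := by ring
    rw [this]
    exact mul_neg_of_pos_of_neg hp2 h4
  exact absurd (mul_nonneg h3.le h5) (not_le.2 h6)

/-- At a blow-up point the second derivative of the energy in the state variable vanishes. -/
lemma EDUB.pExx_of_blowup {T : ℝ} {E : ℝ → ℝ → ℝ} {x : ℝ → ℝ} {t : ℝ}
    (hE : ContDiff ℝ 2 (Function.uncurry E)) (hBV : BoundedVariationOn x (Icc 0 T))
    (hWLS : WeakLS E x T) (hED : EDUB E x T) (ht : t ∈ Ioo 0 T) (hx : ContinuousAt x t)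
    (hB : Tendsto (fun h => |(x (t + h) - x t) / h|) (𝓝[≠] (0 : ℝ)) atTop) :
    pExx E t (x t) = 0 := by
  obtain ⟨hp, hsign⟩ := hED.pEx_of_blowup (hE.of_le one_le_two) hBV hWLS ht hx hB
  have hG : ContDiff ℝ 1 (fun q : ℝ × ℝ => pEx E q.1 q.2) :=
    contDiff_deriv_snd_s9 hE (by norm_num [one_add_one_eq_two])
  have hlim : Tendsto
      (fun h => (pEx E (t + h) (x (t + h)) - pEx E t (x t)) / (x (t + h) - x t))
      (𝓝[≠] (0 : ℝ)) (𝓝 (pExx E t (x t))) :=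
    tendsto_increment_div_of_blowup (hG.differentiable one_ne_zero _) hx hB
  set p := pEx E t (x t) with hpdef
  have hpp : p * p = 1 := by rw [← abs_mul_abs_self, hp, one_mul]
  have hmono : ∀ h, t + h ∈ Ioo 0 T ∧ ContinuousAt x (t + h) →
      p * (pEx E (t + h) (x (t + h)) - p) ≤ 0 := by
    intro h hh
    have h1 := hWLS (t + h) (Ioo_subset_Icc_self hh.1) hh.2.continuousWithinAt
    have h2 : p * pEx E (t + h) (x (t + h)) ≤ 1 :=
      (le_abs_self _).trans (by rwa [abs_mul, hp, one_mul])
    rw [mul_sub, hpp]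
    linarith
  have hquot : ∀ a b : ℝ, a / b = (p * a) / (p * b) := fun a b =>
    (mul_div_mul_left a b (by rintro h0; simp [h0] at hpp)).symm
  refine le_antisymm ?_ ?_
  · refine le_of_tendsto_of_frequently (hlim.mono_left (nhdsLT_le_nhdsNE 0)) ?_
    refine ((frequently_left_of_continuousAt hBV ht).and_eventually
      ((hsign.filter_mono (nhdsLT_le_nhdsNE 0)).and self_mem_nhdsWithin)).mono ?_
    rintro h ⟨hc, hs, hneg⟩
    rw [hquot]
    refine div_nonpos_of_nonpos_of_nonneg (hmono h hc) ?_
    rw [← mul_div_assoc] at hs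
    by_contra! hcon
    exact absurd (div_pos_of_neg_of_neg hcon hneg) (not_lt.2 hs.le)
  · refine ge_of_tendsto_of_frequently (hlim.mono_left (nhdsGT_le_nhdsNE 0)) ?_
    refine ((frequently_right_of_continuousAt hBV ht).and_eventually
      ((hsign.filter_mono (nhdsGT_le_nhdsNE 0)).and self_mem_nhdsWithin)).mono ?_
    rintro h ⟨hc, hs, hpos⟩
    rw [hquot]
    refine div_nonneg_of_nonpos (hmono h hc) ?_
    rw [← mul_div_assoc] at hs
    by_contra! hcon
    exact absurd (div_pos hcon hpos) (not_lt.2 hs.le)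

lemma signedMeasure_singleton_eq_zero {μ : SignedMeasure ℝ} {x : ℝ → ℝ} {T c t : ℝ}
    (hμ : ∀ s ∈ Icc 0 T, x s = c + μ (Ioc 0 s)) (ht : t ∈ Ioo 0 T) (hx : ContinuousAt x t) :
    μ {t} = 0 := by
  obtain ⟨u, hu, hu', hlim⟩ := exists_seq_strictMono_tendsto' ht.1
  have hset : ⋂ n, Ioc (u n) t = {t} := by
    ext s
    simp only [mem_iInter, mem_Ioc, mem_singleton_iff]
    constructor
    · intro hs
      exact le_antisymm (hs 0).2 (le_of_tendsto' hlim fun n => (hs n).1.le)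
    · rintro rfl n
      exact ⟨(hu' n).2, le_rfl⟩
  have h1 : Tendsto (fun n => μ (Ioc (u n) t)) atTop (𝓝 (μ (⋂ n, Ioc (u n) t))) :=
    VectorMeasure.tendsto_vectorMeasure_iInter_atTop_nat
      (fun m n hmn => Ioc_subset_Ioc_left (hu.monotone hmn)) (fun n => measurableSet_Ioc)
  have h2 : ∀ n, μ (Ioc (u n) t) = x t - x (u n) := by
    intro n
    have hsplit : μ (Ioc 0 (u n)) + μ (Ioc (u n) t) = μ (Ioc 0 t) := by
      rw [← VectorMeasure.of_union (Ioc_disjoint_Ioc_of_le le_rfl) measurableSet_Ioc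
        measurableSet_Ioc, Ioc_union_Ioc_eq_Ioc (hu' n).1.le (hu' n).2.le]
    rw [hμ t (Ioo_subset_Icc_self ht), hμ (u n) ⟨(hu' n).1.le, ((hu' n).2.trans ht.2).le⟩,
      ← hsplit]
    ring
  have h3 : Tendsto (fun n => x t - x (u n)) atTop (𝓝 (x t - x t)) :=
    tendsto_const_nhds.sub (hx.tendsto.comp hlim)
  simp only [h2] at h1
  rw [← hset]
  exact (tendsto_nhds_unique h1 h3).trans (sub_self _)

lemma totalVariation_singularPart_singleton {α : Type*} [MeasurableSpace α]
    [MeasurableSingletonClass α] {μ : SignedMeasure α} (ν : Measure α) {a : α} (ha : μ {a} = 0) :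
    (μ.singularPart ν).totalVariation {a} = 0 := by
  have hinter : ∀ i : Set α, μ (i ∩ {a}) = 0 := by
    intro i
    rcases Set.subset_singleton_iff_eq.1 (inter_subset_right : i ∩ {a} ⊆ {a}) with h | h <;>
      simp [h, ha]
  obtain ⟨i, hi, hi₂, hi₃, hpos, hneg⟩ := μ.toJordanDecomposition_spec
  have h1 : μ.toJordanDecomposition.posPart {a} = 0 := by
    rw [hpos, SignedMeasure.toMeasureOfZeroLE_apply _ _ hi (measurableSet_singleton a)]
    simp [hinter]
  have h2 : μ.toJordanDecomposition.negPart {a} = 0 := by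
    rw [hneg, SignedMeasure.toMeasureOfLEZero_apply _ _ hi.compl (measurableSet_singleton a)]
    simp [hinter]
  rw [SignedMeasure.singularPart_totalVariation, Measure.add_apply,
    Measure.absolutelyContinuous_of_le (Measure.singularPart_le _ _) h1,
    Measure.absolutelyContinuous_of_le (Measure.singularPart_le _ _) h2, add_zero]

/-- under weak local stability, the energy-dissipation upper bound and the
(strengthened, empty) version of (H1), the set `B` of non-jump points where the difference
quotient blows up is at most countable; consequently `|μ_s|(B) = 0`. -/
theorem blowup_set_countable
    (T : ℝ) (hT : 0 < T) (E : ℝ → ℝ → ℝ)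
    (hE : ContDiff ℝ 3 (Function.uncurry E))
    (x : ℝ → ℝ) (hBV : BoundedVariationOn x (Set.Icc 0 T))
    (hWLS : WeakLS E x T) (hED : EDUB E x T)
    (hH1' : {p : ℝ × ℝ | p.1 ∈ Set.Ioo 0 T ∧ (pEx E p.1 p.2 = -1 ∨ pEx E p.1 p.2 = 1) ∧
      pExx E p.1 p.2 = 0 ∧ pExxx E p.1 p.2 = 0} = ∅)
    (μ : MeasureTheory.SignedMeasure ℝ) (c : ℝ)
    (hμ : ∀ t ∈ Set.Icc 0 T, x t = c + μ (Set.Ioc 0 t)) :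
    Set.Countable {t ∈ Set.Ioo 0 T \ JumpSet x T |
        Filter.Tendsto (fun h => |(x (t + h) - x t) / h|) (𝓝[≠] (0:ℝ)) Filter.atTop} ∧
    (μ.singularPart MeasureTheory.volume).totalVariation
      {t ∈ Set.Ioo 0 T \ JumpSet x T |
        Filter.Tendsto (fun h => |(x (t + h) - x t) / h|) (𝓝[≠] (0:ℝ)) Filter.atTop} = 0 := by
  set B := {t ∈ Set.Ioo 0 T \ JumpSet x T |
        Filter.Tendsto (fun h => |(x (t + h) - x t) / h|) (𝓝[≠] (0:ℝ)) Filter.atTop} with hBdef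
  have hcount : B.Countable := by
    have hpExx : ∀ t ∈ B, pExx E t (x t) = 0 := fun t ht =>
      hED.pExx_of_blowup (hE.of_le (by norm_num)) hBV hWLS ht.1.1
        (continuousAt_of_notMem_jumpSet ht.1) ht.2
    have hG : ContDiff ℝ 2 (fun q : ℝ × ℝ => pEx E q.1 q.2) :=
      contDiff_deriv_snd_s9 hE (by norm_num)
    have hGG : ContDiff ℝ 1 (fun q : ℝ × ℝ => pExx E q.1 q.2) :=
      contDiff_deriv_snd_s9 hG (by norm_num)
    refine (countable_setOfPred_isolated_right_within (s := B)).mono fun t (ht : t ∈ B) => ?_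
    refine ⟨ht, ?_⟩
    have hx := continuousAt_of_notMem_jumpSet ht.1
    have hlim : Tendsto
        (fun h => (pExx E (t + h) (x (t + h)) - pExx E t (x t)) / (x (t + h) - x t))
        (𝓝[≠] (0 : ℝ)) (𝓝 (pExxx E t (x t))) :=
      tendsto_increment_div_of_blowup (hGG.differentiable one_ne_zero _) hx ht.2
    have hne : pExxx E t (x t) ≠ 0 := by
      intro h0
      have h1 := (hED.pEx_of_blowup (hE.of_le (by norm_num)) hBV hWLS ht.1.1 hx ht.2).1
      refine Set.eq_empty_iff_forall_notMem.1 hH1' (t, x t) ⟨ht.1.1, ?_, hpExx t ht, h0⟩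
      exact (eq_or_eq_neg_of_abs_eq h1).symm
    have hev := (hlim.eventually_ne hne).filter_mono (nhdsGT_le_nhdsNE 0)
    obtain ⟨ε, hε, hsub⟩ := (nhdsGT_basis (0 : ℝ)).eventually_iff.1 hev
    refine empty_mem_iff_bot.1 (mem_nhdsWithin.2 ⟨Iio (t + ε), isOpen_Iio, by simpa using hε, ?_⟩)
    rintro s ⟨hs2, hs, hs1⟩
    have := hsub (x := s - t) ⟨sub_pos.2 hs1, sub_lt_iff_lt_add'.2 hs2⟩
    rw [add_sub_cancel, hpExx s hs, hpExx t ht] at this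
    simp at this
  refine ⟨hcount, ?_⟩
  rw [← Set.biUnion_of_singleton B, measure_biUnion_null_iff hcount]
  exact fun t ht => totalVariation_singularPart_singleton _
    (signedMeasure_singleton_eq_zero hμ ht.1.1 (continuousAt_of_notMem_jumpSet ht.1))
end
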